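/- Let g be the finite-dimensional simple Lie algebra of type E₈ over ℂ. Every nilpotent element e of g with dim g_e = 134 satisfies dim [g_e,g_e] = 133 and e ∉ [g_e,g_e]. (The unique nilpotent orbit of E₈ with centralizer dimension 134 is A₂, whose abelianized centralizer g_e/[g_e,g_e] is one-dimensional and which is not reachable.) -/

import Mathlib

/-- The centralizer `g_e` of `e`, i.e. the kernel of `ad e`. -/
noncomputable def centralizer (e : LieAlgebra.e₈ ℂ) : Submodule ℂ (LieAlgebra.e₈ ℂ) :=
  LinearMap.ker (LieAlgebra.ad ℂ (LieAlgebra.e₈ ℂ) e)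

/-- The derived subalgebra `[g_e, g_e]` of the centralizer, as the linear span of all
brackets of pairs of elements of `g_e`. -/
noncomputable def derived (e : LieAlgebra.e₈ ℂ) : Submodule ℂ (LieAlgebra.e₈ ℂ) :=
  Submodule.span ℂ
    {z : LieAlgebra.e₈ ℂ | ∃ x ∈ centralizer e, ∃ y ∈ centralizer e, ⁅x, y⁆ = z}

namespace EEight

/-- The positive roots of `E₈`.  A root `v` is stored as the base-four number whose `j`-th digit is
`(v, α_j) + 1`. -/
def posRoots : List ℕ :=
  [
    21831, 21789, 21812, 21697, 21269, 19541, 12629, 50517, 21798, 21641, 21664, 21121,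
    18965, 10325, 41301, 21650, 21608, 21065, 21088, 18817, 9749, 38997, 21594, 21074,
    21032, 18761, 18784, 9601, 38421, 21018, 18770, 20884, 18728, 9545, 9568, 38273, 20870,
    18714, 9554, 18580, 9512, 38217, 38240, 20837, 18566, 9498, 38226, 18004, 9364, 38184,
    18533, 17990, 9350, 38170, 8788, 38036, 17957, 9317, 8774, 38022, 6484, 37460, 17809,
    8741, 37989, 6470, 37446, 35156, 17753, 8593, 6437, 37413, 35142, 25940, 8537, 6289,
    37265, 35109, 25926, 6233, 37209, 5713, 34961, 25893, 5657, 34905, 34385, 25745, 5509,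
    34329, 25689, 25169, 5476, 34181, 25113, 22865, 5462, 34148, 24965, 22809, 34134, 24932,
    22661, 24918, 22628, 22085, 22614, 22052, 22038, 21904, 21890, 21848, 21834, 21857,
    21801, 21653, 21077, 18773, 9557, 38229]

/-- The code of the `j`-th simple root. -/
def simple : Fin 8 → ℕ := ![21831, 21789, 21812, 21697, 21269, 19541, 12629, 50517]

/-- The pairing `(v, α_j)` of a root with a simple root. -/
def wt (n : ℕ) (j : Fin 8) : ℤ := ((n / 4 ^ (j : ℕ) % 4 : ℕ) : ℤ) - 1

/-- The Cartan matrix of type `E₈`. -/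
def cm : Fin 8 → Fin 8 → ℤ := CartanMatrix.E₈

/-- The code of `v + α_j`. -/
def up (n : ℕ) (j : Fin 8) : ℕ := n + simple j - 21845

/-- The code of `v - α_j`. -/
def dn (n : ℕ) (j : Fin 8) : ℕ := n + 21845 - simple j

/-- The height of a root. -/
def ht (n : ℕ) : ℕ :=
  (46 * wt n 0 + 68 * wt n 1 + 91 * wt n 2 + 135 * wt n 3 + 110 * wt n 4 + 84 * wt n 5 +
    57 * wt n 6 + 29 * wt n 7).toNat

theorem posRoots_up : ∀ n ∈ posRoots, ∀ j, wt n j = -1 →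
    up n j ∈ posRoots ∧ dn (up n j) j = n ∧ ht (up n j) = ht n + 1 ∧
      ∀ k, wt (up n j) k = wt n k + cm j k := by
  decide +kernel

theorem posRoots_dn : ∀ n ∈ posRoots, ∀ j, wt n j = 1 →
    dn n j ∈ posRoots ∧ up (dn n j) j = n ∧ ht n = ht (dn n j) + 1 ∧
      ∀ k, wt (dn n j) k = wt n k - cm j k := by
  decide +kernel

theorem posRoots_two : ∀ n ∈ posRoots, ∀ j, wt n j = 2 → n = simple j := by
  decide +kernel

theorem posRoots_range : ∀ n ∈ posRoots, ∀ j, -1 ≤ wt n j ∧ wt n j ≤ 2 := by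
  decide +kernel

theorem posRoots_simple_or : ∀ n ∈ posRoots, (∃ j, wt n j = 1) ∨ ∃ j, n = simple j := by
  decide +kernel

theorem simple_facts : ∀ j, simple j ∈ posRoots ∧ ht (simple j) = 1 ∧
    ∀ k, wt (simple j) k = cm j k := by
  decide +kernel

theorem simple_injective : Function.Injective simple := by
  decide +kernel

theorem ht_pos : ∀ n ∈ posRoots, 0 < ht n := by
  decide +kernel

theorem posRoots_nodup : posRoots.Nodup := by
  decide +kernel

theorem cm_symm : ∀ i j, cm i j = cm j i := by
  decide +kernel

theorem cm_diag : ∀ i, cm i i = 2 := by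
  decide +kernel

theorem cm_offdiag : ∀ i j, i ≠ j → cm i j = 0 ∨ cm i j = -1 := by
  decide +kernel

theorem dn_simple_up : ∀ i j, cm i j = -1 → dn (up (simple i) j) i = simple j := by
  decide +kernel

theorem dn_up_comm : ∀ n ∈ posRoots, ∀ i j, i ≠ j → wt n i = 1 → wt n j = -1 →
    dn (up n j) i = up (dn n i) j := by
  decide +kernel

theorem dn_dn_comm : ∀ n ∈ posRoots, ∀ i j, wt n i = 1 → wt n j = 1 → cm i j = 0 →
    up (dn (dn n i) j) i = dn n j := by
  decide +kernel

/-- The coefficients of the element `ρ^∨` in the simple coroots. -/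
def rhoCoeff : Fin 8 → ℤ := ![46, 68, 91, 135, 110, 84, 57, 29]

theorem ht_eq : ∀ n ∈ posRoots, (ht n : ℤ) = ∑ i, rhoCoeff i * wt n i := by
  decide +kernel

/-- Coefficients of a regular coweight taking distinct values on the positive roots. -/
def sepCoeff : Fin 8 → ℤ := fun i => 100000 * rhoCoeff i + 4 ^ (i : ℕ)

theorem sep_pos : ∀ n ∈ posRoots, 0 < ∑ i, sepCoeff i * wt n i := by
  decide +kernel

theorem sep_inj : ∀ n ∈ posRoots, ∀ m ∈ posRoots,
    ∑ i, sepCoeff i * wt n i = ∑ i, sepCoeff i * wt m i → n = m := by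
  have h : (posRoots.map fun n => ∑ i, sepCoeff i * wt n i).Nodup := by decide +kernel
  intro n hn m hm
  exact List.inj_on_of_nodup_map h hn hm

theorem closed_eq_univ : ∀ S : Finset (Fin 8), S.Nonempty →
    (∀ i ∈ S, ∀ j, cm i j ≠ 0 → j ∈ S) → S = Finset.univ := by
  decide +kernel

theorem cm_det : Matrix.det (Matrix.of fun i j => (cm i j : ℂ)) = 1 := by
  have h : (Matrix.of fun i j => (cm i j : ℂ)) = CartanMatrix.E₈.map (Int.castRingHom ℂ) := rfl
  rw [h, ← RingHom.mapMatrix_apply, ← RingHom.map_det, CartanMatrix.E₈_det]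
  simp

end EEight

namespace EEight

/-- Chevalley generators of type `E₈` acting locally nilpotently. -/
structure IsSerre {L : Type*} [LieRing L] [LieAlgebra ℂ L] (H E F : Fin 8 → L) : Prop where
  hh : ∀ i j, ⁅H i, H j⁆ = 0
  ef : ∀ i, ⁅E i, F i⁆ = H i
  ef_ne : ∀ i j, i ≠ j → ⁅E i, F j⁆ = 0
  he : ∀ i j, ⁅H i, E j⁆ = (cm i j : ℂ) • E j
  hf : ∀ i j, ⁅H i, F j⁆ = -(cm i j : ℂ) • F j
  nil_e : ∀ i y, ∃ N : ℕ, ((LieAlgebra.ad ℂ L (E i)) ^ N) y = 0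
  nil_f : ∀ i y, ∃ N : ℕ, ((LieAlgebra.ad ℂ L (F i)) ^ N) y = 0
  gen : ∀ K : LieSubalgebra ℂ L, (∀ i, E i ∈ K) → (∀ i, F i ∈ K) → K = ⊤

/-- The root vector of the positive root `n`, by recursion on the first argument. -/
noncomputable def rootVecAux {L : Type*} [LieRing L] (E : Fin 8 → L) : ℕ → ℕ → L
  | 0, _ => 0
  | k + 1, n =>
    open Classical in
    if h : ∃ j, wt n j = 1 then ⁅E h.choose, rootVecAux E k (dn n h.choose)⁆
    else ∑ j, if n = simple j then E j else 0

/-- The root vector of the positive root `n`. -/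
noncomputable def rootVec {L : Type*} [LieRing L] (E : Fin 8 → L) (n : ℕ) : L :=
  rootVecAux E (ht n) n

section
variable {L : Type*} [LieRing L]

theorem rootVec_simple (E : Fin 8 → L) (i : Fin 8) : rootVec E (simple i) = E i := by
  have h : ¬ ∃ j, wt (simple i) j = 1 := by
    rintro ⟨j, hj⟩
    rw [(simple_facts i).2.2] at hj
    by_cases hij : i = j
    · subst hij; rw [cm_diag] at hj; omega
    · rcases cm_offdiag i j hij with h | h <;> omega
  rw [rootVec, (simple_facts i).2.1, rootVecAux, dif_neg h]
  rw [Finset.sum_eq_single i]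
  · simp
  · intro b _ hb
    rw [if_neg]
    exact fun h => hb (simple_injective h).symm
  · simp

/-- The simple root by which a non-simple root vector is raised. -/
noncomputable def pivot (n : ℕ) : Fin 8 :=
  open Classical in if h : ∃ j, wt n j = 1 then h.choose else 0

theorem wt_pivot {n : ℕ} (h : ∃ j, wt n j = 1) : wt n (pivot n) = 1 := by
  rw [pivot, dif_pos h]; exact h.choose_spec

theorem rootVec_step (E : Fin 8 → L) {n : ℕ} (hn : n ∈ posRoots) (h : ∃ j, wt n j = 1) :
    rootVec E n = ⁅E (pivot n), rootVec E (dn n (pivot n))⁆ := by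
  have := (posRoots_dn n hn _ (wt_pivot h)).2.2.1
  rw [rootVec, this, rootVecAux, dif_pos h, rootVec]
  simp only [pivot, dif_pos h]

end

theorem smul_left_congr {M : Type*} [AddCommGroup M] [Module ℂ M] {a b : ℂ} (h : a = b) (x : M) :
    a • x = b • x := by rw [h]

namespace IsSerre

variable {L : Type*} [LieRing L] [LieAlgebra ℂ L] {H E F : Fin 8 → L}

theorem swap (S : IsSerre H E F) : IsSerre (-H) F E where
  hh i j := by simp [S.hh]
  ef i := by rw [Pi.neg_apply, ← S.ef i, lie_skew]
  ef_ne i j h := by rw [← lie_skew, S.ef_ne j i h.symm, neg_zero]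
  he i j := by simp [S.hf]
  hf i j := by simp [S.he]
  nil_e := S.nil_f
  nil_f := S.nil_e
  gen K h1 h2 := S.gen K h2 h1

theorem lie_fe (S : IsSerre H E F) (i : Fin 8) (y : L) :
    ⁅F i, ⁅E i, y⁆⁆ = -⁅H i, y⁆ + ⁅E i, ⁅F i, y⁆⁆ := by
  rw [leibniz_lie, ← lie_skew (F i) (E i), S.ef, neg_lie]

theorem lie_fe_ne (S : IsSerre H E F) {i j : Fin 8} (h : i ≠ j) (y : L) :
    ⁅F i, ⁅E j, y⁆⁆ = ⁅E j, ⁅F i, y⁆⁆ := by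
  rw [leibniz_lie, ← lie_skew (F i) (E j), S.ef_ne j i h.symm]; simp

theorem eq_zero_of_lowest (S : IsSerre H E F) {i : Fin 8} {y : L} {k : ℤ} (hk : 1 ≤ k)
    (hF : ⁅F i, y⁆ = 0) (hH : ⁅H i, y⁆ = (k : ℂ) • y) : y = 0 := by
  set e := LieAlgebra.ad ℂ L (E i) with he
  have hHp : ∀ n : ℕ, ⁅H i, (e ^ n) y⁆ = ((k : ℂ) + 2 * n) • (e ^ n) y := by
    intro n
    induction n with
    | zero => simp [hH]
    | succ n ih =>
      rw [pow_succ', Module.End.mul_apply, he, LieAlgebra.ad_apply, leibniz_lie, S.he, cm_diag,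
        ← he, ih, smul_lie, lie_smul, ← add_smul]
      congr 1
      push_cast; ring
  have hFp : ∀ n : ℕ, ⁅F i, (e ^ (n + 1)) y⁆ = (-(n + 1) * ((k : ℂ) + n)) • (e ^ n) y := by
    intro n
    induction n with
    | zero =>
      rw [pow_succ', Module.End.mul_apply, he, LieAlgebra.ad_apply, S.lie_fe, ← he]
      simp [hF, hH, lie_zero]
    | succ n ih =>
      rw [pow_succ', Module.End.mul_apply, he, LieAlgebra.ad_apply, S.lie_fe, ← he, ih, hHp, lie_smul, pow_succ' e n, Module.End.mul_apply,
        he, LieAlgebra.ad_apply, ← neg_smul, ← add_smul]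
      congr 1
      push_cast; ring
  obtain ⟨N, hN⟩ := S.nil_e i y
  induction N with
  | zero => simpa using hN
  | succ N ih =>
    apply ih
    have := hFp N
    rw [← he] at hN
    rw [hN, lie_zero, eq_comm, smul_eq_zero] at this
    rcases this with h | h
    · exfalso
      have h2 : ((-(N + 1) * (k + N) : ℤ) : ℂ) = 0 := by push_cast; exact h
      rw [Int.cast_eq_zero] at h2
      rcases mul_eq_zero.mp h2 with h3 | h3 <;> omega
    · exact h

theorem lie_h_rootVec (S : IsSerre H E F) : ∀ (k n : ℕ), n ∈ posRoots → ht n = k → ∀ i,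
    ⁅H i, rootVec E n⁆ = (wt n i : ℂ) • rootVec E n := by
  intro k
  induction k using Nat.strong_induction_on with
  | _ k ih =>
  intro n hn hk i
  by_cases h : ∃ j, wt n j = 1
  · obtain ⟨h1, h2, h3, h4⟩ := posRoots_dn n hn _ (wt_pivot h)
    rw [rootVec_step E hn h, leibniz_lie, S.he, ih _ (by omega) _ h1 rfl, smul_lie, lie_smul,
      ← add_smul, h4, cm_symm]
    refine smul_left_congr ?_ _
    push_cast; ring
  · obtain ⟨j, rfl⟩ := (posRoots_simple_or n hn).resolve_left h
    rw [rootVec_simple, S.he, (simple_facts j).2.2, cm_symm]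

/-- The statement describing the action of the `F j` on the root vector of `n`. -/
def LowerClaim (H E F : Fin 8 → L) (n : ℕ) : Prop :=
  ∀ j, (wt n j = 1 → ∃ c : ℂ, ⁅F j, rootVec E n⁆ = c • rootVec E (dn n j)) ∧
    (wt n j ≤ 0 → ⁅F j, rootVec E n⁆ = 0) ∧ (n = simple j → ⁅F j, rootVec E n⁆ = -H j)

/-- The statement describing the action of the `E j` on the root vector of `n`. -/
def RaiseClaim (E : Fin 8 → L) (n : ℕ) : Prop :=
  ∀ j, (wt n j = -1 → ∃ c : ℂ, ⁅E j, rootVec E n⁆ = c • rootVec E (up n j)) ∧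
    (wt n j ≠ -1 → ⁅E j, rootVec E n⁆ = 0)

theorem lie_f_pivot (S : IsSerre H E F) {n : ℕ} (hn : n ∈ posRoots) (h : ∃ j, wt n j = 1)
    (hL : LowerClaim H E F (dn n (pivot n))) :
    ⁅F (pivot n), rootVec E n⁆ = rootVec E (dn n (pivot n)) := by
  obtain ⟨h1, h2, h3, h4⟩ := posRoots_dn n hn _ (wt_pivot h)
  have hw : wt (dn n (pivot n)) (pivot n) = -1 := by
    rw [h4, wt_pivot h, cm_diag]; rfl
  rw [rootVec_step E hn h, S.lie_fe, (hL _).2.1 (by omega), S.lie_h_rootVec _ _ h1 rfl, hw]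
  simp

theorem lowerClaim (S : IsSerre H E F) {n : ℕ} (hn : n ∈ posRoots)
    (ihL : ∀ m ∈ posRoots, ht m < ht n → LowerClaim H E F m)
    (ihR : ∀ m ∈ posRoots, ht m < ht n → RaiseClaim E m) : LowerClaim H E F n := by
  intro j
  by_cases h : ∃ j, wt n j = 1
  · set i := pivot n with hi
    obtain ⟨h1, h2, h3, h4⟩ := posRoots_dn n hn i (wt_pivot h)
    have hni : wt n i = 1 := wt_pivot h
    have hwi : wt (dn n i) i = -1 := by rw [h4, hni, cm_diag]; rfl
    have hnotsimple : ¬ n = simple j := by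
      rintro rfl
      have := (simple_facts j).2.1
      have := ht_pos _ h1
      omega
    have hlow : LowerClaim H E F (dn n i) := ihL _ h1 (by omega)
    have key : ⁅F i, rootVec E n⁆ = rootVec E (dn n i) := S.lie_f_pivot hn h hlow
    by_cases hij : j = i
    · subst hij
      exact ⟨fun _ => ⟨1, by rw [key, one_smul]⟩, fun hle => by omega, fun hs => (hnotsimple hs).elim⟩
    · have hF : ⁅F j, rootVec E n⁆ = ⁅E i, ⁅F j, rootVec E (dn n i)⁆⁆ := by
        rw [rootVec_step E hn h, S.lie_fe_ne hij]
      have hwj := h4 j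
      obtain ⟨l1, l2, l3⟩ := ihL _ h1 (by omega) j
      refine ⟨fun hj => ?_, fun hj => ?_, fun hs => (hnotsimple hs).elim⟩
      · rcases cm_offdiag i j (Ne.symm hij) with hc | hc
        · rw [hc, hj] at hwj
          obtain ⟨c, hc1⟩ := l1 hwj
          obtain ⟨g1, g2, g3, g4⟩ := posRoots_dn _ h1 _ hwj
          obtain ⟨r1, r2⟩ := ihR _ g1 (by omega) i
          obtain ⟨d, hd⟩ := r1 (by rw [g4, hwi, cm_symm, hc]; rfl)
          refine ⟨c * d, ?_⟩
          rw [hF, hc1, lie_smul, hd, smul_smul, dn_dn_comm n hn i j hni hj hc]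
        · rw [hc, hj] at hwj
          have hs := posRoots_two _ h1 j hwj
          refine ⟨-1, ?_⟩
          have hd : dn n j = simple i := by
            rw [← h2, hs]
            exact dn_simple_up j i (by rw [cm_symm, hc])
          rw [hF, l3 hs, hd, rootVec_simple, lie_neg, ← lie_skew, S.he, cm_symm, hc]
          simp
      · rw [hF]
        by_cases hle : wt (dn n i) j ≤ 0
        · rw [l2 hle, lie_zero]
        · have hc : cm i j = -1 := by
            rcases cm_offdiag i j (Ne.symm hij) with hc | hc
            · omega
            · exact hc
          have hw1 : wt (dn n i) j = 1 := by omega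
          obtain ⟨c, hc1⟩ := l1 hw1
          obtain ⟨g1, g2, g3, g4⟩ := posRoots_dn _ h1 _ hw1
          rw [hc1, lie_smul, ((ihR _ g1 (by omega)) i).2, smul_zero]
          rw [g4, hwi, cm_symm, hc]; decide
  · obtain ⟨i, rfl⟩ := (posRoots_simple_or n hn).resolve_left h
    refine ⟨fun hj => (h ⟨j, hj⟩).elim, fun hj => ?_, fun hs => ?_⟩
    · rw [rootVec_simple, ← lie_skew, S.ef_ne, neg_zero]
      rintro rfl
      rw [(simple_facts i).2.2, cm_diag] at hj
      omega
    · rw [simple_injective hs, rootVec_simple, ← lie_skew, S.ef]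

theorem raiseClaim (S : IsSerre H E F) {n : ℕ} (hn : n ∈ posRoots)
    (hL : ∀ m ∈ posRoots, ht m ≤ ht n → LowerClaim H E F m)
    (ihR : ∀ m ∈ posRoots, ht m < ht n → RaiseClaim E m) : RaiseClaim E n := by
  intro j
  have hHn : ∀ i, ⁅H i, rootVec E n⁆ = (wt n i : ℂ) • rootVec E n := S.lie_h_rootVec _ n hn rfl
  have hHy : ∀ i, ⁅H i, ⁅E j, rootVec E n⁆⁆ =
      ((wt n i + cm i j : ℤ) : ℂ) • ⁅E j, rootVec E n⁆ := by
    intro i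
    rw [leibniz_lie, S.he, hHn, smul_lie, lie_smul, ← add_smul]
    refine smul_left_congr ?_ _
    push_cast; ring
  refine ⟨fun hj => ?_, fun hj => ?_⟩
  · obtain ⟨h1, h2, h3, h4⟩ := posRoots_up n hn j hj
    set g := up n j with hg
    have hex : ∃ k, wt g k = 1 := ⟨j, by rw [h4, hj, cm_diag]; rfl⟩
    set i := pivot g with hi
    have hgi : wt g i = 1 := wt_pivot hex
    by_cases hij : i = j
    · refine ⟨1, ?_⟩
      rw [rootVec_step E h1 hex, ← hi, hij, h2, one_smul]
    · obtain ⟨p1, p2, p3, p4⟩ := posRoots_dn g h1 i hgi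
      have hlow : LowerClaim H E F (dn g i) := hL _ p1 (by omega)
      have hkey : ⁅F i, rootVec E g⁆ = rootVec E (dn g i) := S.lie_f_pivot h1 hex hlow
      have hwi : wt n i = 1 - cm j i := by linarith [h4 i]
      obtain ⟨c, hc⟩ : ∃ c : ℂ, ⁅F i, ⁅E j, rootVec E n⁆⁆ = c • rootVec E (dn g i) := by
        rw [S.lie_fe_ne hij]
        obtain ⟨l1, l2, l3⟩ := hL n hn le_rfl i
        rcases cm_offdiag j i (Ne.symm hij) with hc | hc
        · rw [hc] at hwi
          obtain ⟨c, hc1⟩ := l1 hwi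
          obtain ⟨g1, g2, g3, g4⟩ := posRoots_dn n hn i hwi
          obtain ⟨d, hd⟩ := ((ihR _ g1 (by omega)) j).1 (by rw [g4, hj, cm_symm, hc]; rfl)
          refine ⟨c * d, ?_⟩
          rw [hc1, lie_smul, hd, smul_smul, dn_up_comm n hn i j hij hwi hj]
        · rw [hc] at hwi
          have hs := posRoots_two n hn i hwi
          refine ⟨-1, ?_⟩
          rw [l3 hs, lie_neg, ← lie_skew, S.he, hg, hs, dn_simple_up i j (by rw [cm_symm, hc]),
            rootVec_simple, cm_symm, hc]
          simp
      refine ⟨c, ?_⟩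
      rw [← sub_eq_zero]
      refine S.eq_zero_of_lowest (i := i) (k := 1) le_rfl ?_ ?_
      · rw [lie_sub, hc, lie_smul, hkey, sub_self]
      · rw [lie_sub, hHy, lie_smul, S.lie_h_rootVec _ g h1 rfl, hgi, hwi, cm_symm i j]
        simp
  · by_cases h2 : wt n j = 2
    · rw [posRoots_two n hn j h2, rootVec_simple, lie_self]
    · obtain ⟨r1, r2⟩ := posRoots_range n hn j
      obtain ⟨l1, l2, l3⟩ := hL n hn le_rfl j
      by_cases h0 : wt n j = 0
      · refine S.eq_zero_of_lowest (i := j) (k := wt n j + cm j j) (by rw [cm_diag]; omega) ?_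
          (hHy j)
        rw [S.lie_fe, l2 (by omega), hHn, h0]
        simp
      · have hw1 : wt n j = 1 := by omega
        obtain ⟨c, hc⟩ := l1 hw1
        obtain ⟨g1, g2, g3, g4⟩ := posRoots_dn n hn j hw1
        have hwd : wt (dn n j) j = -1 := by rw [g4, hw1, cm_diag]; rfl
        have hFd : ⁅F j, rootVec E (dn n j)⁆ = 0 := (hL _ g1 (by omega) j).2.1 (by omega)
        have hFE : ⁅F j, ⁅E j, rootVec E (dn n j)⁆⁆ = rootVec E (dn n j) := by
          rw [S.lie_fe, hFd, S.lie_h_rootVec _ _ g1 rfl, hwd]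
          simp
        have hz : rootVec E n = c • ⁅E j, rootVec E (dn n j)⁆ := by
          rw [← sub_eq_zero]
          refine S.eq_zero_of_lowest (i := j) (k := 1) le_rfl ?_ ?_
          · rw [lie_sub, hc, lie_smul, hFE, sub_self]
          · rw [lie_sub, hHn, hw1, lie_smul, leibniz_lie, S.he, S.lie_h_rootVec _ _ g1 rfl, hwd,
              cm_diag, smul_lie, lie_smul, ← add_smul, smul_sub]
            rw [smul_smul, smul_smul]
            refine congrArg₂ (· - ·) rfl (smul_left_congr ?_ _)
            push_cast; ring
        refine S.eq_zero_of_lowest (i := j) (k := wt n j + cm j j) (by rw [cm_diag]; omega) ?_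
          (hHy j)
        rw [S.lie_fe, hHn, hw1, hc, lie_smul, ← hz]
        simp

theorem claims (S : IsSerre H E F) : ∀ (k n : ℕ), n ∈ posRoots → ht n = k →
    LowerClaim H E F n ∧ RaiseClaim E n := by
  intro k
  induction k using Nat.strong_induction_on with
  | _ k ih =>
  intro n hn hk
  have hl : LowerClaim H E F n := S.lowerClaim hn
    (fun m hm h => (ih _ (hk ▸ h) m hm rfl).1) (fun m hm h => (ih _ (hk ▸ h) m hm rfl).2)
  refine ⟨hl, ?_⟩
  -- roots of the same height are handled by the lower claim itself
  refine S.raiseClaim hn (fun m hm h => ?_) (fun m hm h => (ih _ (hk ▸ h) m hm rfl).2)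
  exact S.lowerClaim hm
    (fun m' hm' h' => (ih _ (by omega) m' hm' rfl).1)
    (fun m' hm' h' => (ih _ (by omega) m' hm' rfl).2)

end IsSerre

end EEight

namespace EEight

/-- The type of positive roots. -/
abbrev PosRoot : Type := {n : ℕ // n ∈ posRoots.toFinset}

/-- The index type of the Chevalley-type basis. -/
abbrev Idx : Type := Fin 8 ⊕ (PosRoot ⊕ PosRoot)

/-- The weight of a basis vector. -/
def idxWt : Idx → Fin 8 → ℤ
  | .inl _, _ => 0
  | .inr (.inl n), i => wt n i
  | .inr (.inr n), i => -wt n i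

/-- The basis vectors attached to Chevalley generators. -/
noncomputable def basisVec {L : Type*} [LieRing L] (H E F : Fin 8 → L) : Idx → L :=
  Sum.elim H (Sum.elim (fun n => rootVec E n) (fun n => rootVec F n))

theorem PosRoot.mem (n : PosRoot) : (n : ℕ) ∈ posRoots := List.mem_toFinset.mp n.2

theorem card_posRoot : Fintype.card PosRoot = 120 := by
  rw [Fintype.card_coe, List.toFinset_card_of_nodup posRoots_nodup]
  rfl

namespace IsSerre

variable {L : Type*} [LieRing L] [LieAlgebra ℂ L] {H E F : Fin 8 → L}

theorem raiseClaim' (S : IsSerre H E F) {n : ℕ} (hn : n ∈ posRoots) : RaiseClaim E n :=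
  (S.claims _ n hn rfl).2

theorem lowerClaim' (S : IsSerre H E F) {n : ℕ} (hn : n ∈ posRoots) : LowerClaim H E F n :=
  (S.claims _ n hn rfl).1

theorem lie_e_mem (S : IsSerre H E F) (M : Submodule ℂ L) (hH : ∀ i, H i ∈ M)
    (hE : ∀ n ∈ posRoots, rootVec E n ∈ M) (hF : ∀ n ∈ posRoots, rootVec F n ∈ M) (j : Fin 8) :
    (∀ i, ⁅E j, H i⁆ ∈ M) ∧ (∀ n ∈ posRoots, ⁅E j, rootVec E n⁆ ∈ M) ∧
      ∀ n ∈ posRoots, ⁅E j, rootVec F n⁆ ∈ M := by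
  refine ⟨fun i => ?_, fun n hn => ?_, fun n hn => ?_⟩
  · rw [← lie_skew, S.he, ← rootVec_simple E]
    exact M.neg_mem (M.smul_mem _ (hE _ (simple_facts j).1))
  · obtain ⟨h1, h2⟩ := S.raiseClaim' hn j
    by_cases h : wt n j = -1
    · obtain ⟨c, hc⟩ := h1 h
      rw [hc]
      exact M.smul_mem _ (hE _ (posRoots_up n hn j h).1)
    · rw [h2 h]; exact M.zero_mem
  · obtain ⟨h1, h2, h3⟩ := S.swap.lowerClaim' hn j
    by_cases h : wt n j = 2
    · rw [h3 (posRoots_two n hn j h)]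
      simpa using hH j
    · by_cases h' : wt n j = 1
      · obtain ⟨c, hc⟩ := h1 h'
        rw [hc]
        exact M.smul_mem _ (hF _ (posRoots_dn n hn j h').1)
      · rw [h2 (by have := posRoots_range n hn j; omega)]
        exact M.zero_mem

theorem span_basisVec (S : IsSerre H E F) :
    Submodule.span ℂ (Set.range (basisVec H E F)) = ⊤ := by
  set M := Submodule.span ℂ (Set.range (basisVec H E F)) with hM
  have hH : ∀ i, H i ∈ M := fun i => Submodule.subset_span ⟨.inl i, rfl⟩
  have hE : ∀ n ∈ posRoots, rootVec E n ∈ M := fun n hn =>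
    Submodule.subset_span ⟨.inr (.inl ⟨n, List.mem_toFinset.mpr hn⟩), rfl⟩
  have hF : ∀ n ∈ posRoots, rootVec F n ∈ M := fun n hn =>
    Submodule.subset_span ⟨.inr (.inr ⟨n, List.mem_toFinset.mpr hn⟩), rfl⟩
  have hstab : ∀ y : L, (∀ k, ⁅y, basisVec H E F k⁆ ∈ M) → ∀ m ∈ M, ⁅y, m⁆ ∈ M := by
    intro y hy m hm
    have : M ≤ M.comap (LieAlgebra.ad ℂ L y) := by
      rw [hM, Submodule.span_le]
      rintro _ ⟨k, rfl⟩
      exact hy k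
    exact this hm
  let N : LieSubalgebra ℂ L :=
    { carrier := {y | ∀ m ∈ M, ⁅y, m⁆ ∈ M}
      add_mem' := fun ha hb m hm => by rw [add_lie]; exact M.add_mem (ha m hm) (hb m hm)
      zero_mem' := fun m _ => by rw [zero_lie]; exact M.zero_mem
      smul_mem' := fun c a ha m hm => by rw [smul_lie]; exact M.smul_mem _ (ha m hm)
      lie_mem' := fun ha hb m hm => by
        rw [lie_lie]; exact M.sub_mem (ha _ (hb m hm)) (hb _ (ha m hm)) }
  have hN : N = ⊤ := by
    refine S.gen N (fun j => hstab _ ?_) (fun j => hstab _ ?_)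
    · obtain ⟨h1, h2, h3⟩ := S.lie_e_mem M hH hE hF j
      rintro (i | n | n)
      · exact h1 i
      · exact h2 n n.mem
      · exact h3 n n.mem
    · obtain ⟨h1, h2, h3⟩ := S.swap.lie_e_mem M (fun i => M.neg_mem (hH i)) hF hE j
      rintro (i | n | n)
      · have h := M.neg_mem (h1 i)
        rw [Pi.neg_apply, lie_neg, neg_neg] at h
        exact h
      · exact h3 n n.mem
      · exact h2 n n.mem
  let K : LieSubalgebra ℂ L :=
    { M with
      lie_mem' := fun {a b} _ hb => by
        have : a ∈ N := hN ▸ LieSubalgebra.mem_top a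
        exact this b hb }
  have hK : K = ⊤ := S.gen K
    (fun i => by
      change E i ∈ M
      rw [← rootVec_simple E]
      exact hE _ (simple_facts i).1)
    (fun i => by
      change F i ∈ M
      rw [← rootVec_simple F]
      exact hF _ (simple_facts i).1)
  rw [eq_top_iff]
  intro x _
  have : x ∈ K := hK ▸ LieSubalgebra.mem_top x
  exact this

theorem e_ne_zero [Nontrivial L] (S : IsSerre H E F) (i : Fin 8) : E i ≠ 0 := by
  classical
  intro hi
  have hcl : (Finset.univ.filter fun j => E j = 0) = Finset.univ := by
    refine closed_eq_univ _ ⟨i, by simpa using hi⟩ ?_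
    intro j hj k hjk
    simp only [Finset.mem_filter, Finset.mem_univ, true_and] at hj ⊢
    have h : H j = 0 := by rw [← S.ef, hj, zero_lie]
    have h2 := S.he j k
    rw [h, zero_lie, eq_comm, smul_eq_zero, Int.cast_eq_zero] at h2
    exact h2.resolve_left hjk
  have hE : ∀ j, E j = 0 := by
    intro j
    have := Finset.mem_univ j
    rw [← hcl] at this
    simpa using this
  have hH : ∀ j, H j = 0 := fun j => by rw [← S.ef, hE, zero_lie]
  have hF : ∀ j, F j = 0 := fun j => by
    have h := S.hf j j
    rw [hH, zero_lie, cm_diag, eq_comm, smul_eq_zero] at h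
    exact h.resolve_left (by norm_num)
  have hbot : (⊥ : LieSubalgebra ℂ L) = ⊤ := S.gen ⊥ (fun i => by simp [hE]) (fun i => by simp [hF])
  obtain ⟨x, hx⟩ := exists_ne (0 : L)
  exact hx ((LieSubalgebra.mem_bot x).mp (hbot ▸ LieSubalgebra.mem_top x))

theorem rootVec_ne_zero [Nontrivial L] (S : IsSerre H E F) : ∀ (k n : ℕ), n ∈ posRoots →
    ht n = k → rootVec E n ≠ 0 := by
  intro k
  induction k using Nat.strong_induction_on with
  | _ k ih =>
  intro n hn hk
  by_cases h : ∃ j, wt n j = 1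
  · obtain ⟨h1, h2, h3, h4⟩ := posRoots_dn n hn _ (wt_pivot h)
    intro h0
    have := S.lie_f_pivot hn h (S.lowerClaim' h1)
    rw [h0, lie_zero] at this
    exact ih _ (by omega) _ h1 rfl this.symm
  · obtain ⟨j, rfl⟩ := (posRoots_simple_or n hn).resolve_left h
    rw [rootVec_simple]
    exact S.e_ne_zero j

theorem lie_h_basisVec (S : IsSerre H E F) (i : Fin 8) (k : Idx) :
    ⁅H i, basisVec H E F k⁆ = (idxWt k i : ℂ) • basisVec H E F k := by
  rcases k with j | n | n
  · simp [basisVec, idxWt, S.hh]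
  · exact S.lie_h_rootVec _ n n.mem rfl i
  · have := S.swap.lie_h_rootVec _ n n.mem rfl i
    rw [Pi.neg_apply, neg_lie, neg_eq_iff_eq_neg] at this
    simp only [basisVec, idxWt, Sum.elim_inr]
    rw [this]
    simp

/-- The element of the Cartan subalgebra with the given coefficients. -/
noncomputable def cart (H : Fin 8 → L) (t : Fin 8 → ℂ) : L := ∑ i, t i • H i

theorem lie_cart_basisVec (S : IsSerre H E F) (t : Fin 8 → ℂ) (k : Idx) :
    ⁅cart H t, basisVec H E F k⁆ = (∑ i, t i * idxWt k i) • basisVec H E F k := by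
  rw [cart, sum_lie, Finset.sum_smul]
  refine Finset.sum_congr rfl fun i _ => ?_
  rw [smul_lie, S.lie_h_basisVec, smul_smul]

theorem lie_cart_cart (S : IsSerre H E F) (t u : Fin 8 → ℂ) : ⁅cart H t, cart H u⁆ = 0 := by
  rw [cart, cart, sum_lie]
  refine Finset.sum_eq_zero fun i _ => ?_
  rw [lie_sum]
  refine Finset.sum_eq_zero fun j _ => ?_
  rw [smul_lie, lie_smul, S.hh, smul_zero, smul_zero]

/-- The separating function on the basis. -/
def sep (k : Idx) : ℤ := ∑ i, sepCoeff i * idxWt k i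

theorem lie_sep (S : IsSerre H E F) (k : Idx) :
    ⁅cart H (fun i => (sepCoeff i : ℂ)), basisVec H E F k⁆ = (sep k : ℂ) • basisVec H E F k := by
  rw [S.lie_cart_basisVec, sep]
  push_cast
  rfl

theorem sep_inl (i : Fin 8) : sep (.inl i) = 0 := by simp [sep, idxWt]

theorem sep_neg (n : PosRoot) : sep (.inr (.inr n)) = -sep (.inr (.inl n)) := by
  simp [sep, idxWt]

theorem sep_pos' (n : PosRoot) : 0 < sep (.inr (.inl n)) := sep_pos n n.mem

theorem sep_inj' {n m : PosRoot} (h : sep (.inr (.inl n)) = sep (.inr (.inl m))) : n = m :=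
  Subtype.ext (sep_inj n n.mem m m.mem h)

theorem sep_ne_zero (k : PosRoot ⊕ PosRoot) : sep (.inr k) ≠ 0 := by
  rcases k with n | n
  · exact (sep_pos' n).ne'
  · rw [sep_neg]; have := sep_pos' n; omega

theorem sep_injective : Function.Injective fun k : PosRoot ⊕ PosRoot => sep (.inr k) := by
  rintro (n | n) (m | m) h
  · rw [sep_inj' h]
  · have h' : sep (.inr (.inl n)) = sep (.inr (.inr m)) := h
    rw [sep_neg] at h'; have := sep_pos' n; have := sep_pos' m; omega
  · have h' : sep (.inr (.inr n)) = sep (.inr (.inl m)) := h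
    rw [sep_neg] at h'; have := sep_pos' n; have := sep_pos' m; omega
  · have h' : sep (.inr (.inr n)) = sep (.inr (.inr m)) := h
    rw [sep_neg, sep_neg, neg_inj] at h'
    rw [sep_inj' h']

theorem linearIndependent_h [Nontrivial L] (S : IsSerre H E F) : LinearIndependent ℂ H := by
  rw [Fintype.linearIndependent_iff]
  intro c hc
  have h1 : ∀ j, ∑ i, c i * (cm i j : ℂ) = 0 := by
    intro j
    have h : ⁅∑ i, c i • H i, E j⁆ = 0 := by rw [hc, zero_lie]
    rw [sum_lie] at h
    simp only [smul_lie, S.he, smul_smul] at h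
    rw [← Finset.sum_smul, smul_eq_zero] at h
    exact h.resolve_right (S.e_ne_zero j)
  have h2 : Matrix.vecMul c (Matrix.of fun i j => (cm i j : ℂ)) = 0 := by
    ext j
    exact h1 j
  have h3 := Matrix.eq_zero_of_vecMul_eq_zero (by rw [cm_det]; exact one_ne_zero) h2
  exact fun i => congrFun h3 i

theorem basisVec_ne_zero [Nontrivial L] (S : IsSerre H E F) (k : PosRoot ⊕ PosRoot) :
    basisVec H E F (.inr k) ≠ 0 := by
  rcases k with n | n
  · exact S.rootVec_ne_zero _ n n.mem rfl
  · exact S.swap.rootVec_ne_zero _ n n.mem rfl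

theorem linearIndependent_basisVec [Nontrivial L] (S : IsSerre H E F) :
    LinearIndependent ℂ (basisVec H E F) := by
  set T := LieAlgebra.ad ℂ L (cart H (fun i => (sepCoeff i : ℂ))) with hT
  have hLI : LinearIndependent ℂ fun k => basisVec H E F (.inr k) := by
    refine T.eigenvectors_linearIndependent' (fun k => (sep (.inr k) : ℂ)) ?_ _ fun k => ?_
    · exact Int.cast_injective.comp sep_injective
    · exact ⟨Module.End.mem_eigenspace_iff.mpr (S.lie_sep _), S.basisVec_ne_zero k⟩
  have h : basisVec H E F = Sum.elim H fun k => basisVec H E F (.inr k) := by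
    ext k; rcases k with i | k <;> rfl
  rw [h]
  refine S.linearIndependent_h.sum_type hLI ?_
  rw [Submodule.disjoint_def]
  intro x hx hx'
  have hx0 : T x = 0 := by
    have : Submodule.span ℂ (Set.range H) ≤ LinearMap.ker T := by
      rw [Submodule.span_le]
      rintro _ ⟨i, rfl⟩
      have := S.lie_sep (.inl i)
      rw [sep_inl] at this
      rw [Int.cast_zero, zero_smul] at this
      exact this
    exact this hx
  obtain ⟨c, rfl⟩ := (Submodule.mem_span_range_iff_exists_fun ℂ).mp hx'
  rw [map_sum] at hx0
  have h1 : ∀ k, T (c k • basisVec H E F (.inr k)) =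
      (c k * (sep (.inr k) : ℂ)) • basisVec H E F (.inr k) := by
    intro k
    rw [map_smul, hT, LieAlgebra.ad_apply, S.lie_sep, smul_smul]
  simp only [h1] at hx0
  have h2 := Fintype.linearIndependent_iff.mp hLI _ hx0
  refine Finset.sum_eq_zero fun k _ => ?_
  have h3 : c k = 0 := by
    have := mul_eq_zero.mp (h2 k)
    exact this.resolve_right (by exact_mod_cast sep_ne_zero k)
  rw [h3, zero_smul]

/-- The basis consisting of simple coroots and root vectors. -/
noncomputable def basis [Nontrivial L] (S : IsSerre H E F) : Module.Basis Idx ℂ L :=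
  Module.Basis.mk S.linearIndependent_basisVec S.span_basisVec.ge

theorem basis_apply [Nontrivial L] (S : IsSerre H E F) (k : Idx) :
    S.basis k = basisVec H E F k := by
  rw [basis, Module.Basis.mk_apply]

theorem finite [Nontrivial L] (S : IsSerre H E F) : Module.Finite ℂ L :=
  Module.Finite.of_basis S.basis

theorem finrank_eq [Nontrivial L] (S : IsSerre H E F) : Module.finrank ℂ L = 248 := by
  rw [Module.finrank_eq_card_basis S.basis, Fintype.card_sum, Fintype.card_sum, card_posRoot,
    Fintype.card_fin]

end IsSerre

end EEight

namespace EEight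

/-- The quotient map from the free Lie algebra. -/
noncomputable def proj8 :
    FreeLieAlgebra ℂ (CartanMatrix.Generators (Fin 8)) →ₗ⁅ℂ⁆ LieAlgebra.e₈ ℂ :=
  { LieSubmodule.Quotient.mk' (CartanMatrix.Relations.toIdeal ℂ CartanMatrix.E₈) with
    map_lie' := fun {_ _} => rfl }

theorem proj8_surjective : Function.Surjective proj8 :=
  LieSubmodule.Quotient.surjective_mk' _

theorem proj8_eq_zero {x : FreeLieAlgebra ℂ (CartanMatrix.Generators (Fin 8))}
    (hx : x ∈ CartanMatrix.Relations.toSet ℂ CartanMatrix.E₈) : proj8 x = 0 :=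
  (LieSubmodule.Quotient.mk_eq_zero _).mpr (LieSubmodule.subset_lieSpan hx)

theorem gen8_generate (K : LieSubalgebra ℂ (LieAlgebra.e₈ ℂ))
    (h : ∀ x, proj8 (FreeLieAlgebra.of ℂ x) ∈ K) : K = ⊤ := by
  let g : FreeLieAlgebra ℂ (CartanMatrix.Generators (Fin 8)) →ₗ⁅ℂ⁆ K :=
    FreeLieAlgebra.lift ℂ fun x => ⟨_, h x⟩
  have hg : K.incl.comp g = proj8 := by
    refine FreeLieAlgebra.hom_ext fun x => ?_
    rw [LieHom.comp_apply, FreeLieAlgebra.lift_of_apply]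
    rfl
  rw [eq_top_iff]
  intro y _
  obtain ⟨x, rfl⟩ := proj8_surjective y
  rw [← hg]
  exact (g x).2

theorem isSerre_e8 : IsSerre
    (fun i => proj8 (FreeLieAlgebra.of ℂ (.H i))) (fun i => proj8 (FreeLieAlgebra.of ℂ (.E i)))
    (fun i => proj8 (FreeLieAlgebra.of ℂ (.F i))) := by
  have hh : ∀ i j, ⁅proj8 (FreeLieAlgebra.of ℂ (.H i)), proj8 (FreeLieAlgebra.of ℂ (.H j))⁆ = 0 := by
    intro i j
    rw [← LieHom.map_lie]
    refine proj8_eq_zero ?_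
    iterate 5 left
    exact ⟨(i, j), rfl⟩
  have hef : ∀ i, ⁅proj8 (FreeLieAlgebra.of ℂ (.E i)), proj8 (FreeLieAlgebra.of ℂ (.F i))⁆ =
      proj8 (FreeLieAlgebra.of ℂ (.H i)) := by
    intro i
    rw [← sub_eq_zero, ← LieHom.map_lie, ← map_sub]
    refine proj8_eq_zero ?_
    iterate 4 left
    right
    exact ⟨(i, i), by simp [CartanMatrix.Relations.EF]⟩
  have hne : ∀ i j, i ≠ j →
      ⁅proj8 (FreeLieAlgebra.of ℂ (.E i)), proj8 (FreeLieAlgebra.of ℂ (.F j))⁆ = 0 := by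
    intro i j h
    rw [← LieHom.map_lie]
    refine proj8_eq_zero ?_
    iterate 4 left
    right
    exact ⟨(i, j), by simp [CartanMatrix.Relations.EF, h]⟩
  have hhe : ∀ i j, ⁅proj8 (FreeLieAlgebra.of ℂ (.H i)), proj8 (FreeLieAlgebra.of ℂ (.E j))⁆ =
      (cm i j : ℂ) • proj8 (FreeLieAlgebra.of ℂ (.E j)) := by
    intro i j
    rw [Int.cast_smul_eq_zsmul, ← sub_eq_zero, ← LieHom.map_lie, ← map_zsmul, ← map_sub]
    refine proj8_eq_zero ?_
    iterate 3 left
    right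
    exact ⟨(i, j), rfl⟩
  have hhf : ∀ i j, ⁅proj8 (FreeLieAlgebra.of ℂ (.H i)), proj8 (FreeLieAlgebra.of ℂ (.F j))⁆ =
      -(cm i j : ℂ) • proj8 (FreeLieAlgebra.of ℂ (.F j)) := by
    intro i j
    rw [neg_smul, eq_neg_iff_add_eq_zero, Int.cast_smul_eq_zsmul, ← LieHom.map_lie, ← map_zsmul,
      ← map_add]
    refine proj8_eq_zero ?_
    iterate 2 left
    right
    exact ⟨(i, j), rfl⟩
  have hpow : ∀ (a b : FreeLieAlgebra ℂ (CartanMatrix.Generators (Fin 8))) (n : ℕ),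
      proj8 ((LieAlgebra.ad ℂ _ a ^ n) b) = (LieAlgebra.ad ℂ _ (proj8 a) ^ n) (proj8 b) := by
    intro a b n
    induction n with
    | zero => simp
    | succ n ih =>
      rw [pow_succ', Module.End.mul_apply, LieAlgebra.ad_apply, LieHom.map_lie, ih, pow_succ',
        Module.End.mul_apply, LieAlgebra.ad_apply]
  have hse : ∀ i j, (LieAlgebra.ad ℂ _ (proj8 (FreeLieAlgebra.of ℂ (.E i))) ^
      ((-CartanMatrix.E₈ i j).toNat + 1)) (proj8 (FreeLieAlgebra.of ℂ (.E j))) = 0 := by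
    intro i j
    rw [pow_succ, Module.End.mul_apply, LieAlgebra.ad_apply, ← LieHom.map_lie, ← hpow]
    refine proj8_eq_zero ?_
    left; right
    exact ⟨(i, j), rfl⟩
  have hsf : ∀ i j, (LieAlgebra.ad ℂ _ (proj8 (FreeLieAlgebra.of ℂ (.F i))) ^
      ((-CartanMatrix.E₈ i j).toNat + 1)) (proj8 (FreeLieAlgebra.of ℂ (.F j))) = 0 := by
    intro i j
    rw [pow_succ, Module.End.mul_apply, LieAlgebra.ad_apply, ← LieHom.map_lie, ← hpow]
    refine proj8_eq_zero ?_
    right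
    exact ⟨(i, j), rfl⟩
  have hnil_e : ∀ i y, ∃ N : ℕ,
      ((LieAlgebra.ad ℂ _ (proj8 (FreeLieAlgebra.of ℂ (.E i)))) ^ N) y = 0 := by
    intro i y
    have : LieSubalgebra.engel ℂ (proj8 (FreeLieAlgebra.of ℂ (.E i))) = ⊤ := by
      refine gen8_generate _ fun x => ?_
      rw [LieSubalgebra.mem_engel_iff]
      rcases x with j | j | j
      · refine ⟨2, ?_⟩
        rw [pow_two, Module.End.mul_apply, LieAlgebra.ad_apply, LieAlgebra.ad_apply,
          ← lie_skew (proj8 (FreeLieAlgebra.of ℂ (.E i))) (proj8 (FreeLieAlgebra.of ℂ (.H j))),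
          hhe, lie_neg, lie_smul, lie_self, smul_zero, neg_zero]
      · exact ⟨_, hse i j⟩
      · by_cases h : i = j
        · subst h
          refine ⟨3, ?_⟩
          rw [pow_succ, pow_two, Module.End.mul_apply, Module.End.mul_apply, LieAlgebra.ad_apply,
            LieAlgebra.ad_apply, LieAlgebra.ad_apply, hef,
            ← lie_skew (proj8 (FreeLieAlgebra.of ℂ (.E i))) (proj8 (FreeLieAlgebra.of ℂ (.H i))),
            hhe, lie_neg, lie_smul, lie_self, smul_zero, neg_zero]
        · exact ⟨1, by rw [pow_one, LieAlgebra.ad_apply, hne i j h]⟩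
    rw [← LieSubalgebra.mem_engel_iff, this]
    exact LieSubalgebra.mem_top y
  have hnil_f : ∀ i y, ∃ N : ℕ,
      ((LieAlgebra.ad ℂ _ (proj8 (FreeLieAlgebra.of ℂ (.F i)))) ^ N) y = 0 := by
    intro i y
    have : LieSubalgebra.engel ℂ (proj8 (FreeLieAlgebra.of ℂ (.F i))) = ⊤ := by
      refine gen8_generate _ fun x => ?_
      rw [LieSubalgebra.mem_engel_iff]
      rcases x with j | j | j
      · refine ⟨2, ?_⟩
        rw [pow_two, Module.End.mul_apply, LieAlgebra.ad_apply, LieAlgebra.ad_apply,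
          ← lie_skew (proj8 (FreeLieAlgebra.of ℂ (.F i))) (proj8 (FreeLieAlgebra.of ℂ (.H j))),
          hhf, lie_neg, lie_smul, lie_self, smul_zero, neg_zero]
      · by_cases h : i = j
        · subst h
          refine ⟨3, ?_⟩
          rw [pow_succ, pow_two, Module.End.mul_apply, Module.End.mul_apply, LieAlgebra.ad_apply,
            LieAlgebra.ad_apply, LieAlgebra.ad_apply,
            ← lie_skew (proj8 (FreeLieAlgebra.of ℂ (.F i))) (proj8 (FreeLieAlgebra.of ℂ (.E i))),
            hef, lie_neg,
            ← lie_skew (proj8 (FreeLieAlgebra.of ℂ (.F i))) (proj8 (FreeLieAlgebra.of ℂ (.H i))),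
            hhf, neg_neg, lie_smul, lie_self, smul_zero]
        · refine ⟨1, ?_⟩
          rw [pow_one, LieAlgebra.ad_apply, ← lie_skew, hne j i (Ne.symm h), neg_zero]
      · exact ⟨_, hsf i j⟩
    rw [← LieSubalgebra.mem_engel_iff, this]
    exact LieSubalgebra.mem_top y
  refine ⟨hh, hef, hne, hhe, hhf, hnil_e, hnil_f, fun K h1 h2 => gen8_generate K ?_⟩
  rintro (i | i | i)
  · rw [← hef i]
    exact K.lie_mem (h1 i) (h2 i)
  · exact h1 i
  · exact h2 i

end EEight

namespace EEight

theorem sum_wt_two : ∀ i j, (posRoots.map fun n => wt n i * wt n j).sum = 30 * cm i j := by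
  decide +kernel

theorem sum_wt_four_sorted : ∀ i j, i ≤ j → ∀ k, j ≤ k → ∀ l, k ≤ l →
    (posRoots.map fun n => wt n i * wt n j * wt n k * wt n l).sum =
      6 * (cm i j * cm k l + cm i k * cm j l + cm i l * cm j k) := by
  decide +kernel

end EEight

namespace EEight

theorem symm_four {f : Fin 8 → Fin 8 → Fin 8 → Fin 8 → Prop}
    (h12 : ∀ i j k l, f i j k l → f j i k l) (h23 : ∀ i j k l, f i j k l → f i k j l)
    (h34 : ∀ i j k l, f i j k l → f i j l k)
    (hs : ∀ i j, i ≤ j → ∀ k, j ≤ k → ∀ l, k ≤ l → f i j k l) (i j k l : Fin 8) : f i j k l := by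
  have s1 : ∀ i j k l, j ≤ k → k ≤ l → f i j k l := by
    intro i j k l hjk hkl
    rcases le_total i j with h | h
    · exact hs _ _ h _ hjk _ hkl
    · apply h12
      rcases le_total i k with h' | h'
      · exact hs _ _ h _ h' _ hkl
      · apply h23
        rcases le_total i l with h'' | h''
        · exact hs _ _ hjk _ h' _ h''
        · exact h34 _ _ _ _ (hs _ _ hjk _ hkl _ h'')
  have s2 : ∀ i j k l, k ≤ l → f i j k l := by
    intro i j k l hkl
    rcases le_total j k with h | h
    · exact s1 _ _ _ _ h hkl
    · apply h23
      rcases le_total j l with h' | h'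
      · exact s1 _ _ _ _ h h'
      · exact h34 _ _ _ _ (s1 _ _ _ _ hkl h')
  rcases le_total k l with h | h
  · exact s2 _ _ _ _ h
  · exact h34 _ _ _ _ (s2 _ _ _ _ h)

theorem sum_posRoot (f : ℕ → ℤ) : ∑ n : PosRoot, f n = (posRoots.map f).sum := by
  rw [Finset.sum_coe_sort posRoots.toFinset f, List.sum_toFinset _ posRoots_nodup]

theorem sum_wt_four (i j k l : Fin 8) :
    ∑ n : PosRoot, wt n i * wt n j * wt n k * wt n l =
      6 * (cm i j * cm k l + cm i k * cm j l + cm i l * cm j k) := by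
  refine symm_four (f := fun i j k l => ∑ n : PosRoot, wt n i * wt n j * wt n k * wt n l =
      6 * (cm i j * cm k l + cm i k * cm j l + cm i l * cm j k)) ?_ ?_ ?_ ?_ i j k l
  · intro i j k l h
    rw [cm_symm j i]
    simp only [mul_comm (wt _ j) (wt _ i)]
    rw [h]; ring
  · intro i j k l h
    rw [cm_symm k j]
    simp only [mul_right_comm _ (wt _ k) (wt _ j)]
    rw [h]; ring
  · intro i j k l h
    rw [cm_symm l k]
    simp only [mul_right_comm _ (wt _ l) (wt _ k)]
    rw [h]; ring
  · intro i j h1 k h2 l h3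
    rw [sum_posRoot fun n => wt n i * wt n j * wt n k * wt n l]
    exact sum_wt_four_sorted i j h1 k h2 l h3

theorem sum_idxWt_two (i j : Fin 8) : ∑ k : Idx, idxWt k i * idxWt k j = 60 * cm i j := by
  rw [Fintype.sum_sum_type, Fintype.sum_sum_type]
  simp only [idxWt, mul_zero, Finset.sum_const_zero, zero_add, neg_mul_neg]
  rw [sum_posRoot fun n => wt n i * wt n j, sum_wt_two]
  ring

theorem sum_idxWt_four (a b c d : Fin 8) :
    ∑ k : Idx, idxWt k a * idxWt k b * idxWt k c * idxWt k d =
      12 * (cm a b * cm c d + cm a c * cm b d + cm a d * cm b c) := by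
  rw [Fintype.sum_sum_type, Fintype.sum_sum_type]
  have h : ∀ n : PosRoot, idxWt (.inr (.inr n)) a * idxWt (.inr (.inr n)) b *
      idxWt (.inr (.inr n)) c * idxWt (.inr (.inr n)) d =
      wt n a * wt n b * wt n c * wt n d := by
    intro n; simp only [idxWt]; ring
  simp only [h]
  simp only [idxWt, mul_zero, Finset.sum_const_zero, zero_add]
  rw [sum_wt_four]
  ring

theorem killing_inv {L : Type*} [LieRing L] [LieAlgebra ℂ L] (x y z : L) :
    killingForm ℂ L ⁅x, y⁆ z = killingForm ℂ L x ⁅y, z⁆ :=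
  LieModule.traceForm_apply_lie_apply ℂ L L x y z

theorem killing_symm {L : Type*} [LieRing L] [LieAlgebra ℂ L] (x y : L) :
    killingForm ℂ L x y = killingForm ℂ L y x :=
  LieModule.traceForm_comm ℂ L L x y

theorem killing_def {L : Type*} [LieRing L] [LieAlgebra ℂ L] (x y : L) :
    killingForm ℂ L x y = LinearMap.trace ℂ L (LieAlgebra.ad ℂ L x * LieAlgebra.ad ℂ L y) := rfl

theorem trace_of_diagonal {ι M : Type*} [Fintype ι] [AddCommGroup M] [Module ℂ M]
    (b : Module.Basis ι ℂ M) (T : Module.End ℂ M) (μ : ι → ℂ) (h : ∀ i, T (b i) = μ i • b i) :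
    LinearMap.trace ℂ M T = ∑ i, μ i := by
  classical
  rw [LinearMap.trace_eq_matrix_trace ℂ b, Matrix.trace]
  refine Finset.sum_congr rfl fun i _ => ?_
  rw [Matrix.diag_apply, LinearMap.toMatrix_apply, h]
  simp

namespace IsSerre

variable {L : Type*} [LieRing L] [LieAlgebra ℂ L] {H E F : Fin 8 → L}

theorem killing_eq_zero (S : IsSerre H E F) {k l : Idx} (h : sep k + sep l ≠ 0) :
    killingForm ℂ L (basisVec H E F k) (basisVec H E F l) = 0 := by
  set T := cart H (fun i => (sepCoeff i : ℂ)) with hT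
  have h1 := killing_inv (basisVec H E F k) T (basisVec H E F l)
  rw [S.lie_sep, ← lie_skew, S.lie_sep, map_neg, LinearMap.neg_apply, map_smul, map_smul,
    LinearMap.smul_apply, smul_eq_mul, smul_eq_mul] at h1
  have h2 : ((sep k + sep l : ℤ) : ℂ) *
      killingForm ℂ L (basisVec H E F k) (basisVec H E F l) = 0 := by
    push_cast; linear_combination -h1
  exact (mul_eq_zero.mp h2).resolve_left (by exact_mod_cast h)

variable [Nontrivial L]

theorem ad_h_basis (S : IsSerre H E F) (i : Fin 8) (k : Idx) :
    LieAlgebra.ad ℂ L (H i) (S.basis k) = (idxWt k i : ℂ) • S.basis k := by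
  rw [S.basis_apply, LieAlgebra.ad_apply, S.lie_h_basisVec]

theorem killing_h (S : IsSerre H E F) (i j : Fin 8) :
    killingForm ℂ L (H i) (H j) = 60 * (cm i j : ℂ) := by
  rw [killing_def, trace_of_diagonal S.basis _ (fun k => (idxWt k i : ℂ) * idxWt k j)]
  · have := sum_idxWt_two i j
    exact_mod_cast congrArg (Int.cast : ℤ → ℂ) this
  · intro k
    rw [Module.End.mul_apply, S.ad_h_basis, map_smul, S.ad_h_basis, smul_smul, mul_comm]

theorem trace_h_four (S : IsSerre H E F) (a b c d : Fin 8) :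
    LinearMap.trace ℂ L (LieAlgebra.ad ℂ L (H a) * LieAlgebra.ad ℂ L (H b) *
      LieAlgebra.ad ℂ L (H c) * LieAlgebra.ad ℂ L (H d)) =
      12 * ((cm a b : ℂ) * cm c d + cm a c * cm b d + cm a d * cm b c) := by
  rw [trace_of_diagonal S.basis _
    (fun k => (idxWt k a : ℂ) * idxWt k b * idxWt k c * idxWt k d)]
  · have := sum_idxWt_four a b c d
    exact_mod_cast congrArg (Int.cast : ℤ → ℂ) this
  · intro k
    simp only [Module.End.mul_apply, S.ad_h_basis, map_smul, smul_smul]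
    refine smul_left_congr ?_ _
    ring

theorem killing_root (S : IsSerre H E F) : ∀ (k n : ℕ), n ∈ posRoots → ht n = k →
    killingForm ℂ L (rootVec E n) (rootVec F n) ≠ 0 := by
  intro k
  induction k using Nat.strong_induction_on with
  | _ k ih =>
  intro n hn hk
  by_cases h : ∃ j, wt n j = 1
  · obtain ⟨h1, h2, h3, h4⟩ := posRoots_dn n hn _ (wt_pivot h)
    have h5 := S.swap.lie_f_pivot hn h (S.swap.lowerClaim' h1)
    rw [rootVec_step E hn h, ← lie_skew, map_neg, LinearMap.neg_apply, killing_inv, h5]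
    exact neg_ne_zero.mpr (ih _ (by omega) _ h1 rfl)
  · obtain ⟨j, rfl⟩ := (posRoots_simple_or n hn).resolve_left h
    rw [rootVec_simple, rootVec_simple]
    have h1 := killing_inv (H j) (E j) (F j)
    rw [S.he, S.ef, S.killing_h, map_smul, LinearMap.smul_apply, cm_diag, smul_eq_mul] at h1
    intro h0
    rw [h0] at h1
    norm_num at h1

theorem killing_nondegenerate (S : IsSerre H E F) {z : L}
    (hz : ∀ y, killingForm ℂ L z y = 0) : z = 0 := by
  have hrep := S.basis.sum_repr z
  set c := S.basis.repr z with hc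
  have hE : ∀ n : PosRoot, c (.inr (.inl n)) = 0 := by
    intro n
    have h := hz (basisVec H E F (.inr (.inr n)))
    rw [← hrep, map_sum, LinearMap.sum_apply, Finset.sum_eq_single (.inr (.inl n))] at h
    · rw [map_smul, LinearMap.smul_apply, smul_eq_mul, S.basis_apply] at h
      exact (mul_eq_zero.mp h).resolve_right (S.killing_root _ n n.mem rfl)
    · intro k _ hk
      rw [map_smul, LinearMap.smul_apply, S.basis_apply, S.killing_eq_zero, smul_zero]
      rw [sep_neg]
      rcases k with i | k
      · rw [sep_inl]; have := sep_pos' n; omega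
      · intro h0
        exact hk (congrArg Sum.inr (sep_injective (by simp only; omega)))
    · simp
  have hF : ∀ n : PosRoot, c (.inr (.inr n)) = 0 := by
    intro n
    have h := hz (basisVec H E F (.inr (.inl n)))
    rw [← hrep, map_sum, LinearMap.sum_apply, Finset.sum_eq_single (.inr (.inr n))] at h
    · rw [map_smul, LinearMap.smul_apply, smul_eq_mul, S.basis_apply, killing_symm] at h
      exact (mul_eq_zero.mp h).resolve_right (S.killing_root _ n n.mem rfl)
    · intro k _ hk
      rw [map_smul, LinearMap.smul_apply, S.basis_apply, S.killing_eq_zero, smul_zero]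
      rcases k with i | k
      · rw [sep_inl]; have := sep_pos' n; omega
      · intro h0
        exact hk (congrArg Sum.inr (sep_injective (by simp only; rw [sep_neg]; omega)))
    · simp
  have hH : ∀ i, c (.inl i) = 0 := by
    have h1 : Matrix.vecMul (fun i => c (.inl i)) (Matrix.of fun i j => (cm i j : ℂ)) = 0 := by
      ext j
      have h := hz (H j)
      rw [← hrep, map_sum, LinearMap.sum_apply, Fintype.sum_sum_type, Fintype.sum_sum_type] at h
      simp only [hE, hF, zero_smul, map_zero, LinearMap.zero_apply, Finset.sum_const_zero,
        add_zero, map_smul, LinearMap.smul_apply, S.basis_apply, smul_eq_mul] at h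
      have h2 : 60 * ∑ i, c (.inl i) * (cm i j : ℂ) = 0 := by
        rw [← h, Finset.mul_sum]
        refine Finset.sum_congr rfl fun i _ => ?_
        rw [show basisVec H E F (.inl i) = H i from rfl, S.killing_h]
        ring
      exact (mul_eq_zero.mp h2).resolve_left (by norm_num)
    have h3 := Matrix.eq_zero_of_vecMul_eq_zero (by rw [cm_det]; exact one_ne_zero) h1
    exact fun i => congrFun h3 i
  rw [← hrep]
  refine Finset.sum_eq_zero fun k _ => ?_
  rcases k with i | n | n
  · rw [hH, zero_smul]
  · rw [hE, zero_smul]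
  · rw [hF, zero_smul]

end IsSerre

end EEight

namespace EEight

/-- A symmetric invariant form of degree four vanishing on a subspace `C` which, together with the
image of the adjoint action of `h`, spans the Lie algebra, vanishes. -/
theorem invariant_four_eq_zero {L : Type*} [LieRing L] (P : L → L → L → L → ℂ)
    (hadd : ∀ a a' b c d, P (a + a') b c d = P a b c d + P a' b c d)
    (h12 : ∀ a b c d, P a b c d = P b a c d) (h23 : ∀ a b c d, P a b c d = P a c b d)
    (h34 : ∀ a b c d, P a b c d = P a b d c)
    (hinv : ∀ y a b c d : L, P ⁅y, a⁆ b c d + P a ⁅y, b⁆ c d + P a b ⁅y, c⁆ d + P a b c ⁅y, d⁆ = 0)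
    (C : Set L) (h : L) (hh : h ∈ C) (hC : ∀ a ∈ C, ∀ b ∈ C, ∀ c ∈ C, ∀ d ∈ C, P a b c d = 0)
    (hdec : ∀ a, ∃ c ∈ C, ∃ u : L, a = c + ⁅u, h⁆) (a b c d : L) : P a b c d = 0 := by
  have s0 : P h h h h = 0 := hC _ hh _ hh _ hh _ hh
  have s1' : ∀ u : L, P ⁅u, h⁆ h h h = 0 := by
    intro u
    have i := hinv u h h h h
    have e1 := h12 h ⁅u, h⁆ h h
    have e2 := h23 h h ⁅u, h⁆ h
    have e3 := h34 h h h ⁅u, h⁆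
    have : 4 * P ⁅u, h⁆ h h h = 0 := by linear_combination i - 3 * e1 - 2 * e2 - e3
    simpa using this
  have s1 : ∀ a, P a h h h = 0 := by
    intro a
    obtain ⟨x, hx, u, rfl⟩ := hdec a
    rw [hadd, s1', hC _ hx _ hh _ hh _ hh, add_zero]
  have s2' : ∀ u a : L, P ⁅u, h⁆ a h h = 0 := by
    intro u a
    have i := hinv u a h h h
    have e0 := s1 ⁅u, a⁆
    have e1 := h12 ⁅u, h⁆ a h h
    have e2 := h23 a h ⁅u, h⁆ h
    have e3 := h34 a h h ⁅u, h⁆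
    have : 3 * P ⁅u, h⁆ a h h = 0 := by linear_combination i - e0 + 3 * e1 - 2 * e2 - e3
    simpa using this
  have s2 : ∀ a b, P a b h h = 0 := by
    intro a b
    obtain ⟨x, hx, u, rfl⟩ := hdec a
    rw [hadd, s2', add_zero, h12]
    obtain ⟨y, hy, v, rfl⟩ := hdec b
    rw [hadd, s2', add_zero]
    exact hC _ hy _ hx _ hh _ hh
  have s3' : ∀ u a b : L, P ⁅u, h⁆ a b h = 0 := by
    intro u a b
    have i := hinv u a b h h
    have e0 := s2 ⁅u, a⁆ b
    have e0' := s2 a ⁅u, b⁆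
    have e1 := h12 ⁅u, h⁆ a b h
    have e2 := h23 a ⁅u, h⁆ b h
    have e3 := h34 a b h ⁅u, h⁆
    have : 2 * P ⁅u, h⁆ a b h = 0 := by
      linear_combination i - e0 - e0' + 2 * e1 + 2 * e2 - e3
    simpa using this
  have s3 : ∀ a b c, P a b c h = 0 := by
    intro a b c
    obtain ⟨x, hx, u, rfl⟩ := hdec a
    rw [hadd, s3', add_zero, h12]
    obtain ⟨y, hy, v, rfl⟩ := hdec b
    rw [hadd, s3', add_zero, h23, h12]
    obtain ⟨z, hz, w, rfl⟩ := hdec c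
    rw [hadd, s3', add_zero]
    exact hC _ hz _ hy _ hx _ hh
  have s4' : ∀ u a b c : L, P ⁅u, h⁆ a b c = 0 := by
    intro u a b c
    have i := hinv u a b c h
    rw [s3, s3, s3, h34, h23, h12] at i
    simpa using i
  obtain ⟨x, hx, u, rfl⟩ := hdec a
  rw [hadd, s4', add_zero, h12]
  obtain ⟨y, hy, v, rfl⟩ := hdec b
  rw [hadd, s4', add_zero, h23, h12]
  obtain ⟨z, hz, w, rfl⟩ := hdec c
  rw [hadd, s4', add_zero, h34, h23, h12]
  obtain ⟨t, ht, w, rfl⟩ := hdec d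
  rw [hadd, s4', add_zero]
  exact hC _ ht _ hz _ hy _ hx

section
variable {L : Type*} [LieRing L] [LieAlgebra ℂ L]

/-- The trace of a product of four adjoint operators. -/
noncomputable def tr4 (a b c d : L) : ℂ :=
  LinearMap.trace ℂ L (LieAlgebra.ad ℂ L a * LieAlgebra.ad ℂ L b * LieAlgebra.ad ℂ L c *
    LieAlgebra.ad ℂ L d)

theorem tr4_cycle (a b c d : L) : tr4 a b c d = tr4 b c d a := by
  rw [tr4, tr4, mul_assoc, mul_assoc,
    LinearMap.trace_mul_comm, ← mul_assoc]

theorem tr4_inv (y a b c d : L) :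
    tr4 ⁅y, a⁆ b c d + tr4 a ⁅y, b⁆ c d + tr4 a b ⁅y, c⁆ d + tr4 a b c ⁅y, d⁆ = 0 := by
  simp only [tr4, LieHom.map_lie, LieRing.of_associative_ring_bracket]
  rw [← map_add, ← map_add, ← map_add]
  set A := LieAlgebra.ad ℂ L a
  set B := LieAlgebra.ad ℂ L b
  set C := LieAlgebra.ad ℂ L c
  set D := LieAlgebra.ad ℂ L d
  set Y := LieAlgebra.ad ℂ L y
  have : (Y * A - A * Y) * B * C * D + A * (Y * B - B * Y) * C * D + A * B * (Y * C - C * Y) * D +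
      A * B * C * (Y * D - D * Y) = Y * (A * B * C * D) - (A * B * C * D) * Y := by noncomm_ring
  rw [this, map_sub, LinearMap.trace_mul_comm, sub_self]

theorem tr4_add (a a' b c d : L) : tr4 (a + a') b c d = tr4 a b c d + tr4 a' b c d := by
  simp only [tr4, map_add, add_mul]

/-- The symmetric quartic form which vanishes identically in type `E₈`. -/
noncomputable def quartic (a b c d : L) : ℂ :=
  tr4 a b c d + tr4 a b d c + tr4 a c b d + tr4 a c d b + tr4 a d b c + tr4 a d c b -
    (1 / 50) * (killingForm ℂ L a b * killingForm ℂ L c d +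
      killingForm ℂ L a c * killingForm ℂ L b d + killingForm ℂ L a d * killingForm ℂ L b c)

end

theorem killing_inv' {L : Type*} [LieRing L] [LieAlgebra ℂ L] (y a b : L) :
    killingForm ℂ L ⁅y, a⁆ b + killingForm ℂ L a ⁅y, b⁆ = 0 := by
  rw [← lie_skew, map_neg, LinearMap.neg_apply, killing_inv]; ring

namespace IsSerre

variable {L : Type*} [LieRing L] [LieAlgebra ℂ L] {H E F : Fin 8 → L} [Nontrivial L]

theorem quartic_h (S : IsSerre H E F) (i j k l : Fin 8) : quartic (H i) (H j) (H k) (H l) = 0 := by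
  simp only [quartic, tr4, S.trace_h_four, S.killing_h, cm_symm l k, cm_symm l j, cm_symm k j]
  ring

theorem quartic_eq_zero (S : IsSerre H E F) (a b c d : L) : quartic a b c d = 0 := by
  have hadd : ∀ a a' b c d : L, quartic (a + a') b c d = quartic a b c d + quartic a' b c d := by
    intro a a' b c d
    simp only [quartic, tr4_add, map_add, LinearMap.add_apply]
    ring
  have h12 : ∀ a b c d : L, quartic a b c d = quartic b a c d := by
    intro a b c d
    simp only [quartic]
    rw [killing_symm b a, tr4_cycle a b c d, tr4_cycle a b d c, tr4_cycle a c b d,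
      tr4_cycle c b d a, tr4_cycle a c d b, tr4_cycle c d b a, tr4_cycle d b a c,
      tr4_cycle a d b c, tr4_cycle d b c a,
      tr4_cycle a d c b, tr4_cycle d c b a, tr4_cycle c b a d]
    ring
  have h23 : ∀ a b c d : L, quartic a b c d = quartic a c b d := by
    intro a b c d
    simp only [quartic]
    rw [killing_symm c b]
    ring
  have h34 : ∀ a b c d : L, quartic a b c d = quartic a b d c := by
    intro a b c d
    simp only [quartic]
    rw [killing_symm d c]
    ring
  have hinv : ∀ y a b c d : L, quartic ⁅y, a⁆ b c d + quartic a ⁅y, b⁆ c d +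
      quartic a b ⁅y, c⁆ d + quartic a b c ⁅y, d⁆ = 0 := by
    intro y a b c d
    simp only [quartic]
    linear_combination tr4_inv y a b c d + tr4_inv y a b d c + tr4_inv y a c b d +
      tr4_inv y a c d b + tr4_inv y a d b c + tr4_inv y a d c b -
      (1 / 50) * (killingForm ℂ L c d * killing_inv' y a b + killingForm ℂ L a b * killing_inv' y c d +
        killingForm ℂ L b d * killing_inv' y a c + killingForm ℂ L a c * killing_inv' y b d +
        killingForm ℂ L b c * killing_inv' y a d + killingForm ℂ L a d * killing_inv' y b c)
  have hsmul : ∀ (t : ℂ) (a b c d : L), quartic (t • a) b c d = t * quartic a b c d := by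
    intro t a b c d
    simp only [quartic, tr4, map_smul, smul_mul_assoc, LinearMap.smul_apply, smul_eq_mul]
    ring
  have hspan : ∀ b c d : L, (∀ i, quartic (H i) b c d = 0) →
      ∀ a ∈ Submodule.span ℂ (Set.range H), quartic a b c d = 0 := by
    intro b c d h a ha
    induction ha using Submodule.span_induction with
    | mem x hx => obtain ⟨i, rfl⟩ := hx; exact h i
    | zero => simpa using hsmul 0 0 b c d
    | add x y _ _ hx hy => rw [hadd, hx, hy, add_zero]
    | smul t x _ hx => rw [hsmul, hx, mul_zero]
  set h0 := cart H (fun i => (rhoCoeff i : ℂ)) with hh0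
  have hmem : ∀ i, H i ∈ Submodule.span ℂ (Set.range H) := fun i => Submodule.subset_span ⟨i, rfl⟩
  refine invariant_four_eq_zero quartic hadd h12 h23 h34 hinv
    (Submodule.span ℂ (Set.range H) : Set L) h0 ?_ ?_ ?_ a b c d
  · exact Submodule.sum_mem _ fun i _ => Submodule.smul_mem _ _ (hmem i)
  · intro a ha b hb c hc d hd
    refine hspan b c d (fun i => ?_) a ha
    rw [h12]
    refine hspan _ c d (fun j => ?_) b hb
    rw [h23, h12]
    refine hspan _ _ d (fun k => ?_) c hc
    rw [h34, h23, h12]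
    exact hspan _ _ _ (fun l => S.quartic_h _ _ _ _) d hd
  · -- every vector splits into a Cartan part and a part in the image of `ad h0`
    have hroot : ∀ k : PosRoot ⊕ PosRoot, ∃ u : L, basisVec H E F (.inr k) = ⁅u, h0⁆ := by
      intro k
      have h1 := S.lie_cart_basisVec (fun i => (rhoCoeff i : ℂ)) (.inr k)
      set t : ℂ := ∑ i, (rhoCoeff i : ℂ) * idxWt (.inr k) i with htdef
      have ht0 : t ≠ 0 := by
        rcases k with n | n
        · have e1 : t = (ht n : ℂ) := by
            have := ht_eq n n.mem
            rw [htdef]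
            exact_mod_cast congrArg (Int.cast : ℤ → ℂ) this.symm
          rw [e1]
          exact_mod_cast (ht_pos n n.mem).ne'
        · have e1 : t = -(ht n : ℂ) := by
            have := ht_eq n n.mem
            have e2 : (ht n : ℂ) = ∑ i, (rhoCoeff i : ℂ) * wt n i := by
              exact_mod_cast congrArg (Int.cast : ℤ → ℂ) this
            rw [htdef, e2]
            simp [idxWt]
          rw [e1]
          exact neg_ne_zero.mpr (by exact_mod_cast (ht_pos n n.mem).ne')
      refine ⟨-t⁻¹ • basisVec H E F (.inr k), ?_⟩
      rw [smul_lie, ← lie_skew, h1, neg_smul_neg, smul_smul, inv_mul_cancel₀ ht0, one_smul]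
    choose u hu using hroot
    intro a
    refine ⟨∑ i, S.basis.repr a (.inl i) • H i,
      Submodule.sum_mem _ fun i _ => Submodule.smul_mem _ _ (hmem i),
      ∑ k, S.basis.repr a (.inr k) • u k, ?_⟩
    conv_lhs => rw [← S.basis.sum_repr a, Fintype.sum_sum_type]
    rw [sum_lie]
    refine congrArg₂ (· + ·) (Finset.sum_congr rfl fun i _ => ?_)
      (Finset.sum_congr rfl fun k _ => ?_)
    · rw [S.basis_apply]; rfl
    · rw [S.basis_apply, smul_lie, ← hu]

end IsSerre

end EEight

namespace EEight

section

variable {L : Type*} [LieRing L] [LieAlgebra ℂ L]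

theorem tr4_self (hq : ∀ a b c d : L, quartic a b c d = 0) (h : L) :
    100 * tr4 h h h h = killingForm ℂ L h h ^ 2 := by
  have q := hq h h h h
  simp only [quartic] at q
  linear_combination (50 / 3) * q

theorem tr4_three (hq : ∀ a b c d : L, quartic a b c d = 0) (h b : L) :
    100 * tr4 h h h b = killingForm ℂ L h h * killingForm ℂ L h b := by
  have q := hq h h h b
  simp only [quartic] at q
  have c1 := tr4_cycle h h h b
  have c2 := tr4_cycle h h b h
  have c3 := tr4_cycle h b h h
  rw [c3, ← c3, ← c2, ← c1] at q
  linear_combination (50 / 3) * q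

theorem ad_mul_comm {h b : L} (hb : ⁅h, b⁆ = 0) :
    LieAlgebra.ad ℂ L h * LieAlgebra.ad ℂ L b = LieAlgebra.ad ℂ L b * LieAlgebra.ad ℂ L h := by
  ext v
  simp only [Module.End.mul_apply, LieAlgebra.ad_apply]
  rw [leibniz_lie, hb, zero_lie, zero_add]

theorem tr4_comm (h b c d : L) (hb : ⁅h, b⁆ = 0) : tr4 h b c d = tr4 b h c d := by
  rw [tr4, tr4, ad_mul_comm hb]

theorem tr4_two (hq : ∀ a b c d : L, quartic a b c d = 0) (h b c : L) (hb : ⁅h, b⁆ = 0)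
    (hc : ⁅h, c⁆ = 0) :
    300 * tr4 h h b c = killingForm ℂ L h h * killingForm ℂ L b c +
      2 * (killingForm ℂ L h b * killingForm ℂ L h c) := by
  have q := hq h h b c
  simp only [quartic] at q
  have c1 := tr4_cycle h h b c
  have c2 := tr4_cycle h h c b
  have c3 := tr4_cycle b h h c
  have c4 := tr4_cycle c h h b
  have c5 := tr4_cycle h b h c
  have c6 := tr4_cycle b h c h
  have k1 := tr4_comm h b h c hb
  have k2 := tr4_comm h c h b hc
  have : tr4 h h c b = tr4 h h b c := by linear_combination -c3 - k1 + c5 + c6 + k2 + c4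
  rw [← c1, ← c2, c5, c6, k2, c4, this] at q
  linear_combination 50 * q

end
end EEight

namespace EEight

section
variable {R : Type*} [Ring R] [Algebra ℂ R]

/-- The inner derivation of an associative algebra. -/
def innerDer (A : R) : Module.End ℂ R := LinearMap.mulLeft ℂ A - LinearMap.mulRight ℂ A

theorem innerDer_apply (A X : R) : innerDer A X = A * X - X * A := rfl

theorem innerDer_pow_mul (A B : R) (hC : A * (A * B - B * A) = (A * B - B * A) * A) (X : R) (n : ℕ) :
    ((innerDer A) ^ (n + 1)) (B * X) = B * ((innerDer A) ^ (n + 1)) X +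
      (n + 1 : ℂ) • ((A * B - B * A) * ((innerDer A) ^ n) X) := by
  have ad_mul : ∀ Y Z : R, innerDer A (Y * Z) =
      (A * Y - Y * A) * Z + Y * innerDer A Z := by
    intro Y Z
    simp only [innerDer_apply]
    noncomm_ring
  induction n with
  | zero => simp [ad_mul, add_comm]
  | succ n ih =>
    rw [pow_succ', Module.End.mul_apply, ih, map_add, map_smul, ad_mul, ad_mul, hC, sub_self, zero_mul,
      zero_add, ← Module.End.mul_apply, ← Module.End.mul_apply, ← pow_succ', ← pow_succ']
    push_cast
    module

/-- The Kleinecke–Shirokov lemma for a nilpotent element. -/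
theorem isNilpotent_commutator {A : R} (hA : IsNilpotent A) (B : R)
    (hC : A * (A * B - B * A) = (A * B - B * A) * A) : IsNilpotent (A * B - B * A) := by
  have key : ∀ n : ℕ, ((innerDer A) ^ (n + 1)) (B ^ n) = 0 ∧
      ((innerDer A) ^ n) (B ^ n) = (n.factorial : ℂ) • (A * B - B * A) ^ n := by
    intro n
    induction n with
    | zero => simp [innerDer_apply]
    | succ n ih =>
      constructor
      · rw [pow_succ' B, innerDer_pow_mul A B hC, ih.1, pow_succ', Module.End.mul_apply, ih.1]
        simp
      · rw [pow_succ' B, innerDer_pow_mul A B hC, ih.1, ih.2, Nat.factorial_succ, mul_smul_comm,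
          smul_smul, ← pow_succ']
        simp
  obtain ⟨n, hn⟩ : IsNilpotent (innerDer A) :=
    Commute.isNilpotent_sub (LinearMap.commute_mulLeft_right (R := ℂ) A A)
      ((LinearMap.isNilpotent_mulLeft_iff ℂ A).mpr hA)
      ((LinearMap.isNilpotent_mulRight_iff ℂ A).mpr hA)
  have := (key n).2
  rw [hn, LinearMap.zero_apply] at this
  exact ⟨n, ((smul_eq_zero.mp this.symm).resolve_left (by exact_mod_cast n.factorial_ne_zero))⟩

end

section
variable {V : Type*} [AddCommGroup V] [Module ℂ V]

theorem trace_mul_eq_zero [FiniteDimensional ℂ V] {A : Module.End ℂ V} (hA : IsNilpotent A)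
    (B : Module.End ℂ V) (hC : A * (A * B - B * A) = (A * B - B * A) * A) :
    LinearMap.trace ℂ V (A * B) = 0 := by
  have hnil := isNilpotent_commutator hA B hC
  set C := A * B - B * A with hCdef
  have hpow : ∀ k : ℕ, A ^ (k + 1) * B = B * A ^ (k + 1) + (k + 1 : ℂ) • (C * A ^ k) := by
    intro k
    induction k with
    | zero => simp [hCdef]
    | succ k ih =>
      have : Commute A C := hC
      have h2 : A ^ (k + 1) * C = C * A ^ (k + 1) := (this.pow_left (k + 1))
      rw [pow_succ, mul_assoc, show A * B = B * A + C by rw [hCdef]; abel, mul_add, ← mul_assoc, ih, h2,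
        add_mul, mul_assoc, ← pow_succ, smul_mul_assoc, mul_assoc C, ← pow_succ]
      push_cast
      module
  classical
  have hev : ∀ μ : ℂ, μ ≠ 0 → (A * B).maxGenEigenspace μ = ⊥ := by
    intro μ hμ
    by_contra hne
    have h1 : (A * B).HasEigenvalue μ := by
      rw [Module.End.HasEigenvalue, ← Module.End.hasUnifEigenvalue_iff_hasUnifEigenvalue_one (k := ⊤) (by simp)]
      exact hne
    obtain ⟨v, hv⟩ := h1.exists_hasEigenvector
    have hAB : A (B v) = μ • v := hv.apply_eq_smul
    obtain ⟨N, hN⟩ := hA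
    have hex : ∃ n, (A ^ n) v = 0 := ⟨N, by rw [hN]; rfl⟩
    obtain ⟨k, hk⟩ : ∃ k, Nat.find hex = k + 1 := by
      refine Nat.exists_eq_succ_of_ne_zero fun h0 => hv.2 ?_
      have := Nat.find_spec hex
      rw [h0] at this
      simpa using this
    have h3 : (A ^ (k + 1)) v = 0 := hk ▸ Nat.find_spec hex
    have h4 : (A ^ k) v ≠ 0 := Nat.find_min hex (by omega)
    have h5 := congrArg (fun f : Module.End ℂ V => f v) (hpow k)
    simp only [Module.End.mul_apply, LinearMap.add_apply, LinearMap.smul_apply, h3, map_zero, zero_add] at h5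
    rw [pow_succ, Module.End.mul_apply, hAB, map_smul] at h5
    have hk0 : (k + 1 : ℂ) ≠ 0 := by exact_mod_cast k.succ_ne_zero
    have h6 : C ((A ^ k) v) = (μ / (k + 1)) • (A ^ k) v := by
      rw [div_eq_inv_mul, mul_smul, h5, smul_smul, inv_mul_cancel₀ hk0, one_smul]
    have h7 : C.HasEigenvalue (μ / (k + 1)) :=
      Module.End.hasEigenvalue_of_hasEigenvector ⟨Module.End.mem_eigenspace_iff.mpr h6, h4⟩
    have h8 := h7.isNilpotent_of_isNilpotent hnil
    exact div_ne_zero hμ hk0 h8.eq_zero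
  have htop : (A * B).maxGenEigenspace 0 = ⊤ := by
    rw [eq_top_iff, ← Module.End.iSup_maxGenEigenspace_eq_top (A * B)]
    refine iSup_le fun μ => ?_
    by_cases hμ : μ = 0
    · rw [hμ]
    · rw [hev μ hμ]; exact bot_le
  have hnilAB : IsNilpotent (A * B) := by
    rw [Module.End.maxGenEigenspace_eq_genEigenspace_finrank] at htop
    refine ⟨Module.finrank ℂ V, LinearMap.ext fun v => ?_⟩
    have : v ∈ (A * B).genEigenspace 0 (Module.finrank ℂ V) := htop ▸ Submodule.mem_top
    rw [Module.End.mem_genEigenspace_nat] at this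
    simpa using this
  exact (LinearMap.isNilpotent_trace_of_isNilpotent hnilAB).eq_zero

open Polynomial

/-- On the kernel of the raising operator, the weight operator is annihilated by
`X (X - 1) ⋯ (X - N + 1)`. -/
theorem aeval_prod_ker {E H F : Module.End ℂ V} (hEF : E * F - F * E = H)
    (hHE : H * E - E * H = (2 : ℂ) • E) {N : ℕ} (hN : E ^ N = 0) {v : V} (hv : E v = 0) :
    aeval H (∏ i ∈ Finset.range N, (X - C (i : ℂ))) v = 0 := by
  have hker : ∀ w, E w = 0 → E (H w) = 0 := by
    intro w hw
    have := congrArg (fun f : Module.End ℂ V => f w) hHE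
    simpa [hw] using this
  have hHE' : H * E = E * H + (2 : ℂ) • E := by rw [← hHE]; abel
  have hEH : ∀ n : ℕ, E ^ n * H = H * E ^ n - (2 * n : ℂ) • E ^ n := by
    intro n
    induction n with
    | zero => simp
    | succ n ih =>
      rw [pow_succ, mul_assoc, show E * H = H * E - (2 : ℂ) • E by rw [hHE']; abel, mul_sub,
        ← mul_assoc, ih, sub_mul, mul_assoc, ← pow_succ, mul_smul_comm, smul_mul_assoc, ← pow_succ]
      push_cast
      module
  have hpow : ∀ n : ℕ, E ^ (n + 1) * F - F * E ^ (n + 1) =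
      (n + 1 : ℂ) • (H * E ^ n - (n : ℂ) • E ^ n) := by
    intro n
    induction n with
    | zero => simpa using hEF
    | succ n ih =>
      have e1 : E ^ (n + 1 + 1) * F - F * E ^ (n + 1 + 1) =
          (E ^ (n + 1) * F - F * E ^ (n + 1)) * E + E ^ (n + 1) * (E * F - F * E) := by
        rw [pow_succ]; noncomm_ring
      rw [e1, ih, hEF, hEH, smul_mul_assoc, sub_mul, mul_assoc, smul_mul_assoc, ← pow_succ]
      push_cast
      module
  have key : ∀ n : ℕ, (∃ u, (E ^ n) u = aeval H (∏ i ∈ Finset.range n, (X - C (i : ℂ))) v) ∧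
      E (aeval H (∏ i ∈ Finset.range n, (X - C (i : ℂ))) v) = 0 := by
    intro n
    induction n with
    | zero => exact ⟨⟨v, by simp⟩, by simpa using hv⟩
    | succ n ih =>
      obtain ⟨⟨u, hu⟩, hE⟩ := ih
      set w := aeval H (∏ i ∈ Finset.range n, (X - C (i : ℂ))) v with hw
      have e1 : aeval H (∏ i ∈ Finset.range (n + 1), (X - C (i : ℂ))) v = H w - (n : ℂ) • w := by
        rw [Finset.prod_range_succ, mul_comm, map_mul, Module.End.mul_apply, ← hw]
        simp [Nat.cast_smul_eq_nsmul]
      rw [e1]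
      refine ⟨⟨((n + 1 : ℂ)⁻¹) • F u, ?_⟩, ?_⟩
      · have h1 := congrArg (fun f : Module.End ℂ V => f u) (hpow n)
        simp only [LinearMap.sub_apply, Module.End.mul_apply, LinearMap.smul_apply, hu] at h1
        rw [show (E ^ (n + 1)) u = 0 by rw [pow_succ', Module.End.mul_apply, hu, hE], map_zero, sub_zero] at h1
        have hk0 : (n + 1 : ℂ) ≠ 0 := by exact_mod_cast n.succ_ne_zero
        rw [map_smul, h1, smul_smul, inv_mul_cancel₀ hk0, one_smul]
      · rw [map_sub, map_smul, hE, hker _ hE]; simp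
  obtain ⟨⟨u, hu⟩, -⟩ := key N
  rw [← hu, hN, LinearMap.zero_apply]

theorem aeval_prod_apply {H : Module.End ℂ V} {v : V} {μ : ℂ} (h : H v = μ • v) (p : ℂ[X]) :
    aeval H p v = p.eval μ • v := by
  induction p using Polynomial.induction_on' with
  | add p q hp hq => simp [hp, hq, add_smul]
  | monomial n a =>
    have : (H ^ n) v = μ ^ n • v := by
      induction n with
      | zero => simp
      | succ n ih => rw [pow_succ, Module.End.mul_apply, h, map_smul, ih, smul_smul, pow_succ, mul_comm]
    rw [aeval_monomial, Module.End.mul_apply, this, eval_monomial, Module.algebraMap_end_apply, smul_smul]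

theorem weight_nat {E H F : Module.End ℂ V} (hEF : E * F - F * E = H)
    (hHE : H * E - E * H = (2 : ℂ) • E) {N : ℕ} (hN : E ^ N = 0) {v : V} (hv : E v = 0) {μ : ℂ}
    (h : H v = μ • v) (h0 : v ≠ 0) : ∃ n ∈ Finset.range N, μ = n := by
  have h1 := aeval_prod_ker hEF hHE hN hv
  rw [aeval_prod_apply h, smul_eq_zero, or_iff_left h0, eval_prod, Finset.prod_eq_zero_iff] at h1
  obtain ⟨n, hn, h2⟩ := h1
  exact ⟨n, hn, by simpa [sub_eq_zero] using h2⟩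

end

end EEight

namespace EEight

open LieAlgebra Polynomial

variable {L : Type*} [LieRing L] [LieAlgebra ℂ L]

theorem exists_killing_eq [FiniteDimensional ℂ L]
    (hκ : ∀ z : L, (∀ y, killingForm ℂ L z y = 0) → z = 0) (φ : Module.Dual ℂ L) :
    ∃ z : L, ∀ y, killingForm ℂ L z y = φ y := by
  have hinj : Function.Injective (killingForm ℂ L) := by
    rw [injective_iff_map_eq_zero]
    intro z hz
    exact hκ z fun y => by rw [hz]; rfl
  have hsurj := (LinearMap.injective_iff_surjective_of_finrank_eq_finrank
    (Subspace.dual_finrank_eq (K := ℂ) (V := L)).symm).mp hinj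
  obtain ⟨z, hz⟩ := hsurj φ
  exact ⟨z, fun y => by rw [hz]⟩

/-- An element orthogonal to the orthogonal complement of a subspace lies in the subspace. -/
theorem mem_of_orthogonal [FiniteDimensional ℂ L]
    (hκ : ∀ z : L, (∀ y, killingForm ℂ L z y = 0) → z = 0) (U : Submodule ℂ L) (x : L)
    (h : ∀ z : L, (∀ u ∈ U, killingForm ℂ L z u = 0) → killingForm ℂ L z x = 0) : x ∈ U := by
  by_contra hx
  obtain ⟨φ, hφ, hU⟩ := Submodule.exists_le_ker_of_notMem hx
  obtain ⟨z, hz⟩ := exists_killing_eq hκ φ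
  refine hφ ?_
  rw [← hz]
  exact h z fun u hu => by rw [hz]; exact hU hu

theorem ad_eq_comm (x y : L) : ad ℂ L x * ad ℂ L y - ad ℂ L y * ad ℂ L x = ad ℂ L ⁅x, y⁆ := by
  ext v
  simp [ad_apply]

/-- The Jacobson–Morozov theorem. -/
theorem jacobson_morozov [FiniteDimensional ℂ L]
    (hκ : ∀ z : L, (∀ y, killingForm ℂ L z y = 0) → z = 0) {e : L}
    (he : IsNilpotent (ad ℂ L e)) : ∃ h f : L, ⁅h, e⁆ = (2 : ℂ) • e ∧ ⁅e, f⁆ = h ∧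
      ⁅h, f⁆ = -(2 : ℂ) • f := by
  have hsq : e ∈ LinearMap.range (ad ℂ L e * ad ℂ L e) := by
    refine mem_of_orthogonal hκ _ _ fun z hz => ?_
    have hz2 : ⁅e, ⁅e, z⁆⁆ = 0 := by
      refine hκ _ fun y => ?_
      have h1 := hz _ ⟨y, rfl⟩
      have h2 := killing_inv' e ⁅e, z⁆ y
      have h3 := killing_inv' e z ⁅e, y⁆
      simp only [Module.End.mul_apply, ad_apply] at h1
      linear_combination h1 + h2 - h3
    rw [killing_symm, killing_def]
    refine trace_mul_eq_zero he _ ?_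
    rw [← sub_eq_zero, ad_eq_comm, ad_eq_comm, hz2, map_zero]
  obtain ⟨u, hu⟩ := hsq
  simp only [Module.End.mul_apply, ad_apply] at hu
  set h : L := -(2 : ℂ) • ⁅e, u⁆ with hh
  have hhe : ⁅h, e⁆ = (2 : ℂ) • e := by
    rw [hh, smul_lie, ← lie_skew, hu]; module
  obtain ⟨N, hN⟩ := he
  set f' : L := -(2 : ℂ) • u with hf'
  have hef' : ⁅e, f'⁆ = h := by rw [hf', lie_smul]
  clear_value h f'
  have heh : ⁅e, h⁆ = -(2 : ℂ) • e := by rw [← lie_skew, hhe]; module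
  have hker : ⁅e, ⁅h, f'⁆ + (2 : ℂ) • f'⁆ = 0 := by
    rw [lie_add, leibniz_lie, heh, hef', lie_self, lie_smul, smul_lie, hef']; module
  have hHE : ad ℂ L h * ad ℂ L e - ad ℂ L e * ad ℂ L h = (2 : ℂ) • ad ℂ L e := by
    rw [ad_eq_comm, hhe, map_smul]
  have hEF : ad ℂ L e * ad ℂ L f' - ad ℂ L f' * ad ℂ L e = ad ℂ L h := by
    rw [ad_eq_comm, hef']
  have hmaps : ∀ v ∈ LinearMap.ker (ad ℂ L e),
      (ad ℂ L h + (2 : ℂ) • (1 : Module.End ℂ L)) v ∈ LinearMap.ker (ad ℂ L e) := by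
    intro v hv
    have hv' : ⁅e, v⁆ = 0 := hv
    simp only [LinearMap.mem_ker, LinearMap.add_apply, ad_apply, LinearMap.smul_apply,
      Module.End.one_apply, lie_add, lie_smul, hv', leibniz_lie e h v, heh, smul_lie]
    simp
  set T := (ad ℂ L h + (2 : ℂ) • (1 : Module.End ℂ L)).restrict hmaps with hT
  have hinj : Function.Injective T := by
    rw [injective_iff_map_eq_zero]
    rintro ⟨v, hv⟩ hTv
    have h1 : (ad ℂ L h + (2 : ℂ) • (1 : Module.End ℂ L)) v = 0 := congrArg Subtype.val hTv
    by_contra hne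
    have h2 : ad ℂ L h v = (-2 : ℂ) • v := by
      rw [LinearMap.add_apply, LinearMap.smul_apply, Module.End.one_apply] at h1
      rw [eq_neg_of_add_eq_zero_left h1, neg_smul]
    obtain ⟨n, -, hn⟩ := weight_nat hEF hHE hN hv h2 fun h0 => hne (Subtype.ext h0)
    have : ((n + 2 : ℕ) : ℂ) = 0 := by push_cast; rw [← hn]; norm_num
    exact absurd (Nat.cast_eq_zero.mp this) (by omega)
  obtain ⟨⟨g, hg⟩, hTg⟩ := LinearMap.injective_iff_surjective.mp hinj
    ⟨⁅h, f'⁆ + (2 : ℂ) • f', hker⟩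
  have hg2 : ⁅h, g⁆ + (2 : ℂ) • g = ⁅h, f'⁆ + (2 : ℂ) • f' := congrArg Subtype.val hTg
  have hg1 : ⁅e, g⁆ = 0 := hg
  refine ⟨h, f' - g, hhe, by rw [lie_sub, hef', hg1, sub_zero], ?_⟩
  have : ⁅h, f'⁆ - ⁅h, g⁆ = (2 : ℂ) • g - (2 : ℂ) • f' := by
    rw [sub_eq_sub_iff_add_eq_add, ← hg2]; abel
  rw [lie_sub, this]; module

end EEight

namespace EEight

open Polynomial

variable {V : Type*} [AddCommGroup V] [Module ℂ V]

theorem prod_eigen_injective {H : Module.End ℂ V} {T : Submodule ℂ V} (hT : ∀ v ∈ T, H v ∈ T)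
    (s : Finset ℕ) (h : ∀ i ∈ s, ∀ v ∈ T, H v = (i : ℂ) • v → v = 0) :
    ∀ v ∈ T, aeval H (∏ i ∈ s, (X - C (i : ℂ))) v = 0 → v = 0 := by
  induction s using Finset.induction_on with
  | empty => intro v _ h; simpa using h
  | insert a s ha ih =>
    intro v hv h1
    rw [Finset.prod_insert ha, mul_comm, map_mul, Module.End.mul_apply] at h1
    have h2 : aeval H (X - C (a : ℂ)) v = H v - (a : ℂ) • v := by
      rw [map_sub, aeval_X, aeval_C, LinearMap.sub_apply, Module.algebraMap_end_apply]
    rw [h2] at h1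
    have h3 := ih (fun i hi => h i (Finset.mem_insert_of_mem hi)) _
      (T.sub_mem (hT v hv) (T.smul_mem _ hv)) h1
    exact h a (Finset.mem_insert_self _ _) v hv (sub_eq_zero.mp h3)

theorem exists_sub_smul_eq (H : Module.End ℂ V) (S : Set ℂ) {a : ℂ} (ha : a ∉ S) {w : V}
    (hw : w ∈ ⨆ μ : S, H.eigenspace μ) : ∃ u ∈ ⨆ μ : S, H.eigenspace μ, H u - a • u = w := by
  induction hw using Submodule.iSup_induction' with
  | mem μ x hx =>
    have hne : (μ : ℂ) - a ≠ 0 := sub_ne_zero.mpr fun h => ha (h ▸ μ.2)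
    refine ⟨((μ : ℂ) - a)⁻¹ • x, Submodule.mem_iSup_of_mem μ (Submodule.smul_mem _ _ hx), ?_⟩
    rw [map_smul, Module.End.mem_eigenspace_iff.mp hx, smul_comm a, ← smul_sub, ← sub_smul, smul_smul,
      inv_mul_cancel₀ hne, one_smul]
  | zero => exact ⟨0, zero_mem _, by simp⟩
  | add x y _ _ hx hy =>
    obtain ⟨u, hu, rfl⟩ := hx
    obtain ⟨v, hv, rfl⟩ := hy
    exact ⟨u + v, add_mem hu hv, by rw [map_add, smul_add]; abel⟩

/-- The weight operator of a finite-dimensional representation of `𝔰𝔩₂` is diagonalizable with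
integer eigenvalues. -/
theorem iSup_weight_eq_top [FiniteDimensional ℂ V] {E H F : Module.End ℂ V}
    (hEF : E * F - F * E = H) (hHE : H * E - E * H = (2 : ℂ) • E)
    (hHF : H * F - F * H = -(2 : ℂ) • F) {N : ℕ} (hN : E ^ N = 0) :
    ⨆ k : ℤ, H.eigenspace (k : ℂ) = ⊤ := by
  set Ω : Module.End ℂ V := 4 * (F * E) + 2 * H + H * H with hΩ
  have hr : H * E - E * H - 2 * E = 0 := by rw [hHE, two_smul, two_mul, sub_self]
  have hs : E * F - F * E - H = 0 := by rw [hEF, sub_self]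
  have ht : H * F - F * H + 2 * F = 0 := by rw [hHF, neg_smul, two_smul, two_mul]; abel
  have hΩE : Commute Ω E := by
    refine (sub_eq_zero.mp ?_).symm
    have : E * Ω - Ω * E = 4 * ((E * F - F * E - H) * E) -
        (H * (H * E - E * H - 2 * E) + (H * E - E * H - 2 * E) * H) := by
      rw [hΩ]; noncomm_ring
    rw [this, hr, hs]; simp
  have hΩH : Commute Ω H := by
    refine (sub_eq_zero.mp ?_).symm
    have : H * Ω - Ω * H = 4 * ((H * F - F * H + 2 * F) * E) + 4 * (F * (H * E - E * H - 2 * E)) := by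
      rw [hΩ]; noncomm_ring
    rw [this, hr, ht]; simp
  have hEpow : ∀ (k : ℕ) (v : V), H ((E ^ k) v) = (E ^ k) (H v) + (2 * k : ℂ) • (E ^ k) v := by
    intro k
    induction k with
    | zero => intro v; simp
    | succ k ih =>
      intro v
      have h1 : ∀ u, H (E u) = E (H u) + (2 : ℂ) • E u := by
        intro u
        have := congrArg (fun f : Module.End ℂ V => f u) hHE
        simp only [LinearMap.sub_apply, Module.End.mul_apply, LinearMap.smul_apply] at this
        rw [← this]; abel
      rw [pow_succ, Module.End.mul_apply, Module.End.mul_apply, ih, h1, map_add, map_smul]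
      push_cast
      module
  have hmapsG : ∀ c, ∀ v ∈ Ω.maxGenEigenspace c, H v ∈ Ω.maxGenEigenspace c := fun c v hv =>
    Module.End.mapsTo_maxGenEigenspace_of_comm hΩH c hv
  have hmapsE : ∀ c (k : ℕ), ∀ v ∈ Ω.maxGenEigenspace c, (E ^ k) v ∈ Ω.maxGenEigenspace c :=
    fun c k v hv => Module.End.mapsTo_maxGenEigenspace_of_comm (hΩE.pow_right k) c hv
  have claim1 : ∀ c : ℂ, ∃ d : ℕ, ∀ v ∈ Ω.maxGenEigenspace c ⊓ LinearMap.ker E, H v = (d : ℂ) • v := by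
    intro c
    set T := Ω.maxGenEigenspace c ⊓ LinearMap.ker E with hTdef
    have hT : ∀ v ∈ T, H v ∈ T := by
      rintro v ⟨h1, h2⟩
      refine ⟨hmapsG c v h1, ?_⟩
      have h2' : E v = 0 := h2
      have := hEpow 1 v
      simp only [pow_one, h2', map_zero, smul_zero, add_zero] at this
      exact this.symm
    have hc : ∀ i : ℕ, (i : ℂ) ^ 2 + 2 * i ≠ c → ∀ v ∈ T, H v = (i : ℂ) • v → v = 0 := by
      rintro i hi v ⟨h1, h2⟩ hv
      have h2' : E v = 0 := h2
      have h3 : Ω v = ((i : ℂ) ^ 2 + 2 * i) • v := by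
        have e2 : (2 : Module.End ℂ V) * H = (2 : ℂ) • H := by rw [two_smul, two_mul]
        rw [hΩ, e2]
        simp only [LinearMap.add_apply, Module.End.mul_apply, h2', map_zero, hv, map_smul,
          LinearMap.smul_apply]
        module
      have h4 : v ∈ Ω.maxGenEigenspace ((i : ℂ) ^ 2 + 2 * i) :=
        Module.End.eigenspace_le_maxGenEigenspace (Module.End.mem_eigenspace_iff.mpr h3)
      exact Submodule.disjoint_def.mp (Module.End.disjoint_genEigenspace Ω hi ⊤ ⊤) v h4 h1
    have hprod : ∀ v ∈ T, aeval H (∏ i ∈ Finset.range N, (X - C (i : ℂ))) v = 0 := fun v hv =>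
      aeval_prod_ker hEF hHE hN hv.2
    by_cases hd : ∃ d ∈ Finset.range N, (d : ℂ) ^ 2 + 2 * d = c
    · obtain ⟨d, hdN, hd⟩ := hd
      refine ⟨d, fun v hv => ?_⟩
      have h1 := hprod v hv
      rw [← Finset.mul_prod_erase _ _ hdN, mul_comm, map_mul, Module.End.mul_apply, map_sub, aeval_X, aeval_C,
        LinearMap.sub_apply, Module.algebraMap_end_apply] at h1
      refine sub_eq_zero.mp (prod_eigen_injective hT _ (fun i hi => hc i fun hic => ?_) _
        (T.sub_mem (hT v hv) (T.smul_mem _ hv)) h1)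
      rw [← hd] at hic
      have h2 : i * i + 2 * i = d * d + 2 * d := by
        have : ((i * i + 2 * i : ℕ) : ℂ) = ((d * d + 2 * d : ℕ) : ℂ) := by
          push_cast; linear_combination hic
        exact_mod_cast this
      exact (Finset.mem_erase.mp hi).1 (by nlinarith [mul_self_nonneg (i - d : ℤ), Nat.lt_trichotomy i d, lt_trichotomy i d])
    · refine ⟨0, fun v hv => ?_⟩
      rw [prod_eigen_injective hT _ (fun i hi => hc i fun hic => hd ⟨i, hi, hic⟩) v hv (hprod v hv)]
      simp
  rw [eq_top_iff, ← Module.End.iSup_maxGenEigenspace_eq_top Ω]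
  refine iSup_le fun c => ?_
  obtain ⟨d, hd⟩ := claim1 c
  let S : ℕ → Set ℂ := fun k => {z | ∃ j < k, z = (d : ℂ) - 2 * (j : ℕ)}
  have claim2 : ∀ k : ℕ, ∀ v ∈ Ω.maxGenEigenspace c, (E ^ k) v = 0 →
      v ∈ ⨆ μ : S k, H.eigenspace μ := by
    intro k
    induction k with
    | zero => intro v _ h0; rw [show v = 0 by simpa using h0]; exact zero_mem _
    | succ k ih =>
      intro v hv hk
      have h1 := hd _ ⟨hmapsE c k v hv, by
        rw [SetLike.mem_coe, LinearMap.mem_ker, ← Module.End.mul_apply, ← pow_succ', hk]⟩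
      rw [hEpow] at h1
      set a : ℂ := (d : ℂ) - 2 * (k : ℕ) with ha
      have h2 : (E ^ k) (H v - a • v) = 0 := by
        rw [map_sub, map_smul, eq_sub_of_add_eq h1, ha]; module
      have h3 := ih _ (sub_mem (hmapsG c v hv) (Submodule.smul_mem _ _ hv)) h2
      have haS : a ∉ S k := by
        rintro ⟨j, hj, hja⟩
        rw [ha] at hja
        have : (k : ℂ) = j := by linear_combination (-1 / 2) * hja
        exact absurd (Nat.cast_injective this) hj.ne'
      obtain ⟨u, hu, hue⟩ := exists_sub_smul_eq H (S k) haS h3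
      have hle : ⨆ μ : S k, H.eigenspace (μ : ℂ) ≤ ⨆ μ : S (k + 1), H.eigenspace (μ : ℂ) := by
        refine iSup_le fun ⟨μ, j, hj, hμ⟩ => ?_
        exact le_iSup (fun ν : S (k + 1) => H.eigenspace (ν : ℂ)) ⟨μ, j, by omega, hμ⟩
      rw [← sub_add_cancel v u]
      refine add_mem (Submodule.mem_iSup_of_mem ⟨a, k, by omega, rfl⟩ ?_) (hle hu)
      rw [Module.End.mem_eigenspace_iff, map_sub, smul_sub, sub_eq_sub_iff_sub_eq_sub, hue]
  intro v hv
  have h1 := claim2 N v hv (by rw [hN]; rfl)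
  refine (iSup_le fun ⟨μ, j, hj, hμ⟩ => ?_ : (⨆ μ : S N, H.eigenspace (μ : ℂ)) ≤ _) h1
  refine le_trans (le_of_eq ?_) (le_iSup (fun k : ℤ => H.eigenspace (k : ℂ)) ((d : ℤ) - 2 * j))
  subst hμ
  push_cast
  rfl

end EEight

namespace EEight

open Polynomial LieAlgebra

section
variable {V : Type*} [AddCommGroup V] [Module ℂ V]

theorem eigenspaces_int_independent (G : Module.End ℂ V) :
    iSupIndep fun k : ℤ => G.eigenspace (k : ℂ) :=
  (Module.End.eigenspaces_iSupIndep G).comp Int.cast_injective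

variable [FiniteDimensional ℂ V]

theorem finite_weights (G : Module.End ℂ V) : {k : ℤ | G.eigenspace (k : ℂ) ≠ ⊥}.Finite :=
  WellFoundedGT.finite_ne_bot_of_iSupIndep (eigenspaces_int_independent G)

theorem trace_aeval {G : Module.End ℂ V} (hG : ⨆ k : ℤ, G.eigenspace (k : ℂ) = ⊤) (s : Finset ℤ)
    (hs : ∀ k ∉ s, G.eigenspace (k : ℂ) = ⊥) (p : ℂ[X]) :
    LinearMap.trace ℂ V (aeval G p) =
      ∑ k ∈ s, (Module.finrank ℂ (G.eigenspace (k : ℂ)) : ℂ) * p.eval (k : ℂ) := by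
  have hdirect := DirectSum.isInternal_submodule_of_iSupIndep_of_iSup_eq_top
    (eigenspaces_int_independent G) hG
  have hap : ∀ (k : ℤ) v, v ∈ G.eigenspace (k : ℂ) → aeval G p v = p.eval (k : ℂ) • v :=
    fun k v hv => aeval_prod_apply (Module.End.mem_eigenspace_iff.mp hv) p
  have hmaps : ∀ k : ℤ, Set.MapsTo (aeval G p) (G.eigenspace (k : ℂ)) (G.eigenspace (k : ℂ)) := by
    intro k v hv
    rw [hap k v hv]
    exact Submodule.smul_mem _ _ hv
  rw [LinearMap.trace_eq_sum_trace_restrict' hdirect (finite_weights G) hmaps]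
  have hval : ∀ k : ℤ, LinearMap.trace ℂ _ ((aeval G p).restrict (hmaps k)) =
      (Module.finrank ℂ (G.eigenspace (k : ℂ)) : ℂ) * p.eval (k : ℂ) := by
    intro k
    have : (aeval G p).restrict (hmaps k) = p.eval (k : ℂ) • LinearMap.id := by
      ext ⟨v, hv⟩
      exact hap k v hv
    rw [this, map_smul, LinearMap.trace_id, smul_eq_mul, mul_comm]
  simp_rw [hval]
  refine Finset.sum_subset (fun k hk => ?_) (fun k _ hk => ?_)
  · by_contra hks
    exact (finite_weights G).mem_toFinset.mp hk (hs k hks)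
  · have : G.eigenspace (k : ℂ) = ⊥ := by
      by_contra hne
      exact hk ((finite_weights G).mem_toFinset.mpr hne)
    rw [this]
    simp

theorem finrank_eq_sum {G : Module.End ℂ V} (hG : ⨆ k : ℤ, G.eigenspace (k : ℂ) = ⊤) (s : Finset ℤ)
    (hs : ∀ k ∉ s, G.eigenspace (k : ℂ) = ⊥) :
    Module.finrank ℂ V = ∑ k ∈ s, Module.finrank ℂ (G.eigenspace (k : ℂ)) := by
  have := trace_aeval hG s hs 1
  rw [map_one, LinearMap.trace_one] at this
  simp only [eval_one, mul_one] at this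
  exact_mod_cast this

end

/-- An `𝔰𝔩₂`-triple with nilpotent raising operator. -/
structure IsTriple {L : Type*} [LieRing L] [LieAlgebra ℂ L] (e h f : L) : Prop where
  he : ⁅h, e⁆ = (2 : ℂ) • e
  ef : ⁅e, f⁆ = h
  hf : ⁅h, f⁆ = -(2 : ℂ) • f
  nil : IsNilpotent (ad ℂ L e)

variable {L : Type*} [LieRing L] [LieAlgebra ℂ L]

/-- The weight spaces of `ad h`. -/
noncomputable abbrev wtSpace (h : L) (k : ℤ) : Submodule ℂ L := (ad ℂ L h).eigenspace (k : ℂ)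

theorem mem_wtSpace {h v : L} {k : ℤ} : v ∈ wtSpace h k ↔ ⁅h, v⁆ = (k : ℂ) • v :=
  Module.End.mem_eigenspace_iff

theorem lie_mem_wtSpace {h v w : L} {i j : ℤ} (hv : v ∈ wtSpace h i) (hw : w ∈ wtSpace h j) :
    ⁅v, w⁆ ∈ wtSpace h (i + j) := by
  rw [mem_wtSpace] at *
  rw [leibniz_lie, hv, hw, smul_lie, lie_smul, ← add_smul]
  push_cast
  rfl

theorem killing_wtSpace {h v w : L} {i j : ℤ} (hv : v ∈ wtSpace h i) (hw : w ∈ wtSpace h j)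
    (hij : i + j ≠ 0) : killingForm ℂ L v w = 0 := by
  rw [mem_wtSpace] at *
  have h1 := killing_inv' h v w
  rw [hv, hw] at h1
  simp only [map_smul, LinearMap.smul_apply, smul_eq_mul] at h1
  have h2 : ((i + j : ℤ) : ℂ) * killingForm ℂ L v w = 0 := by push_cast; linear_combination h1
  exact (mul_eq_zero.mp h2).resolve_left (by exact_mod_cast hij)

namespace IsTriple

variable {e h f : L}

theorem hEF (t : IsTriple e h f) : ad ℂ L e * ad ℂ L f - ad ℂ L f * ad ℂ L e = ad ℂ L h := by
  rw [ad_eq_comm, t.ef]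

theorem hHE (t : IsTriple e h f) :
    ad ℂ L h * ad ℂ L e - ad ℂ L e * ad ℂ L h = (2 : ℂ) • ad ℂ L e := by
  rw [ad_eq_comm, t.he, map_smul]

theorem hHF (t : IsTriple e h f) :
    ad ℂ L h * ad ℂ L f - ad ℂ L f * ad ℂ L h = -(2 : ℂ) • ad ℂ L f := by
  rw [ad_eq_comm, t.hf, map_smul]

theorem e_mem (t : IsTriple e h f) : e ∈ wtSpace h 2 := by
  rw [mem_wtSpace, t.he]; norm_num

theorem f_mem (t : IsTriple e h f) : f ∈ wtSpace h (-2) := by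
  rw [mem_wtSpace, t.hf]; norm_num

theorem h_mem (h : L) : h ∈ wtSpace h 0 := by
  rw [mem_wtSpace, lie_self]; simp

theorem eq_zero_of_neg (t : IsTriple e h f) {v : L} {k : ℤ} (hk : k < 0) (hv : v ∈ wtSpace h k)
    (hev : ⁅e, v⁆ = 0) : v = 0 := by
  by_contra h0
  obtain ⟨N, hN⟩ := t.nil
  obtain ⟨n, -, hn⟩ := weight_nat t.hEF t.hHE hN hev (mem_wtSpace.mp hv) h0
  have : k = n := by exact_mod_cast hn
  omega

variable [FiniteDimensional ℂ L]

theorem iSup_wtSpace (t : IsTriple e h f) : ⨆ k : ℤ, wtSpace h k = ⊤ := by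
  obtain ⟨N, hN⟩ := t.nil
  exact iSup_weight_eq_top t.hEF t.hHE t.hHF hN

theorem exists_component (t : IsTriple e h f) (z : L) (j : ℤ) :
    ∃ z₀ ∈ wtSpace h j, ∀ u ∈ wtSpace h (-j), killingForm ℂ L z u = killingForm ℂ L z₀ u := by
  have hz : z ∈ wtSpace h j ⊔ ⨆ k : ℤ, ⨆ _ : k ≠ j, wtSpace h k := by
    rw [← iSup_split_single (fun k : ℤ => wtSpace h k) j, t.iSup_wtSpace]
    exact Submodule.mem_top
  obtain ⟨z₀, hz₀, w, hw, rfl⟩ := Submodule.mem_sup.mp hz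
  refine ⟨z₀, hz₀, fun u hu => ?_⟩
  have : (⨆ k : ℤ, ⨆ _ : k ≠ j, wtSpace h k) ≤ LinearMap.ker ((killingForm ℂ L).flip u) := by
    refine iSup_le fun k => iSup_le fun hk v hv => ?_
    change killingForm ℂ L v u = 0
    exact killing_wtSpace hv hu (by omega)
  have h1 : killingForm ℂ L w u = 0 := this hw
  rw [map_add, LinearMap.add_apply, h1, add_zero]

theorem eq_zero_of_killing (t : IsTriple e h f)
    (hκ : ∀ z : L, (∀ y, killingForm ℂ L z y = 0) → z = 0) {v : L} {k : ℤ} (hv : v ∈ wtSpace h k)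
    (h0 : ∀ u ∈ wtSpace h (-k), killingForm ℂ L v u = 0) : v = 0 := by
  refine hκ v fun y => ?_
  obtain ⟨y₀, hy₀, hy⟩ := t.exists_component y (-k)
  rw [killing_symm, hy v (by rwa [neg_neg]), killing_symm]
  exact h0 y₀ hy₀

theorem finrank_wtSpace_neg (t : IsTriple e h f)
    (hκ : ∀ z : L, (∀ y, killingForm ℂ L z y = 0) → z = 0) (k : ℤ) :
    Module.finrank ℂ (wtSpace h (-k)) = Module.finrank ℂ (wtSpace h k) := by
  have key : ∀ k : ℤ, Module.finrank ℂ (wtSpace h k) ≤ Module.finrank ℂ (wtSpace h (-k)) := by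
    intro k
    let g : wtSpace h k →ₗ[ℂ] Module.Dual ℂ (wtSpace h (-k)) :=
      (wtSpace h (-k)).dualRestrict ∘ₗ (killingForm ℂ L) ∘ₗ (wtSpace h k).subtype
    have hg : Function.Injective g := by
      rw [injective_iff_map_eq_zero]
      rintro ⟨v, hv⟩ h0
      refine Subtype.ext (t.eq_zero_of_killing hκ hv fun u hu => ?_)
      exact congrArg (fun φ : Module.Dual ℂ (wtSpace h (-k)) => φ ⟨u, hu⟩) h0
    exact (LinearMap.finrank_le_finrank_of_injective hg).trans_eq Subspace.dual_finrank_eq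
  refine le_antisymm ?_ (key k)
  have := key (-k)
  rwa [neg_neg] at this

theorem exists_lie_e (t : IsTriple e h f)
    (hκ : ∀ z : L, (∀ y, killingForm ℂ L z y = 0) → z = 0) {u : L} {i : ℤ} (hi : -2 < i)
    (hu : u ∈ wtSpace h (i + 2)) : ∃ v ∈ wtSpace h i, ⁅e, v⁆ = u := by
  have : u ∈ (wtSpace h i).map (ad ℂ L e) := by
    refine mem_of_orthogonal hκ _ _ fun z hz => ?_
    obtain ⟨z₀, hz₀, h1⟩ := t.exists_component z (-(i + 2))
    have h2 : ⁅e, z₀⁆ = 0 := by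
      have hm := lie_mem_wtSpace t.e_mem hz₀
      refine t.eq_zero_of_killing hκ hm fun v hv => ?_
      have hv' : v ∈ wtSpace h i := by convert hv using 2; ring
      have h3 := killing_inv' e z₀ v
      have h4 : ⁅e, v⁆ ∈ wtSpace h (- -(i + 2)) := by
        convert lie_mem_wtSpace t.e_mem hv' using 2; ring
      have h5 := h1 _ h4
      have h6 : killingForm ℂ L z ⁅e, v⁆ = 0 := hz _ ⟨v, hv', rfl⟩
      linear_combination h3 + h5 - h6
    rw [h1 u (by rwa [neg_neg]), t.eq_zero_of_neg (by omega) hz₀ h2]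
    simp
  obtain ⟨v, hv, rfl⟩ := this
  exact ⟨v, hv, rfl⟩

theorem finrank_wtSpace_eq (t : IsTriple e h f)
    (hκ : ∀ z : L, (∀ y, killingForm ℂ L z y = 0) → z = 0) {i : ℤ} (hi : -2 < i) :
    Module.finrank ℂ (wtSpace h i) = Module.finrank ℂ (wtSpace h (i + 2)) +
      Module.finrank ℂ (LinearMap.ker (ad ℂ L e) ⊓ wtSpace h i : Submodule ℂ L) := by
  have hmaps : ∀ v ∈ wtSpace h i, ad ℂ L e v ∈ wtSpace h (i + 2) := fun v hv => by
    rw [add_comm]; exact lie_mem_wtSpace t.e_mem hv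
  have h1 := LinearMap.finrank_range_add_finrank_ker ((ad ℂ L e).restrict hmaps)
  have h2 : LinearMap.range ((ad ℂ L e).restrict hmaps) = ⊤ := by
    rw [LinearMap.range_eq_top]
    rintro ⟨u, hu⟩
    obtain ⟨v, hv, rfl⟩ := t.exists_lie_e hκ hi hu
    exact ⟨⟨v, hv⟩, rfl⟩
  rw [h2, finrank_top, LinearMap.ker_restrict] at h1
  rw [← h1, inf_comm]
  congr 1
  rw [← Submodule.finrank_map_subtype_eq, Submodule.map_comap_subtype]

theorem finrank_ker (t : IsTriple e h f) (s : Finset ℤ)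
    (hs : ∀ k ∉ s, wtSpace h k = ⊥) : Module.finrank ℂ (LinearMap.ker (ad ℂ L e)) =
      ∑ k ∈ s, Module.finrank ℂ (LinearMap.ker (ad ℂ L e) ⊓ wtSpace h k : Submodule ℂ L) := by
  have hmaps : ∀ v ∈ LinearMap.ker (ad ℂ L e), ad ℂ L h v ∈ LinearMap.ker (ad ℂ L e) := by
    intro v hv
    rw [LinearMap.mem_ker, ad_apply] at hv ⊢
    rw [ad_apply, leibniz_lie, ← lie_skew e h, t.he, hv, lie_zero, neg_lie, smul_lie, hv]
    simp
  let G : Module.End ℂ (LinearMap.ker (ad ℂ L e)) := (ad ℂ L h).restrict hmaps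
  have heig : ∀ μ : ℂ, LinearMap.ker (ad ℂ L e) ⊓ (ad ℂ L h).eigenspace μ =
      (G.eigenspace μ).map (LinearMap.ker (ad ℂ L e)).subtype :=
    fun μ => Submodule.inf_genEigenspace (ad ℂ L h) _ hmaps
  have hfin : ∀ μ : ℂ,
      Module.finrank ℂ (LinearMap.ker (ad ℂ L e) ⊓ (ad ℂ L h).eigenspace μ : Submodule ℂ L) =
      Module.finrank ℂ (G.eigenspace μ) := fun μ => by
    rw [heig, Submodule.finrank_map_subtype_eq]
  have hbot : ∀ μ : ℂ, (ad ℂ L h).eigenspace μ = ⊥ →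
      G.eigenspace μ = ⊥ := fun μ hμ => by
    rw [← Submodule.finrank_eq_zero, ← hfin, hμ, inf_bot_eq, finrank_bot]
  have hnonint : ∀ μ : ℂ, (¬ ∃ k : ℤ, μ = k) → (ad ℂ L h).eigenspace μ = ⊥ := by
    intro μ hμ
    have hd := Module.End.eigenspaces_iSupIndep (ad ℂ L h) μ
    refine disjoint_top.mp (hd.mono_right ?_)
    rw [← t.iSup_wtSpace]
    refine iSup_le fun k => le_iSup₂_of_le (k : ℂ) (fun hk => hμ ⟨k, hk.symm⟩) le_rfl
  have htop : ⨆ k : ℤ, G.eigenspace (k : ℂ) = ⊤ := by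
    rw [eq_top_iff, ← Module.End.genEigenspace_restrict_eq_top (k := 1) hmaps]
    · refine iSup_le fun μ => ?_
      by_cases hμ : ∃ k : ℤ, μ = k
      · obtain ⟨k, rfl⟩ := hμ
        exact le_iSup (fun k : ℤ => G.eigenspace (k : ℂ)) k
      · exact (hbot μ (hnonint μ hμ)).le.trans bot_le
    · rw [eq_top_iff, ← t.iSup_wtSpace]
      exact iSup_le fun k => le_iSup (fun μ : ℂ => (ad ℂ L h).genEigenspace μ 1) (k : ℂ)
  rw [finrank_eq_sum htop s fun k hk => hbot _ (hs k hk)]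
  exact Finset.sum_congr rfl fun k _ => (hfin k).symm

end IsTriple

end EEight

namespace EEight

open Finset

theorem sum_highest_weights (a m p S : ℕ → ℤ) (ha : ∀ i, a i = a (i + 2) + m i) (hS0 : S 0 = p 0)
    (hS1 : S 1 = 2 * p 1) (hS : ∀ d, S (d + 2) = S d + 2 * p (d + 2)) (K : ℕ) :
    ∑ d ∈ range (K + 2), m d * S d + a (K + 2) * S K + a (K + 3) * S (K + 1) =
      a 0 * p 0 + 2 * ∑ i ∈ range (K + 1), a (i + 1) * p (i + 1) := by
  induction K with
  | zero =>
    simp only [zero_add, sum_range_succ, range_zero, sum_empty]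
    rw [hS0, hS1, ha 0, ha 1]
    ring
  | succ K ih =>
    change ∑ d ∈ range (K + 2 + 1), m d * S d + a (K + 3) * S (K + 1) + a (K + 4) * S (K + 2) = _
    have e1 := sum_range_succ (fun d => m d * S d) (K + 2)
    have e2 := sum_range_succ (fun i => a (i + 1) * p (i + 1)) (K + 1)
    change _ = _ + a (K + 2) * p (K + 2) at e2
    have h1 := hS K
    have h2 : a (K + 2) = a (K + 4) + m (K + 2) := ha (K + 2)
    linear_combination ih + e1 - 2 * e2 + (-S (K + 2)) * h2 + a (K + 2) * h1

set_option maxHeartbeats 1000000 in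
theorem weights_determined (N : ℕ) (m : ℕ → ℤ) (hm : ∀ d, 0 ≤ m d) (hN : ∀ d, N ≤ d → m d = 0)
    (Q Q4 : ℤ) (h0 : ∑ d ∈ range N, m d = 134) (h1 : ∑ d ∈ range N, m d * (d + 1) = 248)
    (h2 : ∑ d ∈ range N, m d * (d * (d + 1) * (d + 2)) = 3 * Q)
    (h4 : ∑ d ∈ range N, m d * (d * (d + 1) * (d + 2) * (3 * d ^ 2 + 6 * d - 4)) = 15 * Q4)
    (hQ : 100 * Q4 = Q ^ 2) :
    Q = 480 ∧ m 2 = 55 ∧ m 4 = 1 ∧ ∀ d, d ≠ 0 → d ≠ 2 → d ≠ 4 → m d = 0 := by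
  have hd1 : ∑ d ∈ range N, m d * d = 114 := by
    have : ∑ d ∈ range N, m d * ((d : ℤ) + 1) = ∑ d ∈ range N, m d * d + ∑ d ∈ range N, m d := by
      rw [← sum_add_distrib]
      exact sum_congr rfl fun d _ => by ring
    omega
  have hQ0 : 0 ≤ 3 * Q := by
    rw [← h2]
    exact sum_nonneg fun d _ => mul_nonneg (hm d) (by positivity)
  have hlin : 30 * Q4 ≥ 435 * Q - 30 * 42 * 114 := by
    have : 0 ≤ ∑ d ∈ range N, m d * ((d : ℤ) * (2 * (((d : ℤ) + 1) * (d + 2) *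
        (3 * d ^ 2 + 6 * d - 4)) - 145 * (((d : ℤ) + 1) * (d + 2)) + 1260)) := by
      refine sum_nonneg fun d _ => mul_nonneg (hm d) (mul_nonneg (by positivity) ?_)
      have h5 : 2 * (((d : ℤ) + 1) * (d + 2) * (3 * d ^ 2 + 6 * d - 4)) -
          145 * (((d : ℤ) + 1) * (d + 2)) + 1260 =
          ((d - 2) * (d - 3)) * (6 * d ^ 2 + 60 * d + 159) := by ring
      rw [h5]
      refine mul_nonneg ?_ (by positivity)
      rcases le_or_gt d 2 with hd | hd
      · exact mul_nonneg_of_nonpos_of_nonpos (by omega) (by omega)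
      · exact mul_nonneg (by omega) (by omega)
    have h5 : ∑ d ∈ range N, m d * ((d : ℤ) * (2 * (((d : ℤ) + 1) * (d + 2) *
        (3 * d ^ 2 + 6 * d - 4)) - 145 * (((d : ℤ) + 1) * (d + 2)) + 1260)) =
        2 * (15 * Q4) - 145 * (3 * Q) + 1260 * 114 := by
      rw [← h4, ← h2, ← hd1, mul_sum, mul_sum, mul_sum, ← sum_sub_distrib, ← sum_add_distrib]
      exact sum_congr rfl fun d _ => by ring
    linarith
  have hcs : 0 ≤ ∑ d ∈ range N, m d * ((d : ℤ) * (38 * (((d : ℤ) + 1) * (d + 2)) - Q) ^ 2) :=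
    sum_nonneg fun d _ => mul_nonneg (hm d) (by positivity)
  have hA : 8 * ∑ d ∈ range N, m d * ((d : ℤ) * (((d : ℤ) + 1) * (d + 2)) ^ 2) ≤
      45 * Q4 + 111 * Q := by
    have h5 : 0 ≤ ∑ d ∈ range N, m d * ((d : ℤ) * (((d : ℤ) + 1) * (d + 2)) * (d - 3) ^ 2) :=
      sum_nonneg fun d _ => mul_nonneg (hm d) (by positivity)
    have h6 : ∑ d ∈ range N, m d * ((d : ℤ) * (((d : ℤ) + 1) * (d + 2)) * (d - 3) ^ 2) =
        3 * (15 * Q4) + 37 * (3 * Q) -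
          8 * ∑ d ∈ range N, m d * ((d : ℤ) * (((d : ℤ) + 1) * (d + 2)) ^ 2) := by
      rw [← h4, ← h2, mul_sum, mul_sum, mul_sum, ← sum_add_distrib, ← sum_sub_distrib]
      exact sum_congr rfl fun d _ => by ring
    linarith
  have hB : ∑ d ∈ range N, m d * ((d : ℤ) * (38 * (((d : ℤ) + 1) * (d + 2)) - Q) ^ 2) =
      38 ^ 2 * ∑ d ∈ range N, m d * ((d : ℤ) * (((d : ℤ) + 1) * (d + 2)) ^ 2) - 76 * Q * (3 * Q) +
        Q ^ 2 * 114 := by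
    rw [← h2, ← hd1, mul_sum, mul_sum, mul_sum, ← sum_sub_distrib, ← sum_add_distrib]
    exact sum_congr rfl fun d _ => by ring
  have hQ1 : Q ≤ 700 := by
    by_contra! hc
    nlinarith
  have hQ2 : Q ≤ 508 := by
    by_contra! hc
    nlinarith
  have hQ4 : Q4 ≤ 2581 := by nlinarith
  have hbig : ∀ d, 6 ≤ d → m d = 0 := by
    intro d hd
    by_cases hdN : d < N
    · by_contra hne
      have hpos : 1 ≤ m d := by have := hm d; omega
      have h5 := single_le_sum (f := fun d : ℕ => m d * ((d : ℤ) * (d + 1) * (d + 2) *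
        (3 * d ^ 2 + 6 * d - 4))) (fun i _ => ?_) (mem_range.mpr hdN)
      · rw [h4] at h5
        have hd' : (6 : ℤ) ≤ d := by exact_mod_cast hd
        have h6 : (336 : ℤ) ≤ (d : ℤ) * (d + 1) * (d + 2) := by
          calc (336 : ℤ) = 6 * (6 + 1) * (6 + 2) := by norm_num
            _ ≤ _ := by gcongr
        have h7 : (140 : ℤ) ≤ 3 * d ^ 2 + 6 * d - 4 := by nlinarith
        have h8 : (336 : ℤ) * 140 ≤ (d : ℤ) * (d + 1) * (d + 2) * (3 * d ^ 2 + 6 * d - 4) :=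
          mul_le_mul h6 h7 (by norm_num) (by omega)
        nlinarith
      · rcases Nat.eq_zero_or_pos i with rfl | hi
        · simp
        · have hi' : (1 : ℤ) ≤ i := by exact_mod_cast hi
          exact mul_nonneg (hm i) (mul_nonneg (by positivity) (by nlinarith))
    · exact hN d (by omega)
  have hred : ∀ g : ℕ → ℤ, ∑ d ∈ range N, m d * g d = ∑ d ∈ range 6, m d * g d := by
    intro g
    rcases le_total N 6 with hle | hle
    · refine sum_subset (range_mono hle) fun d _ hd => ?_
      rw [hN d (by simpa using hd), zero_mul]
    · refine (sum_subset (range_mono hle) fun d _ hd => ?_).symm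
      rw [hbig d (by simpa using hd), zero_mul]
  rw [hred] at hd1 h2 h4
  simp only [sum_range_succ, range_zero, sum_empty] at hd1 h2 h4
  norm_num at hd1 h2 h4
  obtain ⟨q, rfl⟩ : ∃ q, Q = 10 * q := by
    have : (10 : ℤ) ^ 2 ∣ Q ^ 2 := ⟨Q4, by rw [← hQ]; ring⟩
    exact (Int.pow_dvd_pow_iff (by norm_num)).mp this
  have hq4 : Q4 = q ^ 2 := by linarith
  have := hm 1
  have := hm 2
  have := hm 3
  have := hm 4
  have := hm 5
  have hq : q ^ 2 - 70 * q + 1368 = 60 * m 3 + 312 * m 4 + 984 * m 5 := by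
    rw [hq4] at h4
    linarith
  have hq50 : q ≤ 50 := by omega
  have hq0 : 0 ≤ q := by omega
  have hq23 : 23 ≤ q := by omega
  have key : q = 48 := by
    have h8 : 0 ≤ (q - 23) * (50 - q) := mul_nonneg (by linarith) (by linarith)
    have h5 : 60 * m 3 + 312 * m 4 + 984 * m 5 ≤ 368 := by linarith
    have h6 : m 5 = 0 := by omega
    have h7 : m 4 ≤ 1 := by omega
    clear hQ hq4 hQ4 hQ2 hQ1 hB hA hcs hlin hQ0 hred hbig h0 h1 h2 h4 hd1 hN
    generalize m 3 = m3 at *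
    generalize m 4 = m4 at *
    rw [h6] at hq
    interval_cases q <;> omega
  subst key
  refine ⟨by norm_num, by omega, by omega, fun d h0 h2 h4 => ?_⟩
  rcases lt_or_ge d 6 with hd | hd
  · interval_cases d <;> omega
  · exact hbig d hd

end EEight

namespace EEight

open Finset LieAlgebra Polynomial

variable {L : Type*} [LieRing L] [LieAlgebra ℂ L] [FiniteDimensional ℂ L]

/-- The numerical data of an `𝔰𝔩₂`-triple of type `A₂` in `E₈`. -/
structure IsA2Triple (e h f : L) : Prop extends IsTriple e h f where
  nondeg : ∀ z : L, (∀ y, killingForm ℂ L z y = 0) → z = 0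
  quartic_eq : ∀ a b c d : L, quartic a b c d = 0
  killing_h : killingForm ℂ L h h = 480
  wt : ∀ k : ℤ, k ≠ 0 → k ≠ 2 → k ≠ -2 → k ≠ 4 → k ≠ -4 → wtSpace h k = ⊥
  finrank_four : Module.finrank ℂ (wtSpace h 4) = 1
  finrank_two : Module.finrank ℂ (wtSpace h 2) = 56

theorem IsTriple.isA2Triple {e h f : L} (t : IsTriple e h f)
    (hκ : ∀ z : L, (∀ y, killingForm ℂ L z y = 0) → z = 0)
    (hq : ∀ a b c d : L, quartic a b c d = 0) (hL : Module.finrank ℂ L = 248)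
    (hker : Module.finrank ℂ (LinearMap.ker (ad ℂ L e)) = 134) : IsA2Triple e h f := by
  obtain ⟨M, hM⟩ : ∃ M : ℕ, ∀ k : ℤ, (M : ℤ) < |k| → wtSpace h k = ⊥ := by
    obtain ⟨M, hM⟩ := ((finite_weights (ad ℂ L h)).image Int.natAbs).bddAbove
    refine ⟨M, fun k hk => ?_⟩
    by_contra hne
    have : k.natAbs ≤ M := hM ⟨k, hne, rfl⟩
    rw [Int.abs_eq_natAbs] at hk
    omega
  let n : ℤ → ℤ := fun k => Module.finrank ℂ (wtSpace h k)
  let m : ℕ → ℤ := fun d => Module.finrank ℂ (LinearMap.ker (ad ℂ L e) ⊓ wtSpace h d : Submodule ℂ L)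
  have hn0 : ∀ k : ℤ, (M : ℤ) < |k| → n k = 0 := fun k hk => by
    simp only [n]
    rw [hM k hk, finrank_bot, Nat.cast_zero]
  have hm0 : ∀ d : ℕ, M < d → m d = 0 := fun d hd => by
    simp only [m]
    rw [hM d (by rw [abs_of_nonneg (by omega)]; omega), inf_bot_eq, finrank_bot, Nat.cast_zero]
  have hnm : ∀ i : ℕ, n i = n ((i + 2 : ℕ) : ℤ) + m i := fun i => by
    have := t.finrank_wtSpace_eq hκ (i := i) (by omega)
    simp only [n, m]
    exact_mod_cast this
  have hneg : ∀ k : ℤ, n (-k) = n k := fun k => by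
    simp only [n]; rw [t.finrank_wtSpace_neg hκ]
  have hs : ∀ k : ℤ, k ∉ Icc (-((M + 1 : ℕ) : ℤ)) ((M + 1 : ℕ) : ℤ) → wtSpace h k = ⊥ := by
    intro k hk
    refine hM k ?_
    rw [mem_Icc] at hk
    by_contra hc
    rw [not_lt, abs_le] at hc
    omega
  have hsum : ∀ p : ℤ → ℤ, (∀ k, p (-k) = p k) → ∀ S : ℕ → ℤ, S 0 = p 0 → S 1 = 2 * p 1 →
      (∀ d : ℕ, S (d + 2) = S d + 2 * p (d + 2)) →
      ∑ k ∈ Icc (-((M + 1 : ℕ) : ℤ)) ((M + 1 : ℕ) : ℤ), n k * p k = ∑ d ∈ range (M + 2), m d * S d := by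
    intro p hp S h0 h1 hS
    have heven : Function.Even fun k : ℤ => n k * p k := fun k => by simp only [hp, hneg]
    rw [sum_Icc_of_even_eq_range heven, sum_range_succ']
    have h2 := sum_highest_weights (fun i => n i) m (fun i => p i) S hnm h0 h1
      (fun d => by rw [hS]; push_cast; rfl) M
    have h3 : n ((M + 2 : ℕ) : ℤ) = 0 := hn0 _ (by rw [abs_of_nonneg (by omega)]; omega)
    have h4 : n ((M + 3 : ℕ) : ℤ) = 0 := hn0 _ (by rw [abs_of_nonneg (by omega)]; omega)
    simp only [h3, h4, zero_mul, add_zero] at h2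
    rw [h2, two_nsmul]
    simp only [Nat.cast_zero]
    ring
  have htr : ∀ j : ℕ, LinearMap.trace ℂ L (ad ℂ L h ^ j) =
      ((∑ k ∈ Icc (-((M + 1 : ℕ) : ℤ)) ((M + 1 : ℕ) : ℤ), n k * k ^ j : ℤ) : ℂ) := by
    intro j
    have := trace_aeval t.iSup_wtSpace _ hs (X ^ j)
    rw [map_pow, aeval_X] at this
    rw [this]
    push_cast
    simp only [eval_pow, eval_X, n]
    push_cast
    rfl
  have hsq := htr 2
  have hfour := htr 4
  have e0 := hsum (fun _ => 1) (fun _ => rfl) (fun d => d + 1) (by simp) (by simp)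
    (fun d => by push_cast; ring)
  have e2 := hsum (fun k => 3 * k ^ 2) (fun k => by ring) (fun d => d * (d + 1) * (d + 2)) (by simp)
    (by simp) (fun d => by push_cast; ring)
  have e4 := hsum (fun k => 15 * k ^ 4) (fun k => by ring)
    (fun d => d * (d + 1) * (d + 2) * (3 * d ^ 2 + 6 * d - 4)) (by simp) (by norm_num)
    (fun d => by push_cast; ring)
  have hdim : ∑ k ∈ Icc (-((M + 1 : ℕ) : ℤ)) ((M + 1 : ℕ) : ℤ), n k = 248 := by
    have := finrank_eq_sum t.iSup_wtSpace _ hs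
    rw [hL] at this
    simp only [n]
    exact_mod_cast this.symm
  have hmsum : ∑ d ∈ range (M + 2), m d = 134 := by
    have h1 := t.finrank_ker _ hs
    rw [hker] at h1
    have h2 : (134 : ℤ) = ∑ k ∈ Icc (-((M + 1 : ℕ) : ℤ)) ((M + 1 : ℕ) : ℤ),
        (Module.finrank ℂ (LinearMap.ker (ad ℂ L e) ⊓ wtSpace h k : Submodule ℂ L) : ℤ) := by
      exact_mod_cast h1
    rw [h2]
    simp only [m]
    rw [← sum_image (s := range (M + 2)) (g := fun d : ℕ => (d : ℤ))
      (f := fun k : ℤ =>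
        (Module.finrank ℂ (LinearMap.ker (ad ℂ L e) ⊓ wtSpace h k : Submodule ℂ L) : ℤ))
      (fun a _ b _ hab => by exact Nat.cast_injective (R := ℤ) hab)]
    refine sum_subset ?_ ?_
    · intro k hk
      simp only [mem_image, mem_range, mem_Icc] at hk ⊢
      omega
    · intro k hk hk'
      have hk0 : k < 0 := by
        by_contra hc
        simp only [mem_image, mem_range, mem_Icc] at hk hk'
        exact hk' ⟨k.toNat, by omega, by omega⟩
      have : (LinearMap.ker (ad ℂ L e) ⊓ wtSpace h k : Submodule ℂ L) = ⊥ := by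
        rw [eq_bot_iff]
        rintro v ⟨hv1, hv2⟩
        exact t.eq_zero_of_neg hk0 hv2 hv1
      rw [this, finrank_bot, Nat.cast_zero]
  set Q := ∑ k ∈ Icc (-((M + 1 : ℕ) : ℤ)) ((M + 1 : ℕ) : ℤ), n k * k ^ 2 with hQ
  set Q4 := ∑ k ∈ Icc (-((M + 1 : ℕ) : ℤ)) ((M + 1 : ℕ) : ℤ), n k * k ^ 4 with hQ4
  have hκQ : killingForm ℂ L h h = Q := by
    rw [killing_def, ← hsq, pow_two]
  have hκQ4 : tr4 h h h h = Q4 := by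
    rw [tr4, ← hfour]
    congr 1
  have hrel := tr4_self hq h
  rw [hκQ, hκQ4] at hrel
  obtain ⟨r1, r2, r3, r4⟩ := weights_determined (M + 2) m (fun d => by simp only [m]; positivity)
    (fun d hd => hm0 d (by omega)) Q Q4 hmsum (by rw [← e0, ← hdim]; simp)
    (by rw [← e2, hQ, mul_sum]; exact sum_congr rfl fun _ _ => by ring)
    (by rw [← e4, hQ4, mul_sum]; exact sum_congr rfl fun _ _ => by ring)
    (by exact_mod_cast hrel)
  have hlarge : ∀ i : ℕ, 5 ≤ i → n i = 0 := by
    intro i hi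
    have : ∀ j : ℕ, n i = n ((i + 2 * j : ℕ) : ℤ) := by
      intro j
      induction j with
      | zero => rfl
      | succ j ih =>
        rw [ih, hnm, r4 _ (by omega) (by omega) (by omega), add_zero]
        rfl
    rw [this (M + 1)]
    exact hn0 _ (by rw [abs_of_nonneg (by omega)]; omega)
  have n5 : n 5 = 0 := hlarge 5 le_rfl
  have n6 : n 6 = 0 := hlarge 6 (by norm_num)
  have n3 : n 3 = n 5 + m 3 := hnm 3
  have n1 : n 1 = n 3 + m 1 := hnm 1
  have n4 : n 4 = n 6 + m 4 := hnm 4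
  have n2 : n 2 = n 4 + m 2 := hnm 2
  rw [n5, r4 3 (by norm_num) (by norm_num) (by norm_num), zero_add] at n3
  rw [n3, r4 1 (by norm_num) (by norm_num) (by norm_num), zero_add] at n1
  rw [n6, r3, zero_add] at n4
  rw [r2, n4] at n2
  have hpos : ∀ i : ℕ, i ≠ 0 → i ≠ 2 → i ≠ 4 → n i = 0 := by
    intro i h0 h2 h4
    rcases lt_or_ge i 5 with hi | hi
    · interval_cases i
      · exact absurd rfl h0
      · exact n1
      · exact absurd rfl h2
      · exact n3
      · exact absurd rfl h4
    · exact hlarge i hi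
  refine { t with
    nondeg := hκ
    quartic_eq := hq
    killing_h := by rw [hκQ, r1]; norm_num
    wt := fun k h0 h2 h2' h4 h4' => ?_
    finrank_four := by
      exact Nat.cast_injective (R := ℤ) n4
    finrank_two := by
      exact Nat.cast_injective (R := ℤ) n2 }
  rw [← Submodule.finrank_eq_zero]
  have : n k = 0 := by
    rcases le_total 0 k with hk | hk
    · obtain ⟨i, rfl⟩ := Int.eq_ofNat_of_zero_le hk
      exact hpos i (by omega) (by omega) (by omega)
    · rw [← hneg]
      obtain ⟨i, hi⟩ := Int.eq_ofNat_of_zero_le (neg_nonneg.mpr hk)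
      rw [hi]
      exact hpos i (by omega) (by omega) (by omega)
  exact Nat.cast_injective (R := ℤ) this

end EEight

namespace EEight

open LieAlgebra

variable {L : Type*} [LieRing L] [LieAlgebra ℂ L]

theorem IsTriple.lie_e_f {e h f : L} (t : IsTriple e h f) {v : L} {k : ℤ} (hv : v ∈ wtSpace h k) :
    ⁅e, ⁅f, v⁆⁆ = (k : ℂ) • v + ⁅f, ⁅e, v⁆⁆ := by
  rw [leibniz_lie, t.ef, mem_wtSpace.mp hv]

theorem lie_mem_wtSpace' {h v w : L} {i j k : ℤ} (hv : v ∈ wtSpace h i) (hw : w ∈ wtSpace h j)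
    (hk : i + j = k) : ⁅v, w⁆ ∈ wtSpace h k := hk ▸ lie_mem_wtSpace hv hw

/-- An `A₂`-triple with a choice of extremal weight vectors. -/
structure IsA2Frame (e h f x y : L) : Prop extends IsA2Triple e h f where
  x_mem : x ∈ wtSpace h 4
  y_mem : y ∈ wtSpace h (-4)
  killing_xy : killingForm ℂ L x y = 60
  eq_x : ∀ v ∈ wtSpace h 4, v = (killingForm ℂ L v y / 60) • x
  eq_y : ∀ v ∈ wtSpace h (-4), v = (killingForm ℂ L x v / 60) • y
  f_four : ⁅f, ⁅f, ⁅f, ⁅f, x⁆⁆⁆⁆ = (24 : ℂ) • y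

theorem IsA2Triple.exists_frame [FiniteDimensional ℂ L] {e h f : L} (t : IsA2Triple e h f) :
    ∃ x y, IsA2Frame e h f x y := by
  obtain ⟨⟨x₀, hx₀⟩, hx0, hspan⟩ := finrank_eq_one_iff'.mp t.finrank_four
  have hf := t.f_mem
  have h3 : ⁅f, x₀⁆ ∈ wtSpace h 2 := lie_mem_wtSpace' hf hx₀ (by norm_num)
  have h2 : ⁅f, ⁅f, x₀⁆⁆ ∈ wtSpace h 0 := lie_mem_wtSpace' hf h3 (by norm_num)
  have h1 : ⁅f, ⁅f, ⁅f, x₀⁆⁆⁆ ∈ wtSpace h (-2) := lie_mem_wtSpace' hf h2 (by norm_num)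
  have h0 : ⁅f, ⁅f, ⁅f, ⁅f, x₀⁆⁆⁆⁆ ∈ wtSpace h (-4) := lie_mem_wtSpace' hf h1 (by norm_num)
  have hex : ⁅e, x₀⁆ = 0 := by
    have := lie_mem_wtSpace' t.e_mem hx₀ (k := 6) (by norm_num)
    rwa [t.wt 6 (by norm_num) (by norm_num) (by norm_num) (by norm_num) (by norm_num)] at this
  have e1 : ⁅e, ⁅f, x₀⁆⁆ = (4 : ℂ) • x₀ := by
    rw [t.lie_e_f hx₀, hex, lie_zero, add_zero]; norm_num
  have e2 : ⁅e, ⁅f, ⁅f, x₀⁆⁆⁆ = (6 : ℂ) • ⁅f, x₀⁆ := by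
    rw [t.lie_e_f h3, e1, lie_smul, ← add_smul]; norm_num
  have e3 : ⁅e, ⁅f, ⁅f, ⁅f, x₀⁆⁆⁆⁆ = (6 : ℂ) • ⁅f, ⁅f, x₀⁆⁆ := by
    rw [t.lie_e_f h2, e2, lie_smul, ← add_smul]; norm_num
  have e4 : ⁅e, ⁅f, ⁅f, ⁅f, ⁅f, x₀⁆⁆⁆⁆⁆ = (4 : ℂ) • ⁅f, ⁅f, ⁅f, x₀⁆⁆⁆ := by
    rw [t.lie_e_f h1, e3, lie_smul, ← add_smul]; norm_num
  have hne : ⁅f, ⁅f, ⁅f, ⁅f, x₀⁆⁆⁆⁆ ≠ 0 := by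
    intro hz
    have : ⁅e, ⁅e, ⁅e, ⁅e, ⁅f, ⁅f, ⁅f, ⁅f, x₀⁆⁆⁆⁆⁆⁆⁆⁆ = (576 : ℂ) • x₀ := by
      simp only [e4, lie_smul, e3, e2, e1, smul_smul]; norm_num
    rw [hz] at this
    simp only [lie_zero] at this
    exact hx0 (Subtype.ext ((smul_eq_zero.mp this.symm).resolve_left (by norm_num)))
  have hκ0 : killingForm ℂ L x₀ ⁅f, ⁅f, ⁅f, ⁅f, x₀⁆⁆⁆⁆ ≠ 0 := by
    intro hz
    refine hne (t.eq_zero_of_killing t.nondeg h0 fun u hu => ?_)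
    rw [neg_neg] at hu
    obtain ⟨c, hc⟩ := hspan ⟨u, hu⟩
    have hc' : c • x₀ = u := congrArg Subtype.val hc
    rw [← hc', map_smul, killing_symm, hz, smul_zero]
  obtain ⟨s, hs⟩ := IsAlgClosed.exists_pow_nat_eq
    (1440 / killingForm ℂ L x₀ ⁅f, ⁅f, ⁅f, ⁅f, x₀⁆⁆⁆⁆) (n := 2) (by norm_num)
  have hs0 : s ≠ 0 := by
    rintro rfl
    have : (1440 : ℂ) / killingForm ℂ L x₀ ⁅f, ⁅f, ⁅f, ⁅f, x₀⁆⁆⁆⁆ ≠ 0 :=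
      div_ne_zero (by norm_num) hκ0
    exact this (by rw [← hs]; ring)
  have hxy : killingForm ℂ L (s • x₀) ((s / 24) • ⁅f, ⁅f, ⁅f, ⁅f, x₀⁆⁆⁆⁆) = 60 := by
    rw [map_smul, map_smul, LinearMap.smul_apply, smul_eq_mul, smul_eq_mul]
    have : s ^ 2 * killingForm ℂ L x₀ ⁅f, ⁅f, ⁅f, ⁅f, x₀⁆⁆⁆⁆ = 1440 := by
      rw [hs, div_mul_cancel₀ _ hκ0]
    linear_combination this / 24
  refine ⟨s • x₀, (s / 24) • ⁅f, ⁅f, ⁅f, ⁅f, x₀⁆⁆⁆⁆, { t with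
    x_mem := Submodule.smul_mem _ _ hx₀
    y_mem := Submodule.smul_mem _ _ h0
    killing_xy := hxy
    eq_x := fun v hv => ?_
    eq_y := fun v hv => ?_
    f_four := by simp only [lie_smul, smul_smul]; congr 1; ring }⟩
  · obtain ⟨c, hc⟩ := hspan ⟨v, hv⟩
    have hc' : v = (c / s) • s • x₀ := by
      rw [smul_smul, div_mul_cancel₀ _ hs0]; exact (congrArg Subtype.val hc).symm
    have hk : killingForm ℂ L v ((s / 24) • ⁅f, ⁅f, ⁅f, ⁅f, x₀⁆⁆⁆⁆) = (c / s) * 60 := by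
      rw [hc', (killingForm ℂ L).map_smul, LinearMap.smul_apply, hxy, smul_eq_mul]
    rw [hk, mul_div_cancel_right₀ _ (by norm_num)]
    exact hc'
  · have h4 : Module.finrank ℂ (wtSpace h (-4)) = 1 := by
      rw [t.finrank_wtSpace_neg t.nondeg, t.finrank_four]
    have hy0 : (⟨_, Submodule.smul_mem _ (s / 24) h0⟩ : wtSpace h (-4)) ≠ 0 := by
      intro hz
      exact smul_ne_zero (div_ne_zero hs0 (by norm_num)) hne (congrArg Subtype.val hz)
    obtain ⟨c, hc⟩ := (finrank_eq_one_iff_of_nonzero' _ hy0).mp h4 ⟨v, hv⟩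
    have hc' : v = c • (s / 24) • ⁅f, ⁅f, ⁅f, ⁅f, x₀⁆⁆⁆⁆ := (congrArg Subtype.val hc).symm
    have hk : killingForm ℂ L (s • x₀) v = c * 60 := by
      rw [hc', map_smul, hxy, smul_eq_mul]
    rw [hk, mul_div_cancel_right₀ _ (by norm_num)]
    exact hc'

namespace IsA2Frame

variable {e h f x y : L}

theorem eq_zero_of_mem (t : IsA2Frame e h f x y) {v : L} {k : ℤ} (hv : v ∈ wtSpace h k)
    (hk : 5 ≤ |k|) : v = 0 := by
  have h1 : ∀ j : ℤ, |j| < 5 → k ≠ j := by rintro j hj rfl; omega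
  rwa [t.wt k (h1 _ (by norm_num)) (h1 _ (by norm_num)) (h1 _ (by norm_num)) (h1 _ (by norm_num))
    (h1 _ (by norm_num))] at hv

theorem lie_e_x (t : IsA2Frame e h f x y) : ⁅e, x⁆ = 0 :=
  t.eq_zero_of_mem (lie_mem_wtSpace t.e_mem t.x_mem) (by norm_num)

theorem lie_f_y (t : IsA2Frame e h f x y) : ⁅f, y⁆ = 0 :=
  t.eq_zero_of_mem (lie_mem_wtSpace t.f_mem t.y_mem) (by norm_num)

theorem fx_mem (t : IsA2Frame e h f x y) : ⁅f, x⁆ ∈ wtSpace h 2 :=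
  lie_mem_wtSpace' t.f_mem t.x_mem (by norm_num)

theorem ffx_mem (t : IsA2Frame e h f x y) : ⁅f, ⁅f, x⁆⁆ ∈ wtSpace h 0 :=
  lie_mem_wtSpace' t.f_mem t.fx_mem (by norm_num)

theorem lie_e_fx (t : IsA2Frame e h f x y) : ⁅e, ⁅f, x⁆⁆ = (4 : ℂ) • x := by
  rw [t.lie_e_f t.x_mem, t.lie_e_x, lie_zero, add_zero]; norm_num

theorem lie_e_ffx (t : IsA2Frame e h f x y) : ⁅e, ⁅f, ⁅f, x⁆⁆⁆ = (6 : ℂ) • ⁅f, x⁆ := by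
  rw [t.lie_e_f t.fx_mem, t.lie_e_fx, lie_smul, ← add_smul]; norm_num

theorem lie_e_e_y (t : IsA2Frame e h f x y) : ⁅e, ⁅e, y⁆⁆ = ⁅f, ⁅f, x⁆⁆ := by
  have e3 : ⁅e, ⁅f, ⁅f, ⁅f, x⁆⁆⁆⁆ = (6 : ℂ) • ⁅f, ⁅f, x⁆⁆ := by
    rw [t.lie_e_f t.ffx_mem, t.lie_e_ffx, lie_smul, ← add_smul]; norm_num
  have e4 : ⁅e, ⁅f, ⁅f, ⁅f, ⁅f, x⁆⁆⁆⁆⁆ = (4 : ℂ) • ⁅f, ⁅f, ⁅f, x⁆⁆⁆ := by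
    rw [t.lie_e_f (lie_mem_wtSpace' t.f_mem t.ffx_mem (k := -2) (by norm_num)), e3, lie_smul,
      ← add_smul]
    norm_num
  have : (24 : ℂ) • ⁅e, ⁅e, y⁆⁆ = (24 : ℂ) • ⁅f, ⁅f, x⁆⁆ := by
    rw [← lie_smul, ← lie_smul, ← t.f_four, e4, lie_smul, e3, smul_smul]; norm_num
  exact smul_right_injective _ (by norm_num : (24 : ℂ) ≠ 0) this

theorem lie_f_ey (t : IsA2Frame e h f x y) : ⁅f, ⁅e, y⁆⁆ = (4 : ℂ) • y := by
  have := t.lie_e_f t.y_mem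
  rw [t.lie_f_y, lie_zero] at this
  push_cast at this
  rw [eq_comm, add_comm, ← eq_neg_iff_add_eq_zero] at this
  rw [this, ← neg_smul, neg_neg]

theorem killing_ef (t : IsA2Frame e h f x y) : killingForm ℂ L e f = 240 := by
  have h1 := killing_inv e f h
  rw [t.ef, t.killing_h, ← lie_skew, t.hf, map_neg, map_smul, smul_eq_mul] at h1
  linear_combination -h1 / 2

end IsA2Frame

end EEight

namespace EEight

open LieAlgebra Polynomial

variable {L : Type*} [LieRing L] [LieAlgebra ℂ L]

/-- The Lagrange polynomials for the weights `0, ±2, ±4`. -/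
noncomputable def wtPoly (k : ℤ) : ℂ[X] :=
  ∏ j ∈ ({0, 2, -2, 4, -4} : Finset ℤ).erase k, C (((k : ℂ) - j)⁻¹) * (X - C (j : ℂ))

theorem wtPoly_self (k : ℤ) : (wtPoly k).eval (k : ℂ) = 1 := by
  rw [wtPoly, eval_prod]
  refine Finset.prod_eq_one fun j hj => ?_
  have : (k : ℂ) - j ≠ 0 := sub_ne_zero.mpr (by exact_mod_cast (Finset.ne_of_mem_erase hj).symm)
  simp [this]

theorem wtPoly_of_ne {k j : ℤ} (hj : j ∈ ({0, 2, -2, 4, -4} : Finset ℤ)) (hk : j ≠ k) :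
    (wtPoly k).eval (j : ℂ) = 0 := by
  rw [wtPoly, eval_prod]
  exact Finset.prod_eq_zero (Finset.mem_erase.mpr ⟨hk, hj⟩) (by simp)

/-- The projection to a weight space. -/
noncomputable def proj (h : L) (k : ℤ) : Module.End ℂ L := aeval (ad ℂ L h) (wtPoly k)

/-- The partial trace over a weight space. -/
noncomputable def wtr (h : L) (k : ℤ) (A : Module.End ℂ L) : ℂ :=
  LinearMap.trace ℂ L (A * proj h k)

theorem wtr_add (h : L) (k : ℤ) (A B : Module.End ℂ L) : wtr h k (A + B) = wtr h k A + wtr h k B := by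
  rw [wtr, add_mul, map_add]; rfl

theorem wtr_sub (h : L) (k : ℤ) (A B : Module.End ℂ L) : wtr h k (A - B) = wtr h k A - wtr h k B := by
  rw [wtr, sub_mul, map_sub]; rfl

theorem wtr_smul (h : L) (k : ℤ) (c : ℂ) (A : Module.End ℂ L) : wtr h k (c • A) = c * wtr h k A := by
  rw [wtr, smul_mul_assoc, map_smul]; rfl

theorem proj_of_mem {h v : L} {k : ℤ} (hv : v ∈ wtSpace h k) : proj h k v = v := by
  rw [proj, aeval_prod_apply (mem_wtSpace.mp hv), wtPoly_self, one_smul]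

/-- An endomorphism of `L` which is homogeneous with respect to the weights of `ad h`. -/
def IsHomog (h : L) (A : Module.End ℂ L) (i : ℤ) : Prop :=
  ∀ k, ∀ v ∈ wtSpace h k, A v ∈ wtSpace h (k + i)

theorem IsHomog.ad {h a : L} {i : ℤ} (ha : a ∈ wtSpace h i) : IsHomog h (ad ℂ L a) i :=
  fun _ _ hv => lie_mem_wtSpace' ha hv (add_comm _ _)

theorem IsHomog.mul {h : L} {A B : Module.End ℂ L} {i j : ℤ} (hA : IsHomog h A i)
    (hB : IsHomog h B j) : IsHomog h (A * B) (i + j) := fun k v hv => by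
  have := hA _ _ (hB _ _ hv)
  rwa [add_assoc, add_comm j i] at this

theorem trace_eq_of_adjoint [FiniteDimensional ℂ L]
    (hκ : ∀ z : L, (∀ y, killingForm ℂ L z y = 0) → z = 0) {A B : Module.End ℂ L}
    (hAB : ∀ u v, killingForm ℂ L (A u) v = killingForm ℂ L u (B v)) :
    LinearMap.trace ℂ L A = LinearMap.trace ℂ L B := by
  have hinj : Function.Injective (killingForm ℂ L) := by
    rw [injective_iff_map_eq_zero]
    exact fun z hz => hκ z fun y => by rw [hz]; rfl
  let K : L ≃ₗ[ℂ] Module.Dual ℂ L := LinearEquiv.ofBijective (killingForm ℂ L) ⟨hinj,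
    (LinearMap.injective_iff_surjective_of_finrank_eq_finrank
      (Subspace.dual_finrank_eq (K := ℂ) (V := L)).symm).mp hinj⟩
  have : K.conj A = Module.Dual.transpose B := by
    refine LinearMap.ext fun φ => ?_
    obtain ⟨u, rfl⟩ := K.surjective φ
    refine LinearMap.ext fun v => ?_
    rw [LinearEquiv.conj_apply_apply, K.symm_apply_apply]
    exact hAB u v
  rw [← LinearMap.trace_conj' A K, this, LinearMap.trace_transpose']

namespace IsA2Frame

variable {e h f x y : L}

theorem proj_of_ne (t : IsA2Frame e h f x y) {v : L} {k j : ℤ} (hv : v ∈ wtSpace h j) (hk : j ≠ k) :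
    proj h k v = 0 := by
  by_cases hj : j ∈ ({0, 2, -2, 4, -4} : Finset ℤ)
  · rw [proj, aeval_prod_apply (mem_wtSpace.mp hv), wtPoly_of_ne hj hk, zero_smul]
  · simp only [Finset.mem_insert, Finset.mem_singleton, not_or] at hj
    have : v = 0 := by
      rwa [t.wt j hj.1 hj.2.1 hj.2.2.1 hj.2.2.2.1 hj.2.2.2.2] at hv
    rw [this, map_zero]

variable [FiniteDimensional ℂ L]

theorem hom_ext (t : IsA2Frame e h f x y) {A B : Module.End ℂ L}
    (hAB : ∀ k, ∀ v ∈ wtSpace h k, A v = B v) : A = B := by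
  have : (⊤ : Submodule ℂ L) ≤ LinearMap.eqLocus A B := by
    rw [← t.iSup_wtSpace]
    exact iSup_le fun k v hv => hAB k v hv
  exact LinearMap.ext fun v => this Submodule.mem_top

theorem form_ext (t : IsA2Frame e h f x y) {φ ψ : Module.Dual ℂ L}
    (hAB : ∀ k, ∀ v ∈ wtSpace h k, φ v = ψ v) : φ = ψ := by
  have : (⊤ : Submodule ℂ L) ≤ LinearMap.eqLocus φ ψ := by
    rw [← t.iSup_wtSpace]
    exact iSup_le fun k v hv => hAB k v hv
  exact LinearMap.ext fun v => this Submodule.mem_top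

theorem proj_mem (t : IsA2Frame e h f x y) (k : ℤ) (v : L) : proj h k v ∈ wtSpace h k := by
  have : (⊤ : Submodule ℂ L) ≤ (wtSpace h k).comap (proj h k) := by
    rw [← t.iSup_wtSpace]
    refine iSup_le fun j v hv => ?_
    rw [Submodule.mem_comap]
    by_cases hj : j = k
    · subst hj
      rwa [proj_of_mem hv]
    · rw [t.proj_of_ne hv hj]
      exact Submodule.zero_mem _
  exact this Submodule.mem_top

theorem killing_proj (t : IsA2Frame e h f x y) {k : ℤ} {u : L} (hu : u ∈ wtSpace h (-k)) (v : L) :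
    killingForm ℂ L (proj h k v) u = killingForm ℂ L v u := by
  refine congrArg (fun φ : Module.Dual ℂ L => φ v) (t.form_ext
    (φ := (killingForm ℂ L).flip u ∘ₗ proj h k) (ψ := (killingForm ℂ L).flip u) fun j v hv => ?_)
  change killingForm ℂ L (proj h k v) u = killingForm ℂ L v u
  by_cases hj : j = k
  · subst hj
    rw [proj_of_mem hv]
  · rw [t.proj_of_ne hv hj, killing_wtSpace hv hu (by omega), map_zero, LinearMap.zero_apply]

theorem sum_proj (t : IsA2Frame e h f x y) :
    proj h 0 + proj h 2 + proj h (-2) + proj h 4 + proj h (-4) = 1 := by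
  refine t.hom_ext fun k v hv => ?_
  simp only [LinearMap.add_apply, Module.End.one_apply]
  by_cases h0 : k = 0
  · subst h0
    simp [proj_of_mem hv, t.proj_of_ne hv]
  by_cases h2 : k = 2
  · subst h2
    simp [proj_of_mem hv, t.proj_of_ne hv]
  by_cases h2' : k = -2
  · subst h2'
    simp [proj_of_mem hv, t.proj_of_ne hv]
  by_cases h4 : k = 4
  · subst h4
    simp [proj_of_mem hv, t.proj_of_ne hv]
  by_cases h4' : k = -4
  · subst h4'
    simp [proj_of_mem hv, t.proj_of_ne hv]
  · rw [t.wt k h0 h2 h2' h4 h4', Submodule.mem_bot] at hv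
    simp [hv]

theorem trace_eq (t : IsA2Frame e h f x y) (A : Module.End ℂ L) : LinearMap.trace ℂ L A =
    wtr h 0 A + wtr h 2 A + wtr h (-2) A + wtr h 4 A + wtr h (-4) A := by
  simp only [wtr, ← map_add, ← mul_add, t.sum_proj, mul_one]

theorem proj_mul (t : IsA2Frame e h f x y) {A : Module.End ℂ L} {i : ℤ} (hA : IsHomog h A i) (k : ℤ) :
    proj h (k + i) * A = A * proj h k := by
  refine t.hom_ext fun j v hv => ?_
  simp only [Module.End.mul_apply]
  by_cases hj : j = k
  · subst hj
    rw [proj_of_mem hv, proj_of_mem (hA _ _ hv)]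
  · rw [t.proj_of_ne hv hj, t.proj_of_ne (hA _ _ hv) (by omega), map_zero]

theorem wtr_mul_comm (t : IsA2Frame e h f x y) {A : Module.End ℂ L} {i k l : ℤ}
    (hA : IsHomog h A i) (hl : k + i = l) (B : Module.End ℂ L) :
    wtr h k (B * A) = wtr h l (A * B) := by
  rw [wtr, wtr, mul_assoc, ← t.proj_mul hA, hl, ← mul_assoc, LinearMap.trace_mul_comm, ← mul_assoc]

theorem ad_proj (t : IsA2Frame e h f x y) (k : ℤ) : ad ℂ L h * proj h k = (k : ℂ) • proj h k := by
  refine LinearMap.ext fun v => ?_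
  exact mem_wtSpace.mp (t.proj_mem k v)

theorem wtr_mul_ad (t : IsA2Frame e h f x y) (k : ℤ) (A : Module.End ℂ L) :
    wtr h k (A * ad ℂ L h) = k * wtr h k A := by
  rw [wtr, mul_assoc, t.ad_proj, mul_smul_comm, map_smul]; rfl

theorem wtr_four (t : IsA2Frame e h f x y) (A : Module.End ℂ L) :
    wtr h 4 A = killingForm ℂ L (A x) y / 60 := by
  have : A * proj h 4 = ((60 : ℂ)⁻¹ • (killingForm ℂ L).flip y).smulRight (A x) := by
    refine LinearMap.ext fun v => ?_
    rw [Module.End.mul_apply, t.eq_x _ (t.proj_mem 4 v), t.killing_proj t.y_mem, map_smul]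
    simp [div_eq_inv_mul]
  rw [wtr, this, LinearMap.trace_smulRight]
  simp [div_eq_inv_mul]

theorem wtr_neg_four (t : IsA2Frame e h f x y) (A : Module.End ℂ L) :
    wtr h (-4) A = killingForm ℂ L x (A y) / 60 := by
  have : A * proj h (-4) = ((60 : ℂ)⁻¹ • killingForm ℂ L x).smulRight (A y) := by
    refine LinearMap.ext fun v => ?_
    rw [Module.End.mul_apply, t.eq_y _ (t.proj_mem (-4) v), killing_symm,
      t.killing_proj (by simpa using t.x_mem), map_smul, killing_symm v x]
    simp [div_eq_inv_mul]
  rw [wtr, this, LinearMap.trace_smulRight]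
  simp [div_eq_inv_mul]

theorem killing_proj_left (t : IsA2Frame e h f x y) (k : ℤ) (u v : L) :
    killingForm ℂ L (proj h k u) v = killingForm ℂ L u (proj h (-k) v) := by
  rw [← t.killing_proj (t.proj_mem (-k) v), killing_symm, ← t.killing_proj (k := -k)
    (by simpa using t.proj_mem k u), killing_symm]

theorem wtr_adjoint (t : IsA2Frame e h f x y) {A B : Module.End ℂ L}
    (hAB : ∀ u v, killingForm ℂ L (A u) v = killingForm ℂ L u (B v)) (hB : IsHomog h B 0) (k : ℤ) :
    wtr h k A = wtr h (-k) B := by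
  rw [wtr, wtr, ← t.proj_mul hB, add_zero]
  refine trace_eq_of_adjoint t.nondeg fun u v => ?_
  rw [Module.End.mul_apply, Module.End.mul_apply, hAB, t.killing_proj_left]

end IsA2Frame

end EEight

namespace EEight

open LieAlgebra

variable {L : Type*} [LieRing L] [LieAlgebra ℂ L]

theorem killing_inv'' (a u v : L) : killingForm ℂ L ⁅a, u⁆ v = -killingForm ℂ L u ⁅a, v⁆ :=
  eq_neg_of_add_eq_zero_left (killing_inv' a u v)

theorem IsHomog.mul' {h : L} {A B : Module.End ℂ L} {i j k : ℤ} (hA : IsHomog h A i)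
    (hB : IsHomog h B j) (hk : i + j = k) : IsHomog h (A * B) k := hk ▸ hA.mul hB

namespace IsA2Frame

variable {e h f x y : L}

theorem lie_zero_x_of (t : IsA2Frame e h f x y) {b : L} (hb : b ∈ wtSpace h 0) :
    ⁅b, x⁆ = (killingForm ℂ L ⁅b, x⁆ y / 60) • x :=
  t.eq_x _ (lie_mem_wtSpace' hb t.x_mem (by norm_num))

theorem lie_zero_y_of (t : IsA2Frame e h f x y) {b : L} (hb : b ∈ wtSpace h 0) :
    ⁅b, y⁆ = -(killingForm ℂ L ⁅b, x⁆ y / 60) • y := by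
  rw [t.eq_y _ (lie_mem_wtSpace' hb t.y_mem (k := -4) (by norm_num)), killing_inv'' b x y, neg_div,
    neg_neg]

variable [FiniteDimensional ℂ L]

theorem wtr_ad_neg (t : IsA2Frame e h f x y) {b : L} (hb : b ∈ wtSpace h 0) (k : ℤ) :
    wtr h k (ad ℂ L b) = -wtr h (-k) (ad ℂ L b) := by
  rw [t.wtr_adjoint (B := -ad ℂ L b), ← neg_one_smul ℂ (ad ℂ L b), wtr_smul, neg_one_mul]
  · intro u v
    rw [LinearMap.neg_apply, map_neg, ad_apply, ad_apply, killing_inv'']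
  · intro k v hv
    exact Submodule.neg_mem _ (IsHomog.ad hb k v hv)

theorem killing_lie_x (t : IsA2Frame e h f x y) {b : L} (hb : b ∈ wtSpace h 0) :
    killingForm ℂ L ⁅b, x⁆ y = killingForm ℂ L h b / 2 := by
  have w4 := t.wtr_four (ad ℂ L b)
  have w4' := t.wtr_ad_neg hb 4
  rw [ad_apply] at w4
  have k1 : killingForm ℂ L h b = LinearMap.trace ℂ L (ad ℂ L b * ad ℂ L h) := by
    rw [killing_symm, killing_def]
  have k2 := tr4_three t.quartic_eq h b
  rw [← tr4_cycle b h h h, tr4, t.killing_h, t.trace_eq] at k2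
  rw [t.trace_eq] at k1
  simp only [t.wtr_mul_ad] at k1 k2
  push_cast at k1 k2
  linear_combination (-60) * w4 + (5/8) * (k2 / 100 + 4 * k1) + 30 * w4'

theorem lie_x_eq_zero (t : IsA2Frame e h f x y) {b : L} (hb : b ∈ wtSpace h 0)
    (hhb : killingForm ℂ L h b = 0) : ⁅b, x⁆ = 0 := by
  rw [t.lie_zero_x_of hb, t.killing_lie_x hb, hhb]; simp

theorem lie_y_eq_zero (t : IsA2Frame e h f x y) {b : L} (hb : b ∈ wtSpace h 0)
    (hhb : killingForm ℂ L h b = 0) : ⁅b, y⁆ = 0 := by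
  rw [t.lie_zero_y_of hb, t.killing_lie_x hb, hhb]; simp

theorem lie_x_y (t : IsA2Frame e h f x y) : ⁅x, y⁆ = (2 : ℂ)⁻¹ • h := by
  rw [← sub_eq_zero]
  refine t.eq_zero_of_killing t.nondeg (k := 0) (Submodule.sub_mem _
    (lie_mem_wtSpace' t.x_mem t.y_mem (by norm_num))
    (Submodule.smul_mem _ _ (IsTriple.h_mem h))) fun b hb => ?_
  rw [neg_zero] at hb
  have h1 := killing_inv b x y
  rw [t.killing_lie_x hb, killing_symm b] at h1
  rw [map_sub, LinearMap.sub_apply, map_smul, LinearMap.smul_apply, ← h1, smul_eq_mul]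
  ring

/-- The partial traces of a product of two elements of weight zero orthogonal to `h`. -/
theorem wtr_zero_mul (t : IsA2Frame e h f x y) {b c : L} (hb : b ∈ wtSpace h 0)
    (hc : c ∈ wtSpace h 0) (hhb : killingForm ℂ L h b = 0) (hhc : killingForm ℂ L h c = 0) :
    wtr h 2 (ad ℂ L b * ad ℂ L c) = killingForm ℂ L b c / 5 ∧
      wtr h 0 (ad ℂ L b * ad ℂ L c) = 3 * killingForm ℂ L b c / 5 := by
  have hb' : ⁅h, b⁆ = 0 := by rw [mem_wtSpace.mp hb]; simp
  have hc' : ⁅h, c⁆ = 0 := by rw [mem_wtSpace.mp hc]; simp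
  have w4 := t.wtr_four (ad ℂ L b * ad ℂ L c)
  have w4' := t.wtr_neg_four (ad ℂ L b * ad ℂ L c)
  simp only [Module.End.mul_apply, ad_apply, t.lie_x_eq_zero hc hhc, t.lie_y_eq_zero hc hhc,
    map_zero, LinearMap.zero_apply, zero_div] at w4 w4'
  have w2 : wtr h 2 (ad ℂ L b * ad ℂ L c) = wtr h (-2) (ad ℂ L b * ad ℂ L c) := by
    rw [t.wtr_adjoint (B := ad ℂ L c * ad ℂ L b) (fun u v => ?_) ((IsHomog.ad hc).mul' (IsHomog.ad hb) (by norm_num))]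
    · exact t.wtr_mul_comm (IsHomog.ad hb) (by norm_num) _
    · simp only [Module.End.mul_apply, ad_apply]
      rw [killing_inv'', killing_inv'', neg_neg]
  have k1 := t.trace_eq (ad ℂ L b * ad ℂ L c)
  rw [← killing_def] at k1
  have k2 := tr4_two t.quartic_eq h b c hb' hc'
  rw [tr4_cycle, tr4_cycle, tr4, t.trace_eq, hhb] at k2
  simp only [t.wtr_mul_ad, t.killing_h] at k2
  push_cast at k2
  rw [w4, w4'] at k1 k2
  constructor
  · linear_combination k2 / 2400 + w2 / 2
  · linear_combination -k1 - k2 / 1200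

end IsA2Frame

end EEight

namespace EEight

open LieAlgebra

variable {L : Type*} [LieRing L] [LieAlgebra ℂ L]

/-- The derived subalgebra of the centralizer of `e`, as a subspace. -/
noncomputable def derivedCent (e : L) : Submodule ℂ L :=
  Submodule.span ℂ {z : L | ∃ a ∈ LinearMap.ker (ad ℂ L e), ∃ b ∈ LinearMap.ker (ad ℂ L e), ⁅a, b⁆ = z}

theorem lie_mem_derivedCent {e a b : L} (ha : ⁅e, a⁆ = 0) (hb : ⁅e, b⁆ = 0) : ⁅a, b⁆ ∈ derivedCent e :=
  Submodule.subset_span ⟨a, ha, b, hb, rfl⟩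

theorem lie_lie_eq_zero {L : Type*} [LieRing L] {e a b : L} (hea : ⁅e, a⁆ = 0) (heb : ⁅e, b⁆ = 0) : ⁅e, ⁅a, b⁆⁆ = 0 := by
  rw [leibniz_lie, hea, heb, zero_lie, lie_zero, add_zero]

/-- The projection of the zero weight space to the centralizer of an `𝔰𝔩₂`-triple with the frame
vector `x`. -/
noncomputable def centProj (e f x : L) : Module.End ℂ L :=
  1 - (2 : ℂ)⁻¹ • (ad ℂ L f * ad ℂ L e) +
    (720 : ℂ)⁻¹ • ((killingForm ℂ L).flip ⁅f, ⁅f, x⁆⁆).smulRight ⁅f, ⁅f, x⁆⁆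

theorem centProj_apply (e f x v : L) : centProj e f x v = v - (2 : ℂ)⁻¹ • ⁅f, ⁅e, v⁆⁆ +
    (720 : ℂ)⁻¹ • killingForm ℂ L v ⁅f, ⁅f, x⁆⁆ • ⁅f, ⁅f, x⁆⁆ := rfl

namespace IsA2Frame

variable {e h f x y : L}

theorem lie_e_f_two (t : IsA2Frame e h f x y) {u : L} (hu : u ∈ wtSpace h 2) :
    ⁅e, ⁅f, u⁆⁆ = (2 : ℂ) • u + (killingForm ℂ L ⁅e, u⁆ y / 60) • ⁅f, x⁆ := by
  have h1 := t.lie_e_f hu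
  rw [t.eq_x _ (lie_mem_wtSpace' t.e_mem hu (by norm_num)), lie_smul] at h1
  rw [h1]; norm_num

theorem killing_ffx (t : IsA2Frame e h f x y) (v : L) :
    killingForm ℂ L v ⁅f, ⁅f, x⁆⁆ = killingForm ℂ L ⁅e, ⁅e, v⁆⁆ y := by
  rw [← t.lie_e_e_y, killing_inv'', killing_inv'', neg_neg]

theorem lie_e_centProj (t : IsA2Frame e h f x y) {v : L} (hv : v ∈ wtSpace h 0) :
    ⁅e, centProj e f x v⁆ = 0 := by
  rw [centProj_apply, t.killing_ffx, lie_add, lie_sub, lie_smul, lie_smul, lie_smul, t.lie_e_ffx,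
    t.lie_e_f_two (lie_mem_wtSpace' t.e_mem hv (by norm_num))]
  module

theorem centProj_mem (t : IsA2Frame e h f x y) {v : L} (hv : v ∈ wtSpace h 0) :
    centProj e f x v ∈ wtSpace h 0 := by
  rw [centProj_apply]
  refine Submodule.add_mem _ (Submodule.sub_mem _ hv (Submodule.smul_mem _ _ ?_))
    (Submodule.smul_mem _ _ (Submodule.smul_mem _ _ t.ffx_mem))
  exact lie_mem_wtSpace' t.f_mem (lie_mem_wtSpace' t.e_mem hv rfl) (by norm_num)

theorem lie_f_of_lie_e (t : IsA2Frame e h f x y) {z : L} (hz : z ∈ wtSpace h 0) (hez : ⁅e, z⁆ = 0) :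
    ⁅f, z⁆ = 0 := by
  refine t.eq_zero_of_neg (k := -2) (by norm_num) (lie_mem_wtSpace' t.f_mem hz (by norm_num)) ?_
  rw [t.lie_e_f hz, hez]; simp

theorem killing_h_of_lie_e (t : IsA2Frame e h f x y) {z : L} (hez : ⁅e, z⁆ = 0) :
    killingForm ℂ L h z = 0 := by
  rw [← t.ef, ← lie_skew, map_neg, LinearMap.neg_apply, killing_inv, hez, map_zero, neg_zero]

theorem killing_centProj (t : IsA2Frame e h f x y) {z : L} (hz : z ∈ wtSpace h 0) (hez : ⁅e, z⁆ = 0)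
    (g : L) : killingForm ℂ L z (centProj e f x g) = killingForm ℂ L z g := by
  rw [centProj_apply, map_add, map_sub, map_smul, map_smul, map_smul, ← killing_inv,
    ← lie_skew z f, t.lie_f_of_lie_e hz hez, t.killing_ffx z, hez]
  simp

variable [FiniteDimensional ℂ L]

theorem lie_ffx_of_lie_e (t : IsA2Frame e h f x y) {z : L} (hz : z ∈ wtSpace h 0)
    (hez : ⁅e, z⁆ = 0) : ⁅z, ⁅f, ⁅f, x⁆⁆⁆ = 0 := by
  have hf : ⁅z, f⁆ = 0 := by rw [← lie_skew, t.lie_f_of_lie_e hz hez, neg_zero]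
  rw [leibniz_lie, leibniz_lie z f x, hf, t.lie_x_eq_zero hz (t.killing_h_of_lie_e hez)]
  simp

/-- The trace formula for an operator vanishing on the centralizer of the triple. -/
theorem wtr_centProj (t : IsA2Frame e h f x y) {A : Module.End ℂ L}
    (hA : ∀ v ∈ wtSpace h 0, ⁅e, v⁆ = 0 → A v = 0) :
    wtr h 0 A - wtr h 0 (A * (ad ℂ L f * ad ℂ L e)) / 2 +
      killingForm ℂ L (A ⁅f, ⁅f, x⁆⁆) ⁅f, ⁅f, x⁆⁆ / 720 = 0 := by
  have h0 : wtr h 0 (A * centProj e f x) = 0 := by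
    rw [wtr]
    have : A * centProj e f x * proj h 0 = 0 := by
      refine LinearMap.ext fun v => ?_
      exact hA _ (t.centProj_mem (t.proj_mem 0 v)) (t.lie_e_centProj (t.proj_mem 0 v))
    rw [this, map_zero]
  have h1 : wtr h 0 (A * ((killingForm ℂ L).flip ⁅f, ⁅f, x⁆⁆).smulRight ⁅f, ⁅f, x⁆⁆) =
      killingForm ℂ L (A ⁅f, ⁅f, x⁆⁆) ⁅f, ⁅f, x⁆⁆ := by
    have : A * ((killingForm ℂ L).flip ⁅f, ⁅f, x⁆⁆).smulRight ⁅f, ⁅f, x⁆⁆ * proj h 0 =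
        ((killingForm ℂ L).flip ⁅f, ⁅f, x⁆⁆ ∘ₗ proj h 0).smulRight (A ⁅f, ⁅f, x⁆⁆) := by
      refine LinearMap.ext fun v => ?_
      exact map_smul A _ _
    rw [wtr, this, LinearMap.trace_smulRight]
    exact t.killing_proj (by simpa using t.ffx_mem) _
  rw [centProj, mul_add, mul_sub, wtr_add, wtr_sub, mul_smul_comm, wtr_smul, mul_smul_comm, wtr_smul,
    mul_one, h1] at h0
  linear_combination h0

theorem eq_zero_of_killing_cent (t : IsA2Frame e h f x y) {z : L} (hz : z ∈ wtSpace h 0)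
    (hez : ⁅e, z⁆ = 0) (hcz : ∀ v ∈ wtSpace h 0, ⁅e, v⁆ = 0 → killingForm ℂ L z v = 0) : z = 0 := by
  refine t.eq_zero_of_killing t.nondeg hz fun g hg => ?_
  rw [neg_zero] at hg
  rw [← t.killing_centProj hz hez, hcz _ (t.centProj_mem hg) (t.lie_e_centProj hg)]

/-- An element of the centralizer of the triple commuting with the centralizer is zero. -/
theorem eq_zero_of_central (t : IsA2Frame e h f x y) {z : L} (hz : z ∈ wtSpace h 0)
    (hez : ⁅e, z⁆ = 0) (hcz : ∀ v ∈ wtSpace h 0, ⁅e, v⁆ = 0 → ⁅z, v⁆ = 0) : z = 0 := by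
  refine t.eq_zero_of_killing_cent hz hez fun c hc hec => ?_
  rw [killing_symm]
  have hkz := t.killing_h_of_lie_e hez
  have hkc := t.killing_h_of_lie_e hec
  obtain ⟨w2, w0⟩ := t.wtr_zero_mul hc hz hkc hkz
  have h1 := t.wtr_centProj (A := ad ℂ L c * ad ℂ L z) fun v hv hev => by
    rw [Module.End.mul_apply, ad_apply, ad_apply, hcz v hv hev, lie_zero]
  have h2 : wtr h 0 (ad ℂ L c * ad ℂ L z * (ad ℂ L f * ad ℂ L e)) =
      2 * wtr h 2 (ad ℂ L c * ad ℂ L z) := by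
    rw [← mul_assoc, t.wtr_mul_comm (IsHomog.ad t.e_mem) (l := 2) (by norm_num), ← mul_assoc,
      ← mul_assoc, ad_mul_comm hec, mul_assoc (ad ℂ L c), ad_mul_comm hez, mul_assoc, mul_assoc]
    have := ad_eq_comm e f
    rw [t.ef, sub_eq_iff_eq_add] at this
    rw [this, mul_add, mul_add, wtr_add, ← mul_assoc, t.wtr_mul_ad, ← mul_assoc, ← mul_assoc,
      t.wtr_mul_comm (IsHomog.ad t.e_mem) (l := 4) (by norm_num), t.wtr_four]
    simp only [Module.End.mul_apply, ad_apply]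
    rw [leibniz_lie z f x, t.lie_x_eq_zero hz hkz, ← lie_skew z f, t.lie_f_of_lie_e hz hez]
    simp
  rw [h2, w0, w2, Module.End.mul_apply, ad_apply, ad_apply, t.lie_ffx_of_lie_e hz hez, lie_zero, map_zero,
    LinearMap.zero_apply] at h1
  linear_combination (5 / 2) * h1

theorem mem_derivedCent_zero (t : IsA2Frame e h f x y) {z : L} (hz : z ∈ wtSpace h 0)
    (hez : ⁅e, z⁆ = 0) : z ∈ derivedCent e := by
  refine mem_of_orthogonal t.nondeg _ _ fun z' hz' => ?_
  have hy0 := t.proj_mem 0 z'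
  have hz0 := t.centProj_mem hy0
  have hez0 := t.lie_e_centProj hy0
  have hk : ∀ u ∈ wtSpace h 0, ⁅e, u⁆ = 0 →
      killingForm ℂ L (centProj e f x (proj h 0 z')) u = killingForm ℂ L z' u := by
    intro u hu heu
    rw [killing_symm, t.killing_centProj hu heu, killing_symm, t.killing_proj (by simpa using hu)]
  have h0 : centProj e f x (proj h 0 z') = 0 := by
    refine t.eq_zero_of_central hz0 hez0 fun v hv hev => ?_
    refine t.eq_zero_of_killing_cent (lie_mem_wtSpace' hz0 hv (by norm_num))
      (lie_lie_eq_zero hez0 hev) fun b hb heb => ?_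
    rw [killing_inv, hk _ (lie_mem_wtSpace' hv hb (by norm_num)) (lie_lie_eq_zero hev heb)]
    exact hz' _ (lie_mem_derivedCent hev heb)
  rw [← hk z hz hez, h0, map_zero, LinearMap.zero_apply]

end IsA2Frame

end EEight

namespace EEight

open LieAlgebra

variable {L : Type*} [LieRing L] [LieAlgebra ℂ L]

namespace IsA2Frame

variable {e h f x y w v : L}

theorem lie_x_of_two (t : IsA2Frame e h f x y) (hw : w ∈ wtSpace h 2) : ⁅w, x⁆ = 0 :=
  t.eq_zero_of_mem (lie_mem_wtSpace hw t.x_mem) (by norm_num)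

theorem killing_h_lie_f (hw : w ∈ wtSpace h 2)
    (hfw : killingForm ℂ L f w = 0) : killingForm ℂ L h ⁅w, f⁆ = 0 := by
  rw [← killing_inv, mem_wtSpace.mp hw, map_smul, LinearMap.smul_apply, killing_symm, hfw, smul_zero]

theorem lie_e_lie_f (t : IsA2Frame e h f x y) (hw : w ∈ wtSpace h 2) (hew : ⁅e, w⁆ = 0) :
    ⁅e, ⁅w, f⁆⁆ = -(2 : ℂ) • w := by
  rw [← lie_skew w f, lie_neg, t.lie_e_f hw, hew, lie_zero, add_zero, ← neg_smul]; norm_num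

variable [FiniteDimensional ℂ L]

theorem lie_fx_of_two (t : IsA2Frame e h f x y) (hw : w ∈ wtSpace h 2)
    (hfw : killingForm ℂ L f w = 0) : ⁅w, ⁅f, x⁆⁆ = 0 := by
  rw [leibniz_lie, t.lie_x_eq_zero (lie_mem_wtSpace' hw t.f_mem (by norm_num))
    (killing_h_lie_f hw hfw), t.lie_x_of_two hw, lie_zero, add_zero]

theorem lie_ffx_x (t : IsA2Frame e h f x y) : ⁅⁅f, ⁅f, x⁆⁆, x⁆ = 0 := by
  refine t.lie_x_eq_zero t.ffx_mem ?_
  rw [← killing_inv, t.hf, map_smul, LinearMap.smul_apply, ← killing_inv, lie_self, map_zero,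
    LinearMap.zero_apply, smul_zero]

theorem lie_ffx_ffx (t : IsA2Frame e h f x y) (hw : w ∈ wtSpace h 2) (hew : ⁅e, w⁆ = 0)
    (hfw : killingForm ℂ L f w = 0) : ⁅⁅f, ⁅f, x⁆⁆, ⁅⁅f, ⁅f, x⁆⁆, w⁆⁆ = (4 : ℂ) • w := by
  have hb : ⁅w, f⁆ ∈ wtSpace h 0 := lie_mem_wtSpace' hw t.f_mem (by norm_num)
  have hhb := killing_h_lie_f hw hfw
  have heb := t.lie_e_lie_f hw hew
  have hwx := t.lie_x_of_two hw
  set b := ⁅w, f⁆ with hbw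
  have hu : ⁅b, f⁆ ∈ wtSpace h (-2) := lie_mem_wtSpace' hb t.f_mem (by norm_num)
  have hue : ⁅⁅b, f⁆, e⁆ = (2 : ℂ) • b := by
    have h1 : ⁅h, b⁆ = 0 := by rw [mem_wtSpace.mp hb]; simp
    rw [← lie_skew, leibniz_lie, heb, t.ef, smul_lie, ← hbw, ← lie_skew, h1]
    simp
  have h1 : ⁅w, ⁅f, ⁅f, x⁆⁆⁆ = ⁅⁅b, f⁆, x⁆ := by
    rw [leibniz_lie, t.lie_fx_of_two hw hfw, lie_zero, add_zero, ← hbw, leibniz_lie,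
      t.lie_x_eq_zero hb hhb, lie_zero, add_zero]
  have h2 : ⁅⁅b, f⁆, ⁅e, y⁆⁆ = 0 := by
    have : ⁅⁅b, f⁆, y⁆ = 0 :=
      t.eq_zero_of_mem (lie_mem_wtSpace hu t.y_mem) (by norm_num)
    rw [leibniz_lie, hue, smul_lie, t.lie_y_eq_zero hb hhb, this]
    simp
  have h3 : ⁅⁅b, f⁆, ⁅f, ⁅f, x⁆⁆⁆ = (4 : ℂ) • ⁅w, y⁆ := by
    rw [← t.lie_e_e_y, leibniz_lie, h2, lie_zero, add_zero, hue, smul_lie, leibniz_lie,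
      t.lie_y_eq_zero hb hhb, lie_zero, add_zero, ← lie_skew b e, heb, ← neg_smul, smul_lie, smul_smul]
    norm_num
  rw [← lie_skew _ w, h1, lie_skew x ⁅b, f⁆, leibniz_lie, t.lie_ffx_x, zero_lie, zero_add,
    ← lie_skew _ ⁅b, f⁆, h3, lie_neg, lie_smul, leibniz_lie, ← lie_skew x w, hwx, t.lie_x_y, lie_smul,
    ← lie_skew w h, mem_wtSpace.mp hw, neg_zero, zero_lie]
  push_cast
  module

/-- The pairing between the highest weight vectors of weight `2` orthogonal to `f` and the lowest weight
vectors annihilated by the centralizer of the triple is zero. -/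
theorem killing_eq_zero_of_cent (t : IsA2Frame e h f x y) (hw : w ∈ wtSpace h 2) (hew : ⁅e, w⁆ = 0)
    (hfw : killingForm ℂ L f w = 0) (hv : v ∈ wtSpace h (-2)) (hfv : ⁅f, v⁆ = 0)
    (hev : killingForm ℂ L e v = 0) (hcv : ∀ a ∈ wtSpace h 0, ⁅e, a⁆ = 0 → ⁅v, a⁆ = 0) :
    killingForm ℂ L v w = 0 := by
  have hwx := t.lie_x_of_two hw
  have haw := IsHomog.ad hw
  have hav := IsHomog.ad hv
  have hae := IsHomog.ad t.e_mem
  have haf := IsHomog.ad t.f_mem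
  have h1 := t.wtr_centProj (A := ad ℂ L w * ad ℂ L v) fun u hu heu => by
    rw [Module.End.mul_apply, ad_apply, ad_apply, hcv u hu heu, lie_zero]
  have hx : killingForm ℂ L ⁅w, ⁅v, x⁆⁆ y = killingForm ℂ L v w := by
    rw [leibniz_lie, hwx, lie_zero, add_zero,
      t.killing_lie_x (lie_mem_wtSpace' hw hv (by norm_num)), ← killing_inv, mem_wtSpace.mp hw, map_smul,
      LinearMap.smul_apply, smul_eq_mul, killing_symm v w]
    push_cast
    ring
  -- the partial traces of `ad w * ad v`
  have s0 : wtr h 0 (ad ℂ L w * ad ℂ L v) = 29 / 60 * killingForm ℂ L v w := by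
    have shift (k l : ℤ) (hl : k + -2 = l) : wtr h k (ad ℂ L w * ad ℂ L v) =
        wtr h l (ad ℂ L v * ad ℂ L w) := t.wtr_mul_comm hav hl _
    have adj (k : ℤ) : wtr h k (ad ℂ L w * ad ℂ L v) = wtr h (-k) (ad ℂ L v * ad ℂ L w) := by
      refine t.wtr_adjoint (fun a b => ?_) (hav.mul' haw (by norm_num)) k
      simp only [Module.End.mul_apply, ad_apply]
      rw [killing_inv'', killing_inv'', neg_neg]
    have t4 : wtr h 4 (ad ℂ L v * ad ℂ L w) = 0 := by
      rw [t.wtr_four, Module.End.mul_apply, ad_apply, ad_apply, hwx]; simp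
    have s4 := t.wtr_four (ad ℂ L w * ad ℂ L v)
    rw [Module.End.mul_apply, ad_apply, ad_apply, hx] at s4
    have tr := t.trace_eq (ad ℂ L w * ad ℂ L v)
    rw [← killing_def, killing_symm] at tr
    have e1 := shift 0 (-2) (by norm_num)
    have e2 := shift 2 0 (by norm_num)
    have e3 := shift 4 2 (by norm_num)
    have e4 := adj 0
    have e5 := adj (-2)
    have e6 := adj (-4)
    rw [neg_neg] at e5 e6
    rw [neg_zero] at e4
    linear_combination (e4 - e2 - tr - e5 + e3 - 2 * s4 - e6 - t4) / 2
  have s1 : wtr h 0 (ad ℂ L w * ad ℂ L v * (ad ℂ L f * ad ℂ L e)) =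
      2 / 5 * killingForm ℂ L v w := by
    have ha : ⁅e, v⁆ ∈ wtSpace h 0 := lie_mem_wtSpace' t.e_mem hv (by norm_num)
    have hb : ⁅w, f⁆ ∈ wtSpace h 0 := lie_mem_wtSpace' hw t.f_mem (by norm_num)
    have hhb := killing_h_lie_f hw hfw
    have hha : killingForm ℂ L h ⁅e, v⁆ = 0 := by
      rw [← killing_inv, mem_wtSpace.mp t.e_mem, map_smul, LinearMap.smul_apply, hev, smul_zero]
    have heb := t.lie_e_lie_f hw hew
    have hax := t.lie_x_eq_zero ha hha
    have hfa : ⁅⁅e, v⁆, f⁆ = -(2 : ℂ) • v := by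
      have := t.lie_e_f hv
      rw [hfv, lie_zero] at this
      push_cast at this
      rw [← lie_skew, ← sub_eq_zero, ← neg_eq_zero, this]
      module
    have c1 : ad ℂ L e * ad ℂ L v = ad ℂ L ⁅e, v⁆ + ad ℂ L v * ad ℂ L e :=
      sub_eq_iff_eq_add.mp (ad_eq_comm e v)
    have c2 : ad ℂ L w * ad ℂ L f = ad ℂ L ⁅w, f⁆ + ad ℂ L f * ad ℂ L w :=
      sub_eq_iff_eq_add.mp (ad_eq_comm w f)
    have c3 : ad ℂ L e * ad ℂ L f = ad ℂ L h + ad ℂ L f * ad ℂ L e := by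
      rw [← t.ef]; exact sub_eq_iff_eq_add.mp (ad_eq_comm e f)
    have p1 : wtr h 0 (ad ℂ L w * ad ℂ L v * (ad ℂ L f * ad ℂ L e)) =
        wtr h 0 (ad ℂ L e * ad ℂ L f * (ad ℂ L v * ad ℂ L w)) := by
      refine (t.wtr_adjoint (fun a b => ?_)
        ((hae.mul' haf (k := 0) (by norm_num)).mul' (hav.mul' haw (k := 0) (by norm_num))
          (by norm_num)) 0).trans (by rw [neg_zero])
      simp only [Module.End.mul_apply, ad_apply]
      rw [killing_inv'', killing_inv'', killing_inv'', killing_inv'', neg_neg, neg_neg]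
    have p2 : wtr h 0 (ad ℂ L h * (ad ℂ L v * ad ℂ L w)) = 0 := by
      rw [t.wtr_mul_comm (hav.mul' haw (k := 0) (by norm_num)) (add_zero _), t.wtr_mul_ad]
      simp
    have p3 : wtr h 0 (ad ℂ L f * ad ℂ L e * (ad ℂ L v * ad ℂ L w)) =
        wtr h 2 (ad ℂ L e * ad ℂ L v * (ad ℂ L w * ad ℂ L f)) := by
      rw [mul_assoc, ← t.wtr_mul_comm haf (k := 2) (by norm_num)]
      simp only [mul_assoc]
    have q1 : wtr h 2 (ad ℂ L ⁅e, v⁆ * ad ℂ L ⁅w, f⁆) = 2 / 5 * killingForm ℂ L v w := by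
      rw [(t.wtr_zero_mul ha hb hha hhb).1, killing_inv'', heb, map_smul, smul_eq_mul]
      ring
    have q2 : wtr h 2 (ad ℂ L ⁅e, v⁆ * (ad ℂ L f * ad ℂ L w)) = -2 / 60 * killingForm ℂ L v w := by
      rw [← mul_assoc, t.wtr_mul_comm haw (l := 4) (by norm_num), t.wtr_four]
      simp only [Module.End.mul_apply, ad_apply]
      rw [leibniz_lie ⁅e, v⁆ f x, hfa, hax, lie_zero, add_zero, smul_lie, lie_smul, map_smul,
        LinearMap.smul_apply, hx, smul_eq_mul]
      ring
    have q3 : wtr h 2 (ad ℂ L v * ad ℂ L e * ad ℂ L ⁅w, f⁆) = -2 / 60 * killingForm ℂ L v w := by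
      have h0 : ⁅e, ⁅v, x⁆⁆ = 0 := by
        rw [leibniz_lie, hax, t.lie_e_x, lie_zero, add_zero]
      rw [mul_assoc, ← t.wtr_mul_comm hav (k := 4) (by norm_num), t.wtr_four]
      simp only [Module.End.mul_apply, ad_apply]
      rw [leibniz_lie e ⁅w, f⁆ ⁅v, x⁆, h0, lie_zero, add_zero, heb, smul_lie, map_smul,
        LinearMap.smul_apply, hx, smul_eq_mul]
      ring
    have q4 : wtr h 2 (ad ℂ L v * ad ℂ L e * (ad ℂ L f * ad ℂ L w)) =
        4 / 60 * killingForm ℂ L v w := by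
      rw [← mul_assoc, t.wtr_mul_comm haw (l := 4) (by norm_num), t.wtr_four]
      simp only [Module.End.mul_apply, ad_apply]
      rw [t.lie_e_fx, lie_smul, lie_smul, map_smul, LinearMap.smul_apply, hx, smul_eq_mul]
      ring
    rw [p1, c3, add_mul, wtr_add, p2, p3, c1, c2, add_mul, mul_add, mul_add, wtr_add, wtr_add, wtr_add,
      q1, q2, q3, q4]
    ring
  have s2 : killingForm ℂ L ((ad ℂ L w * ad ℂ L v) ⁅f, ⁅f, x⁆⁆) ⁅f, ⁅f, x⁆⁆ =
      4 * killingForm ℂ L v w := by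
    rw [Module.End.mul_apply, ad_apply, ad_apply, killing_inv'', ← lie_skew w, map_neg, neg_neg,
      killing_inv, t.lie_ffx_ffx hw hew hfw, map_smul, smul_eq_mul]
  rw [s0, s1, s2] at h1
  linear_combination 45 / 13 * h1

end IsA2Frame

end EEight

namespace EEight

open LieAlgebra

variable {L : Type*} [LieRing L] [LieAlgebra ℂ L]

namespace IsA2Frame

variable {e h f x y : L}

theorem exists_decomp_two (t : IsA2Frame e h f x y) {g : L} (hg : g ∈ wtSpace h 2) :
    ∃ w ∈ wtSpace h 2, ⁅e, w⁆ = 0 ∧ ∃ c : ℂ, g = w + c • ⁅f, x⁆ := by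
  refine ⟨g - (killingForm ℂ L ⁅e, g⁆ y / 240) • ⁅f, x⁆, Submodule.sub_mem _ hg
    (Submodule.smul_mem _ _ t.fx_mem), ?_, _, (sub_add_cancel _ _).symm⟩
  have := t.eq_x _ (lie_mem_wtSpace' t.e_mem hg (by norm_num))
  rw [lie_sub, lie_smul, t.lie_e_fx, sub_eq_zero, smul_smul]
  refine this.trans ?_
  congr 1
  ring

variable [FiniteDimensional ℂ L]

theorem mem_derivedCent_two (t : IsA2Frame e h f x y) {w : L} (hw : w ∈ wtSpace h 2) (hew : ⁅e, w⁆ = 0)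
    (hfw : killingForm ℂ L f w = 0) : w ∈ derivedCent e := by
  refine mem_of_orthogonal t.nondeg _ _ fun z' hz' => ?_
  set v := proj h (-2) z' with hv_def
  have hv : v ∈ wtSpace h (-2) := t.proj_mem (-2) z'
  have hey : ⁅e, y⁆ ∈ wtSpace h (-2) := lie_mem_wtSpace' t.e_mem t.y_mem (by norm_num)
  set v' := v - (killingForm ℂ L e v / 240) • f - (killingForm ℂ L x ⁅f, v⁆ / 240) • ⁅e, y⁆ with hv'_def
  have hv' : v' ∈ wtSpace h (-2) := Submodule.sub_mem _ (Submodule.sub_mem _ hv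
    (Submodule.smul_mem _ _ t.f_mem)) (Submodule.smul_mem _ _ hey)
  have hfv' : ⁅f, v'⁆ = 0 := by
    have := t.eq_y _ (lie_mem_wtSpace' t.f_mem hv (by norm_num))
    rw [hv'_def, lie_sub, lie_sub, lie_smul, lie_smul, lie_self, smul_zero, sub_zero, t.lie_f_ey,
      sub_eq_zero, smul_smul]
    refine this.trans ?_
    congr 1
    ring
  have hev' : killingForm ℂ L e v' = 0 := by
    rw [hv'_def, map_sub, map_sub, map_smul, map_smul, t.killing_ef, ← killing_inv e e y, lie_self, map_zero,
      LinearMap.zero_apply, smul_eq_mul, smul_zero]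
    ring
  have hk : ∀ u ∈ wtSpace h 2, ⁅e, u⁆ = 0 → killingForm ℂ L f u = 0 →
      killingForm ℂ L v' u = killingForm ℂ L z' u := by
    intro u hu heu hfu
    rw [hv'_def, map_sub, map_sub, LinearMap.sub_apply, LinearMap.sub_apply, map_smul, map_smul,
      LinearMap.smul_apply, LinearMap.smul_apply, hfu, killing_inv'', heu, map_zero, hv_def,
      t.killing_proj (by simpa using hu)]
    simp
  rw [← hk w hw hew hfw]
  refine t.killing_eq_zero_of_cent hw hew hfw hv' hfv' hev' fun a ha hea => ?_
  have hfa := t.lie_f_of_lie_e ha hea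
  refine t.eq_zero_of_killing t.nondeg (lie_mem_wtSpace' hv' ha (k := -2) (by norm_num))
    fun g hg => ?_
  rw [neg_neg] at hg
  obtain ⟨w', hw', hew', c, rfl⟩ := t.exists_decomp_two hg
  have h1 : killingForm ℂ L ⁅v', a⁆ w' = 0 := by
    rw [killing_inv, hk _ (lie_mem_wtSpace' ha hw' (by norm_num)) (lie_lie_eq_zero hea hew')]
    · exact hz' _ (lie_mem_derivedCent hea hew')
    · rw [← killing_inv, hfa, map_zero, LinearMap.zero_apply]
  have h2 : ⁅a, ⁅f, x⁆⁆ = 0 := by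
    rw [leibniz_lie, ← lie_skew a f, hfa, t.lie_x_eq_zero ha (t.killing_h_of_lie_e hea)]
    simp
  rw [map_add, h1, map_smul, killing_inv, h2, map_zero, smul_zero, add_zero]

theorem exists_two (t : IsA2Frame e h f x y) :
    ∃ w ∈ wtSpace h 2, w ≠ 0 ∧ ⁅e, w⁆ = 0 ∧ killingForm ℂ L f w = 0 := by
  let φ : wtSpace h 2 →ₗ[ℂ] ℂ × ℂ :=
    (((killingForm ℂ L).flip y ∘ₗ (ad ℂ L e : L →ₗ[ℂ] L)).prod (killingForm ℂ L f)) ∘ₗ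
      (wtSpace h 2).subtype
  have hφ : LinearMap.ker φ ≠ ⊥ := LinearMap.ker_ne_bot_of_finrank_lt (by
    rw [t.finrank_two, Module.finrank_prod, Module.finrank_self]; norm_num)
  obtain ⟨⟨w, hw⟩, hker, hne⟩ := (Submodule.ne_bot_iff _).mp hφ
  have h1 : (killingForm ℂ L ⁅e, w⁆ y, killingForm ℂ L f w) = 0 := hker
  rw [Prod.mk_eq_zero] at h1
  refine ⟨w, hw, fun h0 => hne (Subtype.ext h0), ?_, h1.2⟩
  rw [t.eq_x _ (lie_mem_wtSpace' t.e_mem hw (by norm_num)), h1.1, zero_div, zero_smul]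

theorem mem_derivedCent_four (t : IsA2Frame e h f x y) : x ∈ derivedCent e := by
  obtain ⟨w, hw, hw0, hew, hfw⟩ := t.exists_two
  have hex : ∃ w' ∈ wtSpace h 2, ⁅e, w'⁆ = 0 ∧ ⁅w, w'⁆ ≠ 0 := by
    by_contra! hall
    have hy : ⁅y, w⁆ = 0 := by
      refine t.eq_zero_of_killing t.nondeg (lie_mem_wtSpace' t.y_mem hw (k := -2) (by norm_num))
        fun g hg => ?_
      rw [neg_neg] at hg
      obtain ⟨w', hw', hew', c, rfl⟩ := t.exists_decomp_two hg
      rw [killing_inv, lie_add, lie_smul, hall w' hw' hew', t.lie_fx_of_two hw hfw]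
      simp
    have h1 := leibniz_lie x y w
    rw [hy, t.lie_x_y, smul_lie, mem_wtSpace.mp hw, ← lie_skew x w, t.lie_x_of_two hw] at h1
    simp only [neg_zero, lie_zero, add_zero] at h1
    rw [smul_smul, eq_comm, smul_eq_zero] at h1
    exact h1.elim (by norm_num) hw0
  obtain ⟨w', hw', hew', hne⟩ := hex
  have h1 := t.eq_x _ (lie_mem_wtSpace' hw hw' (by norm_num))
  set c := killingForm ℂ L ⁅w, w'⁆ y / 60
  have hc : c ≠ 0 := by
    intro h0
    rw [h0, zero_smul] at h1
    exact hne h1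
  have h2 : x = c⁻¹ • ⁅w, w'⁆ := by rw [h1, smul_smul, inv_mul_cancel₀ hc, one_smul]
  rw [h2]
  exact Submodule.smul_mem _ _ (lie_mem_derivedCent hew hew')

/-- The decomposition of the centralizer of `e` into weight spaces. -/
theorem exists_decomp (t : IsA2Frame e h f x y) {z : L} (hz : ⁅e, z⁆ = 0) :
    ∃ z₀ ∈ wtSpace h 0, ∃ z₂ ∈ wtSpace h 2, ∃ z₄ ∈ wtSpace h 4,
      ⁅e, z₀⁆ = 0 ∧ ⁅e, z₂⁆ = 0 ∧ z = z₀ + z₂ + z₄ := by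
  have hp : ∀ k, ⁅e, proj h k z⁆ = 0 := by
    intro k
    have h1 := LinearMap.congr_fun (t.proj_mul (IsHomog.ad t.e_mem) k) z
    simp only [Module.End.mul_apply, ad_apply, hz, map_zero] at h1
    exact h1.symm
  refine ⟨_, t.proj_mem 0 z, _, t.proj_mem 2 z, _, t.proj_mem 4 z, hp 0, hp 2, ?_⟩
  have h1 := LinearMap.congr_fun t.sum_proj z
  simp only [LinearMap.add_apply, Module.End.one_apply] at h1
  rw [t.eq_zero_of_neg (by norm_num) (t.proj_mem (-2) z) (hp (-2)),
    t.eq_zero_of_neg (by norm_num) (t.proj_mem (-4) z) (hp (-4)), add_zero, add_zero] at h1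
  exact h1.symm

theorem mem_derivedCent_iff (t : IsA2Frame e h f x y) (z : L) :
    z ∈ derivedCent e ↔ ⁅e, z⁆ = 0 ∧ killingForm ℂ L f z = 0 := by
  constructor
  · intro hz
    have hle : derivedCent e ≤ LinearMap.ker (ad ℂ L e) ⊓ LinearMap.ker (killingForm ℂ L f) := by
      refine Submodule.span_le.mpr ?_
      rintro _ ⟨a, ha, b, hb, rfl⟩
      refine ⟨lie_lie_eq_zero ha hb, ?_⟩
      obtain ⟨a₀, ha₀, a₂, ha₂, a₄, ha₄, hea₀, hea₂, rfl⟩ := t.exists_decomp ha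
      obtain ⟨b₀, hb₀, b₂, hb₂, b₄, hb₄, heb₀, heb₂, rfl⟩ := t.exists_decomp hb
      have hfa₂ : ⁅f, a₂⁆ ∈ wtSpace h 0 := lie_mem_wtSpace' t.f_mem ha₂ (by norm_num)
      have hfa₄ : ⁅f, a₄⁆ ∈ wtSpace h 2 := lie_mem_wtSpace' t.f_mem ha₄ (by norm_num)
      change killingForm ℂ L f _ = 0
      rw [← killing_inv, lie_add, lie_add, t.lie_f_of_lie_e ha₀ hea₀, zero_add]
      simp only [map_add, LinearMap.add_apply]
      rw [killing_wtSpace hfa₂ hb₂ (by norm_num), killing_wtSpace hfa₂ hb₄ (by norm_num),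
        killing_wtSpace hfa₄ hb₀ (by norm_num), killing_wtSpace hfa₄ hb₂ (by norm_num),
        killing_wtSpace hfa₄ hb₄ (by norm_num), killing_inv'', t.lie_f_of_lie_e hb₀ heb₀]
      simp
    exact hle hz
  · rintro ⟨hez, hfz⟩
    obtain ⟨z₀, hz₀, z₂, hz₂, z₄, hz₄, hez₀, hez₂, rfl⟩ := t.exists_decomp hez
    rw [map_add, map_add, killing_wtSpace t.f_mem hz₀ (by norm_num),
      killing_wtSpace t.f_mem hz₄ (by norm_num), zero_add, add_zero] at hfz
    refine Submodule.add_mem _ (Submodule.add_mem _ (t.mem_derivedCent_zero hz₀ hez₀)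
      (t.mem_derivedCent_two hz₂ hez₂ hfz)) ?_
    rw [t.eq_x _ hz₄]
    exact Submodule.smul_mem _ _ t.mem_derivedCent_four

theorem notMem_derivedCent (t : IsA2Frame e h f x y) : e ∉ derivedCent e := by
  rw [t.mem_derivedCent_iff, killing_symm, t.killing_ef]
  norm_num

theorem finrank_derivedCent (t : IsA2Frame e h f x y) : Module.finrank ℂ (derivedCent e) + 1 =
    Module.finrank ℂ (LinearMap.ker (ad ℂ L e)) := by
  let φ : Module.Dual ℂ (LinearMap.ker (ad ℂ L e)) :=
    killingForm ℂ L f ∘ₗ (LinearMap.ker (ad ℂ L e)).subtype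
  have hφ : φ ≠ 0 := by
    intro h0
    have h1 : killingForm ℂ L f e = 0 := LinearMap.congr_fun h0 ⟨e, lie_self e⟩
    rw [killing_symm, t.killing_ef] at h1
    norm_num at h1
  have hmap : (LinearMap.ker φ).map (LinearMap.ker (ad ℂ L e)).subtype = derivedCent e := by
    ext z
    rw [t.mem_derivedCent_iff]
    constructor
    · rintro ⟨⟨z, hz⟩, h1, rfl⟩
      exact ⟨hz, h1⟩
    · rintro ⟨hz, h1⟩
      exact ⟨⟨z, hz⟩, h1, rfl⟩
  rw [← hmap, Submodule.finrank_map_subtype_eq]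
  exact Module.Dual.finrank_ker_add_one_of_ne_zero hφ

end IsA2Frame

end EEight

/-- In type E₈, for nilpotent `e` with `dim g_e = 134` one has `dim [g_e,g_e] = 133`
and `e ∉ [g_e,g_e]`. -/
theorem dim134_E8 (e : LieAlgebra.e₈ ℂ)
    (hnil : IsNilpotent (LieAlgebra.ad ℂ (LieAlgebra.e₈ ℂ) e))
    (hdim : Module.finrank ℂ ↥(centralizer e) = 134) :
    Module.finrank ℂ ↥(derived e) = 133 ∧ e ∉ derived e := by
  have hdim' : Module.finrank ℂ (LinearMap.ker (LieAlgebra.ad ℂ (LieAlgebra.e₈ ℂ) e)) = 134 := hdim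
  have hnt : Nontrivial (LieAlgebra.e₈ ℂ) := by
    by_contra hs
    rw [not_nontrivial_iff_subsingleton] at hs
    rw [Module.finrank_zero_of_subsingleton] at hdim'
    norm_num at hdim'
  have S := EEight.isSerre_e8
  have hfin : FiniteDimensional ℂ (LieAlgebra.e₈ ℂ) := S.finite
  have hκ : ∀ z : LieAlgebra.e₈ ℂ, (∀ y, killingForm ℂ (LieAlgebra.e₈ ℂ) z y = 0) → z = 0 :=
    fun z hz => S.killing_nondegenerate hz
  obtain ⟨h, f, he, hef, hf⟩ := EEight.jacobson_morozov hκ hnil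
  have t : EEight.IsTriple e h f := ⟨he, hef, hf, hnil⟩
  obtain ⟨x, y, T⟩ := (t.isA2Triple hκ S.quartic_eq_zero S.finrank_eq hdim').exists_frame
  have h1 := T.finrank_derivedCent
  rw [hdim'] at h1
  exact ⟨Nat.succ.inj h1, T.notMem_derivedCent⟩
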